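/- Let α ≤ 0 and let Ω ⊂ ℝ² be a bounded C² domain with outer perimeter L₀ and area A₀. Set r₁ := √(L₀² − 4π·A₀)/(2π) and r₂ := L₀/(2π). Then λ₁^α(Ω) ≤ μ₁^α(A_{r₁,r₂}), where μ₁^α(A_{r₁,r₂}) is the first eigenvalue of the Laplacian on the annulus A_{r₁,r₂} (which has the same area as Ω) with Robin condition with parameter α on the outer circle and Neumann condition on the inner circle. -/

import Mathlib

open MeasureTheory Metric Filter Asymptotics Real RealInnerProductSpace

noncomputable section

abbrev Eu (d : ℕ) := EuclideanSpace ℝ (Fin d)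

/-- The set of Rayleigh quotient values of nonzero Lipschitz test functions for the
Robin problem with boundary parameter `α` on `Ω ⊆ ℝ^d`. -/
def robinRayleighSet (d : ℕ) (α : ℝ) (Ω : Set (Eu d)) : Set ℝ :=
  { lam : ℝ | ∃ (u : Eu d → ℝ) (K : NNReal),
      LipschitzOnWith K u (closure Ω) ∧
      (∫ x in Ω, (u x) ^ 2) ≠ 0 ∧
      lam = ((∫ x in Ω, ‖fderiv ℝ u x‖ ^ 2)
              + α * ∫ x in frontier Ω, (u x) ^ 2 ∂(μH[(d : ℝ) - 1]))
            / (∫ x in Ω, (u x) ^ 2) }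

/-- The first Robin eigenvalue `λ₁^α(Ω)`, defined variationally. -/
def robinEig (d : ℕ) (α : ℝ) (Ω : Set (Eu d)) : ℝ :=
  sInf (robinRayleighSet d α Ω)

/-- A `C²` Jordan curve in the plane: a periodic, regular, `C²` curve which is
injective on a period. -/
def IsC2JordanCurve (γ : ℝ → Eu 2) : Prop :=
  ContDiff ℝ 2 γ ∧ Function.Periodic γ 1 ∧
  (∀ s ∈ Set.Ico (0 : ℝ) 1, ∀ t ∈ Set.Ico (0 : ℝ) 1, γ s = γ t → s = t) ∧
  ∀ t, deriv γ t ≠ 0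

/-- A bounded planar `C²` domain: a bounded open connected set whose boundary is a
finite disjoint union of `C²` Jordan curves. -/
def IsC2Domain (Ω : Set (Eu 2)) : Prop :=
  IsOpen Ω ∧ IsConnected Ω ∧ Bornology.IsBounded Ω ∧
  ∃ (N : ℕ) (γ : Fin N → ℝ → Eu 2),
    (∀ i, IsC2JordanCurve (γ i)) ∧
    (∀ i j, i ≠ j → Disjoint (Set.range (γ i)) (Set.range (γ j))) ∧
    frontier Ω = ⋃ i, Set.range (γ i)

/-- The unbounded connected component of the complement of the closure of `Ω`. -/
def unboundedPart (Ω : Set (Eu 2)) : Set (Eu 2) :=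
  {x | x ∈ (closure Ω)ᶜ ∧ ¬ Bornology.IsBounded (connectedComponentIn (closure Ω)ᶜ x)}

/-- The outer boundary `Γ₀` of `Ω`: the boundary of the unbounded component of the
complement of the closure of `Ω`. -/
def outerBoundary (Ω : Set (Eu 2)) : Set (Eu 2) :=
  frontier (unboundedPart Ω)

/-- The open region `Ω₀` enclosed by the outer boundary of `Ω`. -/
def innerRegion (Ω : Set (Eu 2)) : Set (Eu 2) :=
  (closure (unboundedPart Ω))ᶜ

/-- The inner radius `R` of the region enclosed by the outer boundary of `Ω`. -/
def innerRadius (Ω : Set (Eu 2)) : ℝ :=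
  sSup ((fun x => infDist x (outerBoundary Ω)) '' innerRegion Ω)

/-- The outer perimeter `L₀ = H¹(Γ₀)`. -/
def outerPerim (Ω : Set (Eu 2)) : ℝ :=
  (μH[1] (outerBoundary Ω)).toReal

/-- `A(t)`, the area of the part of the `t`-neighbourhood of the outer boundary lying
inside `Ω`. -/
def areaFn (Ω : Set (Eu 2)) (t : ℝ) : ℝ :=
  (volume {x ∈ Ω | infDist x (outerBoundary Ω) < t}).toReal

/-- `L(t)`, the length of the part of the level curve at distance `t` from the outer
boundary that lies inside `Ω`. -/
def lenFn (Ω : Set (Eu 2)) (t : ℝ) : ℝ :=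
  (μH[1] {x ∈ Ω | infDist x (outerBoundary Ω) = t}).toReal

/-- The first eigenvalue `μ₁^α(A_{r₁,r₂})` of the Laplacian on the planar annulus
`A_{r₁,r₂}` with Robin boundary condition (parameter `α`) on the outer circle and
Neumann condition on the inner circle, defined variationally. -/
def nrEig (α r₁ r₂ : ℝ) : ℝ :=
  sInf { lam : ℝ | ∃ ψ : ℝ → ℝ, ContDiff ℝ (⊤ : ℕ∞) ψ ∧
    (∫ r in r₁..r₂, (ψ r) ^ 2 * r) ≠ 0 ∧
    lam = ((∫ r in r₁..r₂, (deriv ψ r) ^ 2 * r) + α * r₂ * (ψ r₂) ^ 2)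
          / (∫ r in r₁..r₂, (ψ r) ^ 2 * r) }

/-- The coefficients `cₙ` of the power series in `k` of the solution `F` of the radial
equation with eigenvalue parameter `k`, with value `1` and derivative `0` at `a`. -/
def radialCoeff (a : ℝ) : ℕ → ℝ → ℝ
  | 0 => fun _ => 1
  | n + 1 => fun r => ∫ s in a..r, (∫ σ in a..s, σ * radialCoeff a n σ) / s

lemma continuousOn_mean {a b : ℝ} (ha : 0 ≤ a) (hab : a < b) {f : ℝ → ℝ}
    (hf : ContinuousOn f (Set.Icc a b)) :
    ContinuousOn (fun s => (∫ σ in a..s, σ * f σ) / s) (Set.Icc a b) := by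
  have hg : ContinuousOn (fun σ => σ * f σ) (Set.Icc a b) := continuousOn_id.mul hf
  have hint : ContinuousOn (fun s => ∫ σ in a..s, σ * f σ) (Set.Icc a b) := by
    have := intervalIntegral.continuousOn_primitive_interval
      (μ := volume) (f := fun σ => σ * f σ) (a := a) (b := b)
      ((hg.integrableOn_Icc).mono_set (by rw [Set.uIcc_of_le hab.le]))
    rwa [Set.uIcc_of_le hab.le] at this
  obtain ⟨M, hM⟩ := isCompact_Icc.exists_bound_of_continuousOn hf
  intro s hs
  rcases eq_or_lt_of_le (ha.trans hs.1) with h0 | h0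
  · -- `s = 0 = a`
    have ha0 : a = 0 := le_antisymm (h0 ▸ hs.1) ha
    subst ha0
    subst h0
    have hM0 : 0 ≤ M := (norm_nonneg _).trans (hM 0 hs)
    have key : ∀ x ∈ Set.Icc 0 b, ‖(∫ σ in (0:ℝ)..x, σ * f σ) / x‖ ≤ M * x := by
      intro x hx
      have h1 : ‖∫ σ in (0:ℝ)..x, σ * f σ‖ ≤ (x * M) * |x - 0| := by
        apply intervalIntegral.norm_integral_le_of_norm_le_const
        intro σ hσ
        rw [Set.uIoc_of_le hx.1] at hσ
        rw [norm_mul]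
        have := hM σ ⟨hσ.1.le, hσ.2.trans hx.2⟩
        refine mul_le_mul ?_ this (norm_nonneg _) hx.1
        rw [Real.norm_of_nonneg hσ.1.le]; exact hσ.2
      rw [sub_zero, abs_of_nonneg hx.1] at h1
      rw [norm_div, Real.norm_of_nonneg hx.1]
      rcases eq_or_lt_of_le hx.1 with h | h
      · rw [← h]; simp
      · rw [div_le_iff₀ h]; linarith
    have : Tendsto (fun x => (∫ σ in (0:ℝ)..x, σ * f σ) / x)
        (nhdsWithin 0 (Set.Icc 0 b)) (nhds 0) := by
      apply squeeze_zero_norm' (a := fun x => M * x)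
      · filter_upwards [self_mem_nhdsWithin] with x hx using key x hx
      · have : Tendsto (fun x : ℝ => M * x) (nhds 0) (nhds (M * 0)) := by
          exact (continuous_const.mul continuous_id).tendsto 0
        rw [mul_zero] at this
        exact this.mono_left nhdsWithin_le_nhds
    simpa [ContinuousWithinAt] using this
  · exact (hint s hs).div continuousWithinAt_id h0.ne'

lemma continuousOn_radialCoeff {a b : ℝ} (ha : 0 ≤ a) (hab : a < b) (n : ℕ) :
    ContinuousOn (radialCoeff a n) (Set.Icc a b) := by
  induction n with
  | zero => exact continuousOn_const
  | succ n ih =>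
    have := intervalIntegral.continuousOn_primitive_interval
      (μ := volume) (a := a) (b := b)
      (((continuousOn_mean ha hab ih).integrableOn_Icc).mono_set (by rw [Set.uIcc_of_le hab.le]))
    rwa [Set.uIcc_of_le hab.le] at this

lemma integral_le_of_continuousOn {a r : ℝ} (har : a ≤ r) {f g : ℝ → ℝ}
    (hf : ContinuousOn f (Set.Icc a r)) (hg : ContinuousOn g (Set.Icc a r))
    (h : ∀ s ∈ Set.Icc a r, f s ≤ g s) : ∫ s in a..r, f s ≤ ∫ s in a..r, g s := by
  apply intervalIntegral.integral_mono_on har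
  · exact ContinuousOn.intervalIntegrable (by rwa [Set.uIcc_of_le har])
  · exact ContinuousOn.intervalIntegrable (by rwa [Set.uIcc_of_le har])
  · exact h

lemma integral_pow_le {a r : ℝ} (ha : 0 ≤ a) (n : ℕ) :
    ∫ s in a..r, s ^ n ≤ r ^ (n + 1) / (n + 1) := by
  rw [integral_pow]
  have : (0:ℝ) < n + 1 := by positivity
  gcongr
  have := pow_nonneg ha (n+1)
  linarith

lemma radialCoeff_bound {a b : ℝ} (ha : 0 ≤ a) (hab : a < b) (n : ℕ) :
    ∀ r ∈ Set.Icc a b, 0 ≤ radialCoeff a n r ∧ radialCoeff a n r ≤ (r ^ 2) ^ n / n.factorial := by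
  induction n with
  | zero => intro r _; simp [radialCoeff]
  | succ n ih =>
    have hc := continuousOn_radialCoeff ha hab n
    have hm : ∀ s ∈ Set.Icc a b, 0 ≤ (∫ σ in a..s, σ * radialCoeff a n σ) / s ∧
        (∫ σ in a..s, σ * radialCoeff a n σ) / s ≤ s ^ (2 * n + 1) / n.factorial := by
      intro s hs
      have hs0 : 0 ≤ s := ha.trans hs.1
      have hsub : Set.Icc a s ⊆ Set.Icc a b := Set.Icc_subset_Icc_right hs.2
      constructor
      · refine div_nonneg (intervalIntegral.integral_nonneg hs.1 fun σ hσ => ?_) hs0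
        exact mul_nonneg (ha.trans hσ.1) (ih σ (hsub hσ)).1
      · have h1 : ∫ σ in a..s, σ * radialCoeff a n σ ≤
            ∫ σ in a..s, σ ^ (2 * n + 1) / n.factorial := by
          apply integral_le_of_continuousOn hs.1
          · exact continuousOn_id.mul (hc.mono hsub)
          · fun_prop
          · intro σ hσ
            have h := (ih σ (hsub hσ)).2
            calc σ * radialCoeff a n σ ≤ σ * ((σ ^ 2) ^ n / n.factorial) :=
                  mul_le_mul_of_nonneg_left h (ha.trans hσ.1)
              _ = _ := by rw [← pow_mul]; ring
        rw [intervalIntegral.integral_div] at h1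
        have h2 := integral_pow_le (r := s) ha (2 * n + 1)
        rcases eq_or_lt_of_le hs0 with h0 | h0
        · rw [← h0]; simp
        · rw [div_le_iff₀ h0]
          refine h1.trans ?_
          rw [div_mul_eq_mul_div]
          gcongr
          refine h2.trans ?_
          rw [← pow_succ]
          apply div_le_self (by positivity)
          push_cast; linarith [show (0:ℝ) ≤ n by positivity]
    intro r hr
    have hsub : Set.Icc a r ⊆ Set.Icc a b := Set.Icc_subset_Icc_right hr.2
    refine ⟨intervalIntegral.integral_nonneg hr.1 fun s hs => (hm s (hsub hs)).1, ?_⟩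
    have h1 : radialCoeff a (n+1) r ≤ ∫ s in a..r, s ^ (2 * n + 1) / n.factorial := by
      apply integral_le_of_continuousOn hr.1
      · exact (continuousOn_mean ha hab hc).mono hsub
      · fun_prop
      · exact fun s hs => (hm s (hsub hs)).2
    rw [intervalIntegral.integral_div] at h1
    have h2 := integral_pow_le (r := r) ha (2 * n + 1)
    refine h1.trans ?_
    rw [Nat.factorial_succ, ← pow_mul]
    push_cast
    rw [div_le_div_iff₀ (by positivity) (by positivity)]
    have h3 : ∫ s in a..r, s ^ (2 * n + 1) ≤ r ^ (2 * (n+1)) / (n + 1) := by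
      refine h2.trans ?_
      have hr0 : 0 ≤ r := ha.trans hr.1
      rw [show 2 * n + 1 + 1 = 2 * (n + 1) by ring]
      apply div_le_div_of_nonneg_left (by positivity) (by positivity)
      push_cast; linarith [show (0:ℝ) ≤ n by positivity]
    rw [le_div_iff₀ (by positivity)] at h3
    have : (0:ℝ) < n.factorial := by positivity
    nlinarith

/-- The solution of the radial equation with value `1` and derivative `0` at `a`. -/
def radialSol (a k r : ℝ) : ℝ := ∑' n, k ^ n * radialCoeff a n r

/-- The derivative of `radialSol`. -/
def radialDer (a k r : ℝ) : ℝ := (∫ σ in a..r, σ * (k * radialSol a k σ)) / r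

section
variable {a b : ℝ} (ha : 0 ≤ a) (hab : a < b)
include ha hab

lemma norm_radial_term_le {K k r : ℝ} (hk : |k| ≤ K) (hr : r ∈ Set.Icc a b) (n : ℕ) :
    ‖k ^ n * radialCoeff a n r‖ ≤ (K * b ^ 2) ^ n / n.factorial := by
  obtain ⟨h0, h1⟩ := radialCoeff_bound ha hab n r hr
  have hr0 : 0 ≤ r := ha.trans hr.1
  rw [norm_mul, norm_pow, Real.norm_of_nonneg h0, Real.norm_eq_abs, mul_pow, mul_div_assoc]
  have hb : r ≤ b := hr.2
  refine mul_le_mul (by gcongr) (h1.trans (by gcongr)) h0 ?_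
  have := (abs_nonneg k).trans hk
  positivity

lemma summable_radial {k r : ℝ} (hr : r ∈ Set.Icc a b) :
    Summable fun n => k ^ n * radialCoeff a n r :=
  .of_norm_bounded (Real.summable_pow_div_factorial (|k| * b ^ 2))
    (norm_radial_term_le ha hab le_rfl hr)

lemma continuousOn_radialSol (k : ℝ) : ContinuousOn (radialSol a k) (Set.Icc a b) :=
  continuousOn_tsum (fun n => continuousOn_const.mul (continuousOn_radialCoeff ha hab n))
    (Real.summable_pow_div_factorial (|k| * b ^ 2))
    (fun n _ hr => norm_radial_term_le ha hab le_rfl hr n)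

lemma continuous_radialSol_param {r : ℝ} (hr : r ∈ Set.Icc a b) :
    Continuous fun k => radialSol a k r := by
  rw [continuous_iff_continuousAt]
  intro k
  have : ContinuousOn (fun k => radialSol a k r) (Metric.closedBall 0 (|k| + 1)) :=
    continuousOn_tsum (fun n => by fun_prop)
      (Real.summable_pow_div_factorial ((|k| + 1) * b ^ 2))
      (fun n x hx => norm_radial_term_le ha hab (by simpa using hx) hr n)
  apply this.continuousAt
  apply Metric.closedBall_mem_nhds_of_mem
  simp

lemma hasSum_integral_radial {k : ℝ} {r : ℝ} (hr : r ∈ Set.Icc a b) :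
    HasSum (fun n => ∫ σ in a..r, σ * (k ^ n * radialCoeff a n σ))
      (∫ σ in a..r, σ * radialSol a k σ) := by
  have hsub : Set.uIcc a r ⊆ Set.Icc a b := by
    rw [Set.uIcc_of_le hr.1]; exact Set.Icc_subset_Icc_right hr.2
  have hc : ∀ n, ContinuousOn (fun σ => σ * (k ^ n * radialCoeff a n σ)) (Set.uIcc a r) := fun n =>
    continuousOn_id.mul (continuousOn_const.mul ((continuousOn_radialCoeff ha hab n).mono hsub))
  apply intervalIntegral.hasSum_integral_of_dominated_convergence
    (bound := fun n _ => b * ((|k| * b ^ 2) ^ n / n.factorial))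
  · intro n
    exact ((hc n).mono Set.uIoc_subset_uIcc).aestronglyMeasurable measurableSet_uIoc
  · intro n
    refine Eventually.of_forall fun σ hσ => ?_
    have hσ' := hsub (Set.uIoc_subset_uIcc hσ)
    rw [norm_mul]
    refine mul_le_mul ?_ (norm_radial_term_le ha hab le_rfl hσ' n) (norm_nonneg _) (ha.trans hab.le)
    rw [Real.norm_of_nonneg (ha.trans hσ'.1)]; exact hσ'.2
  · refine Eventually.of_forall fun σ _ => ?_
    exact (Real.summable_pow_div_factorial (|k| * b ^ 2)).mul_left b
  · simp
  · refine Eventually.of_forall fun σ hσ => ?_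
    exact (summable_radial ha hab (hsub (Set.uIoc_subset_uIcc hσ))).hasSum.mul_left σ

lemma continuousOn_radialDer (k : ℝ) : ContinuousOn (radialDer a k) (Set.Icc a b) :=
  continuousOn_mean ha hab (continuousOn_const.mul (continuousOn_radialSol ha hab k))

lemma radialSol_eq_integral {k : ℝ} {r : ℝ} (hr : r ∈ Set.Icc a b) :
    radialSol a k r = 1 + ∫ s in a..r, radialDer a k s := by
  have hsub : Set.uIcc a r ⊆ Set.Icc a b := by
    rw [Set.uIcc_of_le hr.1]; exact Set.Icc_subset_Icc_right hr.2
  have key : HasSum (fun n => ∫ s in a..r, (∫ σ in a..s, σ * radialCoeff a n σ) / s * k ^ (n + 1))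
      (∫ s in a..r, radialDer a k s) := by
    have hterm : ∀ n s, (∫ σ in a..s, σ * radialCoeff a n σ) / s * k ^ (n + 1) =
        (∫ σ in a..s, σ * (k ^ n * radialCoeff a n σ)) * (k / s) := by
      intro n s
      have : (∫ σ in a..s, σ * (k ^ n * radialCoeff a n σ)) =
          k ^ n * ∫ σ in a..s, σ * radialCoeff a n σ := by
        rw [← intervalIntegral.integral_const_mul]; congr 1; ext; ring
      rw [this, pow_succ]; ring
    apply intervalIntegral.hasSum_integral_of_dominated_convergence
      (bound := fun n _ => (|k| * b) * ((|k| * b ^ 2) ^ n / n.factorial))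
    · intro n
      have : ContinuousOn (fun s => (∫ σ in a..s, σ * radialCoeff a n σ) / s * k ^ (n + 1))
        (Set.Icc a b) :=
        (continuousOn_mean ha hab (continuousOn_radialCoeff ha hab n)).mul continuousOn_const
      exact (this.mono (Set.uIoc_subset_uIcc.trans hsub)).aestronglyMeasurable measurableSet_uIoc
    · intro n
      refine Eventually.of_forall fun s hs => ?_
      have hs' := hsub (Set.uIoc_subset_uIcc hs)
      have hs0 : 0 ≤ s := ha.trans hs'.1
      have h1 : ‖∫ σ in a..s, σ * (k ^ n * radialCoeff a n σ)‖ ≤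
          (s * ((|k| * b ^ 2) ^ n / n.factorial)) * |s - a| := by
        apply intervalIntegral.norm_integral_le_of_norm_le_const
        intro σ hσ
        rw [Set.uIoc_of_le hs'.1] at hσ
        rw [norm_mul]
        have h2 := norm_radial_term_le ha hab (k := k) le_rfl
          (⟨hσ.1.le, hσ.2.trans hs'.2⟩ : σ ∈ Set.Icc a b) n
        refine mul_le_mul ?_ h2 (norm_nonneg _) hs0
        rw [Real.norm_of_nonneg (ha.trans hσ.1.le)]; exact hσ.2
      rw [hterm, norm_mul, norm_div, Real.norm_of_nonneg hs0, Real.norm_eq_abs k]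
      set B := (|k| * b ^ 2) ^ n / n.factorial with hB
      have hB0 : 0 ≤ B := by positivity
      rcases eq_or_lt_of_le hs0 with h | h
      · rw [← h, div_zero, mul_zero]
        exact mul_nonneg (mul_nonneg (abs_nonneg k) (ha.trans hab.le)) hB0
      · rw [mul_div_assoc', div_le_iff₀ h]
        have h3 : |s - a| ≤ b := by
          rw [abs_of_nonneg (by linarith [hs'.1])]; linarith [hs'.2]
        calc _ ≤ (s * B * |s - a|) * |k| := by gcongr
          _ ≤ (s * B * b) * |k| := by gcongr
          _ = _ := by ring
    · refine Eventually.of_forall fun σ _ => ?_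
      exact (Real.summable_pow_div_factorial (|k| * b ^ 2)).mul_left _
    · simp
    · refine Eventually.of_forall fun s hs => ?_
      have := (hasSum_integral_radial ha hab (k := k)
        (hsub (Set.uIoc_subset_uIcc hs))).mul_right (k / s)
      simp only [hterm]
      have hd : radialDer a k s = (∫ σ in a..s, σ * radialSol a k σ) * (k / s) := by
        have : (∫ σ in a..s, σ * (k * radialSol a k σ)) = k * ∫ σ in a..s, σ * radialSol a k σ := by
          rw [← intervalIntegral.integral_const_mul]; congr 1; ext; ring
        rw [radialDer, this]; ring
      rwa [hd]
  have h0 := (summable_radial ha hab (k := k) hr).tsum_eq_zero_add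
  rw [radialSol, h0, ← key.tsum_eq]
  simp only [pow_zero, radialCoeff, mul_one]
  congr 2
  ext n
  rw [intervalIntegral.integral_mul_const, mul_comm]

end

lemma hasDerivAt_primitive {a b : ℝ} {f F : ℝ → ℝ} (hf : ContinuousOn f (Set.Icc a b)) {c : ℝ}
    (hF : ∀ r ∈ Set.Icc a b, F r = c + ∫ s in a..r, f s) :
    ∀ r ∈ Set.Ioo a b, HasDerivAt F (f r) r := by
  intro r hr
  have hnhds : Set.Icc a b ∈ nhds r := Icc_mem_nhds hr.1 hr.2
  have hi : IntervalIntegrable f volume a r :=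
    (hf.mono (by rw [Set.uIcc_of_le hr.1.le]; exact Set.Icc_subset_Icc_right hr.2.le)).intervalIntegrable
  have h1 : HasDerivAt (fun r => ∫ s in a..r, f s) (f r) r :=
    intervalIntegral.integral_hasDerivAt_right hi
      (hf.stronglyMeasurableAtFilter_nhdsWithin measurableSet_Icc r |>.filter_mono
        (by rw [nhdsWithin_eq_nhds.2 hnhds]))
      (hf.continuousAt hnhds)
  refine (h1.const_add c).congr_of_eventuallyEq ?_
  filter_upwards [hnhds] with x hx using hF x hx

/-- Existence of a positive radial function on the annulus with Neumann condition on the inner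
circle and Robin condition (parameter `-β`) on the outer one. -/
lemma exists_radial_groundState {a b β : ℝ} (ha : 0 ≤ a) (hab : a < b) (hβ : 0 < β) :
    ∃ (k : ℝ) (F H : ℝ → ℝ), 0 < k ∧ ContinuousOn F (Set.Icc a b) ∧
      ContinuousOn H (Set.Icc a b) ∧
      (∀ r ∈ Set.Ioo a b, HasDerivAt F (H r) r) ∧
      (∀ r ∈ Set.Ioo a b, HasDerivAt (fun r => r * H r) (k * r * F r) r) ∧
      (∀ r ∈ Set.Icc a b, 1 ≤ F r) ∧ MonotoneOn F (Set.Icc a b) ∧ MonotoneOn H (Set.Icc a b) ∧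
      H a = 0 ∧ H b = β * F b := by
  have hFc := continuousOn_radialSol ha hab
  have hHc := continuousOn_radialDer ha hab
  have hb : 0 < b := ha.trans_lt hab
  have hamem : a ∈ Set.Icc a b := ⟨le_rfl, hab.le⟩
  have hbmem : b ∈ Set.Icc a b := ⟨hab.le, le_rfl⟩
  have hpos : ∀ k, 0 ≤ k → ∀ r ∈ Set.Icc a b, 0 ≤ radialSol a k r := fun k hk r hr =>
    tsum_nonneg fun n => mul_nonneg (pow_nonneg hk n) (radialCoeff_bound ha hab n r hr).1
  have hHpos : ∀ k, 0 ≤ k → ∀ r ∈ Set.Icc a b, 0 ≤ radialDer a k r := by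
    intro k hk r hr
    refine div_nonneg (intervalIntegral.integral_nonneg hr.1 fun σ hσ => ?_) (ha.trans hr.1)
    exact mul_nonneg (ha.trans hσ.1) (mul_nonneg hk (hpos k hk σ ⟨hσ.1, hσ.2.trans hr.2⟩))
  have hFd : ∀ k, ∀ r ∈ Set.Ioo a b, HasDerivAt (radialSol a k) (radialDer a k r) r := fun k =>
    hasDerivAt_primitive (hHc k) fun r hr => radialSol_eq_integral ha hab hr
  have hpd : ∀ k, ∀ r ∈ Set.Ioo a b,
      HasDerivAt (fun r => r * radialDer a k r) (k * r * radialSol a k r) r := by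
    intro k r hr
    have h1 : ContinuousOn (fun σ => σ * (k * radialSol a k σ)) (Set.Icc a b) :=
      continuousOn_id.mul (continuousOn_const.mul (hFc k))
    have := hasDerivAt_primitive (c := 0) (F := fun r => r * radialDer a k r) h1 ?_ r hr
    · convert this using 1; ring
    · intro r hr
      rw [zero_add, radialDer]
      rcases eq_or_lt_of_le (ha.trans hr.1) with h | h
      · have : a = r := by rw [← h]; exact le_antisymm (h ▸ hr.1) ha
        rw [this]; simp
      · rw [mul_div_assoc', mul_div_cancel_left₀ _ h.ne']
  have hFmono : ∀ k, 0 ≤ k → MonotoneOn (radialSol a k) (Set.Icc a b) := by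
    intro k hk
    refine monotoneOn_of_hasDerivWithinAt_nonneg (f' := radialDer a k) (convex_Icc a b) (hFc k)
      (fun x hx => ?_) (fun x hx => ?_)
    · rw [interior_Icc] at hx; exact (hFd k x hx).hasDerivWithinAt
    · exact hHpos k hk x (interior_subset hx)
  have hFa : ∀ k, radialSol a k a = 1 := by
    intro k; rw [radialSol_eq_integral ha hab hamem]; simp
  have hHa : ∀ k, radialDer a k a = 0 := by intro k; simp [radialDer]
  -- `H / r ≤ k F / 2`
  have hHle : ∀ k, 0 ≤ k → ∀ r ∈ Set.Ioo a b, radialDer a k r / r ≤ k * radialSol a k r / 2 := by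
    intro k hk r hr
    have hr0 : 0 < r := ha.trans_lt hr.1
    have hrm : r ∈ Set.Icc a b := Set.Ioo_subset_Icc_self hr
    have h1 : ∫ σ in a..r, σ * (k * radialSol a k σ) ≤ ∫ σ in a..r, σ * (k * radialSol a k r) := by
      have hsub : Set.Icc a r ⊆ Set.Icc a b := Set.Icc_subset_Icc_right hr.2.le
      apply integral_le_of_continuousOn hr.1.le
      · exact continuousOn_id.mul (continuousOn_const.mul ((hFc k).mono hsub))
      · fun_prop
      · intro σ hσ
        have := hFmono k hk (hsub hσ) hrm hσ.2
        have := mul_le_mul_of_nonneg_left this hk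
        exact mul_le_mul_of_nonneg_left this (ha.trans hσ.1)
    rw [intervalIntegral.integral_mul_const, integral_id] at h1
    rw [radialDer, div_div, div_le_iff₀ (by positivity)]
    have := mul_nonneg hk (hpos k hk r hrm)
    nlinarith [mul_nonneg this (sq_nonneg a)]
  have hHd : ∀ k, ∀ r ∈ Set.Ioo a b,
      HasDerivAt (radialDer a k) (k * radialSol a k r - radialDer a k r / r) r := by
    intro k r hr
    have hr0 : r ≠ 0 := (ha.trans_lt hr.1).ne'
    have h1 := (hpd k r hr).div (hasDerivAt_id r) hr0
    have h2 : (fun r => r * radialDer a k r) / id =ᶠ[nhds r] radialDer a k := by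
      filter_upwards [isOpen_ne.mem_nhds hr0] with x hx
      simp only [Pi.div_apply, id]
      field_simp
    refine (h1.congr_of_eventuallyEq h2.symm).congr_deriv ?_
    simp only [id]
    field_simp
  have hHmono : ∀ k, 0 ≤ k → MonotoneOn (radialDer a k) (Set.Icc a b) := by
    intro k hk
    refine monotoneOn_of_hasDerivWithinAt_nonneg (convex_Icc a b) (hHc k)
      (f' := fun r => k * radialSol a k r - radialDer a k r / r) (fun x hx => ?_) (fun x hx => ?_)
    · rw [interior_Icc] at hx; exact (hHd k x hx).hasDerivWithinAt
    · have h2 := mul_nonneg hk (hpos k hk x (interior_subset hx))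
      rw [interior_Icc] at hx
      have h1 := hHle k hk x hx
      linarith
  have hgrow : ∀ k, 0 ≤ k →
      k / 2 * (radialSol a k b ^ 2 - 1) ≤ radialDer a k b ^ 2 := by
    intro k hk
    have hm : MonotoneOn (fun r => radialDer a k r ^ 2 - k / 2 * radialSol a k r ^ 2)
        (Set.Icc a b) := by
      refine monotoneOn_of_hasDerivWithinAt_nonneg (convex_Icc a b)
        (((hHc k).pow 2).sub (continuousOn_const.mul ((hFc k).pow 2)))
        (f' := fun r => 2 * radialDer a k r * (k * radialSol a k r - radialDer a k r / r) -
          k / 2 * (2 * radialSol a k r * radialDer a k r))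
        (fun x hx => ?_) (fun x hx => ?_)
      · rw [interior_Icc] at hx
        have := ((hHd k x hx).pow 2).sub (((hFd k x hx).pow 2).const_mul (k / 2))
        refine (this.congr_deriv ?_).hasDerivWithinAt
        norm_num
      · have h2 := hHpos k hk x (interior_subset hx)
        rw [interior_Icc] at hx
        have h1 := hHle k hk x hx
        nlinarith
    have := hm hamem hbmem hab.le
    simp only [hHa, hFa] at this
    linarith
  have hFlow : ∀ k, 0 ≤ k → 1 + k * radialCoeff a 1 b ≤ radialSol a k b := by
    intro k hk
    have := (summable_radial ha hab (k := k) hbmem).sum_le_tsum (Finset.range 2) (fun n _ =>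
      mul_nonneg (pow_nonneg hk n) (radialCoeff_bound ha hab n b hbmem).1)
    rw [radialSol]
    simpa [Finset.sum_range_succ, radialCoeff] using this
  have hc1 : 0 < radialCoeff a 1 b := by
    have hc := continuousOn_mean ha hab (continuousOn_radialCoeff ha hab 0)
    have : radialCoeff a 1 b = ∫ s in a..b, (∫ σ in a..s, σ * radialCoeff a 0 σ) / s := rfl
    rw [this]
    apply intervalIntegral.intervalIntegral_pos_of_pos_on
    · exact ContinuousOn.intervalIntegrable (by rwa [Set.uIcc_of_le hab.le])
    · intro s hs
      have hs0 : 0 < s := ha.trans_lt hs.1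
      apply div_pos _ hs0
      simp only [radialCoeff, mul_one, integral_id]
      nlinarith [hs.1]
    · exact hab
  -- choose `k`
  have hcont : Continuous fun k => radialDer a k b - β * radialSol a k b := by
    have h1 := continuous_radialSol_param ha hab hbmem
    have h2 : Continuous fun k => radialDer a k b := by
      have hint : ∀ k, radialDer a k b = (k * ∫ σ in a..b, σ * radialSol a k σ) / b := by
        intro k
        rw [radialDer, ← intervalIntegral.integral_const_mul]
        congr 2; ext; ring
      simp only [hint]
      refine (continuous_id.mul ?_).div_const b
      rw [continuous_iff_continuousAt]
      intro k
      refine intervalIntegral.continuousAt_of_dominated_interval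
        (bound := fun _ => b * ∑' n : ℕ, ((|k| + 1) * b ^ 2) ^ n / n.factorial) ?_ ?_ ?_ ?_
      · refine Eventually.of_forall fun x => ?_
        have : ContinuousOn (fun σ => σ * radialSol a x σ) (Set.Icc a b) :=
          continuousOn_id.mul (hFc x)
        refine (this.mono ?_).aestronglyMeasurable measurableSet_uIoc
        rw [Set.uIoc_of_le hab.le]; exact Set.Ioc_subset_Icc_self
      · have : Metric.closedBall (0:ℝ) (|k| + 1) ∈ nhds k := by
          apply Metric.closedBall_mem_nhds_of_mem; simp
        filter_upwards [this] with x hx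
        refine Eventually.of_forall fun σ hσ => ?_
        rw [Set.uIoc_of_le hab.le] at hσ
        have hσ' : σ ∈ Set.Icc a b := Set.Ioc_subset_Icc_self hσ
        rw [norm_mul]
        refine mul_le_mul ?_ ?_ (norm_nonneg _) hb.le
        · rw [Real.norm_of_nonneg (ha.trans hσ'.1)]; exact hσ'.2
        · exact tsum_of_norm_bounded (Real.summable_pow_div_factorial _).hasSum
            (norm_radial_term_le ha hab (by simpa using hx) hσ')
      · simp
      · refine Eventually.of_forall fun σ hσ => ?_
        rw [Set.uIoc_of_le hab.le] at hσ
        exact continuousAt_const.mul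
          (continuous_radialSol_param ha hab (Set.Ioc_subset_Icc_self hσ)).continuousAt
    exact h2.sub (continuous_const.mul h1)
  set K := max (4 * β ^ 2) (1 / radialCoeff a 1 b) with hK
  have hK0 : 0 ≤ K := le_max_of_le_left (by positivity)
  have hKpos : 0 ≤ radialDer a K b - β * radialSol a K b := by
    have h1 := hgrow K hK0
    have h2 : 2 ≤ radialSol a K b := by
      have := hFlow K hK0
      have h3 : 1 / radialCoeff a 1 b ≤ K := le_max_right _ _
      rw [div_le_iff₀ hc1] at h3
      linarith
    have h3 : 4 * β ^ 2 ≤ K := le_max_left _ _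
    have h4 : (β * radialSol a K b) ^ 2 ≤ radialDer a K b ^ 2 := by
      refine le_trans ?_ h1
      have h4 : 0 ≤ radialSol a K b ^ 2 - 2 := by nlinarith
      nlinarith [mul_nonneg (sub_nonneg.2 h3) (sq_nonneg (radialSol a K b)), mul_nonneg hK0 h4]
    have := abs_le_of_sq_le_sq' h4 (hHpos K hK0 b hbmem)
    linarith [this.2]
  have h0 : radialDer a 0 b - β * radialSol a 0 b < 0 := by
    have h1 : radialDer a 0 b = 0 := by simp [radialDer]
    have h2 := hFlow 0 le_rfl
    rw [h1]; nlinarith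
  obtain ⟨k, hk, hk0⟩ := intermediate_value_Icc hK0 hcont.continuousOn ⟨h0.le, hKpos⟩
  have hkne : k ≠ 0 := by rintro rfl; simp only at hk0; linarith
  have hkpos : 0 < k := lt_of_le_of_ne hk.1 (Ne.symm hkne)
  refine ⟨k, radialSol a k, radialDer a k, hkpos, hFc k, hHc k, hFd k, hpd k, ?_, hFmono k hk.1,
    hHmono k hk.1, hHa k, ?_⟩
  · intro r hr
    rw [← hFa k]; exact hFmono k hk.1 hamem hr hr.1
  · simp only at hk0; linarith

section
variable {a b β k : ℝ} {F H : ℝ → ℝ} (ha : 0 ≤ a) (hab : a < b)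
  (hFc : ContinuousOn F (Set.Icc a b)) (hHc : ContinuousOn H (Set.Icc a b))
  (hF : ∀ r ∈ Set.Ioo a b, HasDerivAt F (H r) r)
  (hH : ∀ r ∈ Set.Ioo a b, HasDerivAt (fun r => r * H r) (k * r * F r) r)
  (hF1 : ∀ r ∈ Set.Icc a b, 1 ≤ F r) (hHa : H a = 0) (hHb : H b = β * F b)
include hab hFc hHc hF hH hHa hHb

lemma radial_energy_eq :
    (∫ r in a..b, H r ^ 2 * r) - β * b * F b ^ 2 = - (k * ∫ r in a..b, F r ^ 2 * r) := by
  have hc1 : ContinuousOn (fun r => H r ^ 2 * r) (Set.uIcc a b) := by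
    rw [Set.uIcc_of_le hab.le]; exact (hHc.pow 2).mul continuousOn_id
  have hc2 : ContinuousOn (fun r => k * (F r ^ 2 * r)) (Set.uIcc a b) := by
    rw [Set.uIcc_of_le hab.le]; exact continuousOn_const.mul ((hFc.pow 2).mul continuousOn_id)
  have := intervalIntegral.integral_eq_sub_of_hasDerivAt_of_le (a := a) (b := b)
    (f := fun r => (r * H r) * F r) (f' := fun r => H r ^ 2 * r + k * (F r ^ 2 * r)) hab.le
    ((continuousOn_id.mul hHc).mul hFc)
    (fun r hr => ((hH r hr).mul (hF r hr)).congr_deriv (by ring))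
    (hc1.intervalIntegrable.add hc2.intervalIntegrable)
  rw [intervalIntegral.integral_add hc1.intervalIntegrable hc2.intervalIntegrable,
    intervalIntegral.integral_const_mul] at this
  simp only [hHa, hHb] at this
  linarith

include ha hF1

lemma picone_inequality {ψ : ℝ → ℝ} (hψ : ContDiff ℝ (⊤ : ℕ∞) ψ) :
    - (k * ∫ r in a..b, ψ r ^ 2 * r) ≤
      (∫ r in a..b, deriv ψ r ^ 2 * r) - β * b * ψ b ^ 2 := by
  have hψ' : Continuous (deriv ψ) := hψ.continuous_deriv (by simp)
  have hψc : Continuous ψ := hψ.continuous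
  have hF0 : ∀ r ∈ Set.Icc a b, F r ≠ 0 := fun r hr => by linarith [hF1 r hr] |> ne_of_gt
  have hP : ContinuousOn (fun r => ψ r ^ 2 * ((r * H r) / F r)) (Set.Icc a b) :=
    (hψc.pow 2).continuousOn.mul ((continuousOn_id.mul hHc).div hFc hF0)
  have hP' : ContinuousOn (fun r => 2 * ψ r * deriv ψ r * (r * H r / F r) +
      ψ r ^ 2 * (((k * r * F r) * F r - r * H r * H r) / F r ^ 2)) (Set.Icc a b) := by
    refine ContinuousOn.add ?_ ?_
    · exact ContinuousOn.mul (by fun_prop) ((continuousOn_id.mul hHc).div hFc hF0)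
    · refine ContinuousOn.mul (by fun_prop) (ContinuousOn.div ?_ (hFc.pow 2) fun r hr =>
        pow_ne_zero 2 (hF0 r hr))
      fun_prop
  have hFTC := intervalIntegral.integral_eq_sub_of_hasDerivAt_of_le hab.le hP
    (fun r hr => by
      have h1 := ((hψ.differentiable (by simp)) r).hasDerivAt
      have h2 := (h1.pow 2).mul ((hH r hr).div (hF r hr) (hF0 r (Set.Ioo_subset_Icc_self hr)))
      refine h2.congr_deriv ?_
      show _ = 2 * ψ r * deriv ψ r * (r * H r / F r) +
        ψ r ^ 2 * (((k * r * F r) * F r - r * H r * H r) / F r ^ 2)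
      simp)
    (ContinuousOn.intervalIntegrable (by rwa [Set.uIcc_of_le hab.le]))
  have hle := integral_le_of_continuousOn (g := fun r => deriv ψ r ^ 2 * r + k * (ψ r ^ 2 * r))
    hab.le hP' (by fun_prop) (fun r hr => by
      have h0 := hF0 r hr
      have e : 2 * ψ r * deriv ψ r * (r * H r / F r) +
        ψ r ^ 2 * (((k * r * F r) * F r - r * H r * H r) / F r ^ 2) =
        deriv ψ r ^ 2 * r + k * (ψ r ^ 2 * r) - r * (deriv ψ r - ψ r * (H r / F r)) ^ 2 := by
        field_simp; ring
      rw [e]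
      have := mul_nonneg (ha.trans hr.1) (sq_nonneg (deriv ψ r - ψ r * (H r / F r)))
      linarith)
  rw [hFTC, intervalIntegral.integral_add (Continuous.intervalIntegrable (by fun_prop) _ _)
    (Continuous.intervalIntegrable (by fun_prop) _ _), intervalIntegral.integral_const_mul] at hle
  have hb := hF0 b ⟨hab.le, le_rfl⟩
  have e1 : ψ b ^ 2 * (b * H b / F b) = β * b * ψ b ^ 2 := by
    rw [hHb]; field_simp
  rw [e1, hHa] at hle
  simp only [mul_zero, zero_div, sub_zero] at hle
  linarith

lemma neg_le_nrEig : -k ≤ nrEig (-β) a b := by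
  apply le_csInf
  · refine ⟨_, fun _ => 1, contDiff_const, ?_, rfl⟩
    simp only [one_pow, one_mul, integral_id]
    have : 0 < b ^ 2 - a ^ 2 := by nlinarith
    exact ne_of_gt (by linarith)
  · rintro _ ⟨ψ, hψ, h0, rfl⟩
    have hpos : 0 ≤ ∫ r in a..b, ψ r ^ 2 * r := intervalIntegral.integral_nonneg hab.le
      fun r hr => mul_nonneg (sq_nonneg _) (ha.trans hr.1)
    have hpos' : 0 < ∫ r in a..b, ψ r ^ 2 * r := lt_of_le_of_ne hpos (Ne.symm h0)
    rw [le_div_iff₀ hpos']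
    have := picone_inequality ha hab hFc hHc hF hH hF1 hHa hHb hψ
    linarith

end

/-- A continuous logarithm of a nowhere vanishing continuously differentiable curve. -/
lemma exists_log_lift {c c' : ℝ → ℂ} (hc : ∀ s, HasDerivAt c (c' s) s) (hc' : Continuous c')
    (h0 : ∀ s, c s ≠ 0) (a : ℝ) {l : ℂ} (hl : Complex.exp l = c a) :
    ∃ L : ℝ → ℂ, L a = l ∧ (∀ s, HasDerivAt L (c' s / c s) s) ∧ ∀ s, Complex.exp (L s) = c s := by
  have hcc : Continuous c := continuous_iff_continuousAt.2 fun s => (hc s).continuousAt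
  have hq : Continuous fun s => c' s / c s := hc'.div hcc h0
  refine ⟨fun s => l + ∫ y in a..s, c' y / c y, by simp, fun s => ?_, fun s => ?_⟩
  · exact (intervalIntegral.integral_hasDerivAt_right (hq.intervalIntegrable _ _)
      (hq.stronglyMeasurableAtFilter _ _) hq.continuousAt).const_add l
  · set L : ℝ → ℂ := fun s => l + ∫ y in a..s, c' y / c y with hL
    have hd : ∀ s, HasDerivAt (fun s => c s * Complex.exp (-L s)) 0 s := by
      intro s
      have h1 : HasDerivAt L (c' s / c s) s :=
        (intervalIntegral.integral_hasDerivAt_right (hq.intervalIntegrable _ _)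
          (hq.stronglyMeasurableAtFilter _ _) hq.continuousAt).const_add l
      have := (hc s).mul h1.neg.cexp
      have h0s := h0 s
      refine this.congr_deriv ?_
      field_simp
      ring
    have hcst := is_const_of_deriv_eq_zero (fun s => (hd s).differentiableAt)
      (fun s => (hd s).deriv) s a
    have hLa : L a = l := by simp [hL]
    simp only [hLa, Complex.exp_neg, hl] at hcst
    rw [mul_inv_cancel₀ (h0 a)] at hcst
    have := Complex.exp_ne_zero (L s)
    field_simp at hcst
    exact hcst.symm

/-- A continuous logarithm of a nowhere vanishing continuous function on the plane. -/
lemma exists_log_lift_plane {f : ℝ × ℝ → ℂ} (hf : Continuous f) (h0 : ∀ p, f p ≠ 0)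
    (p₀ : ℝ × ℝ) {l : ℂ} (hl : Complex.exp l = f p₀) :
    ∃ L : ℝ × ℝ → ℂ, Continuous L ∧ L p₀ = l ∧ ∀ p, Complex.exp (L p) = f p := by
  obtain ⟨F, ⟨hF0, hF⟩, -⟩ := Complex.isCoveringMap_exp.existsUnique_continuousMap_lifts
    (⟨fun p => ⟨f p, h0 p⟩, by fun_prop⟩ : C(ℝ × ℝ, {z : ℂ // z ≠ 0})) p₀ l (Subtype.ext hl)
  exact ⟨F, F.continuous, hF0, fun p => congrArg Subtype.val (congrFun hF p)⟩

/-- Two continuous angle functions with the same direction differ by a constant multiple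
of `2π`. -/
lemma angle_eq_add_int {f g : ℝ → ℝ} (hf : Continuous f) (hg : Continuous g)
    (h : ∀ s, Complex.exp (f s * Complex.I) = Complex.exp (g s * Complex.I)) :
    ∃ n : ℤ, ∀ s, f s = g s + 2 * π * n := by
  have key : ∀ s, ∃ n : ℤ, (f s - g s) / (2 * π) = n := by
    intro s
    obtain ⟨n, hn⟩ := Complex.exp_eq_exp_iff_exists_int.1 (h s)
    refine ⟨n, ?_⟩
    have := congrArg Complex.im hn
    simp at this
    rw [this]; field_simp; ring
  choose n hn using key
  have hc : Continuous fun s => ((n s : ℤ) : ℝ) := by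
    have : Continuous fun s => (f s - g s) / (2 * π) := by fun_prop
    simpa only [hn] using this
  have hc' : Continuous n := Int.isClosedEmbedding_coe_real.isInducing.continuous_iff.2 hc
  refine ⟨n 0, fun s => ?_⟩
  have := PreconnectedSpace.constant (inferInstance) hc' (x := s) (y := 0)
  rw [← this]
  have := hn s
  field_simp at this
  linarith

lemma cos_neg_of_abs {x : ℝ} (h1 : π / 2 < |x|) (h2 : |x| < 3 * π / 2) : cos x < 0 := by
  rw [← cos_abs]
  exact cos_neg_of_pi_div_two_lt_of_lt h1 (by linarith)

/-- A continuous angle pointing into a half-plane stays in one band. -/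
lemma exists_band {g : ℝ → ℝ} {a b ω : ℝ} (hab : a ≤ b) (hg : ContinuousOn g (Set.Icc a b))
    (h : ∀ t ∈ Set.Icc a b, 0 ≤ cos (g t - ω)) :
    ∃ k : ℤ, ∀ t ∈ Set.Icc a b, |g t - ω - 2 * π * k| ≤ π / 2 := by
  have hpi := pi_pos
  set k : ℤ := round ((g a - ω) / (2 * π)) with hk
  have hcos : ∀ t, cos (g t - ω - 2 * π * k) = cos (g t - ω) := by
    intro t
    have := cos_sub_int_mul_two_pi (g t - ω) k
    rw [← this]; ring_nf
  have hka : |g a - ω - 2 * π * k| ≤ π := by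
    have := abs_sub_round ((g a - ω) / (2 * π))
    rw [← hk] at this
    have e : g a - ω - 2 * π * k = 2 * π * ((g a - ω) / (2 * π) - k) := by field_simp
    rw [e, abs_mul, abs_of_pos (by positivity)]
    nlinarith
  have hka' : |g a - ω - 2 * π * k| ≤ π / 2 := by
    by_contra hcon
    have := cos_neg_of_abs (not_le.1 hcon) (by linarith)
    rw [hcos] at this
    exact absurd (h a ⟨le_rfl, hab⟩) (not_le.2 this)
  refine ⟨k, fun t ht => ?_⟩
  by_contra hcon
  push Not at hcon
  have hcont : ContinuousOn (fun t => |g t - ω - 2 * π * k|) (Set.Icc a t) := by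
    have := hg.mono (Set.Icc_subset_Icc_right ht.2)
    fun_prop
  set m := min |g t - ω - 2 * π * k| π with hm
  have hm1 : π / 2 < m := lt_min hcon (by linarith)
  obtain ⟨y, hy, hym⟩ := intermediate_value_Icc ht.1 hcont
    (show m ∈ Set.Icc _ _ from ⟨hka'.trans hm1.le, min_le_left _ _⟩)
  have h2 : m ≤ π := min_le_right _ _
  have := cos_neg_of_abs (x := g y - ω - 2 * π * k) (by simp only at hym; rw [hym]; exact hm1)
    (by simp only at hym; rw [hym]; linarith)
  rw [hcos] at this
  exact absurd (h y ⟨hy.1, hy.2.trans ht.2⟩) (not_le.2 this)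

lemma re_exp_mul (ω : ℝ) (l : ℂ) :
    (Complex.exp (-(ω * Complex.I)) * Complex.exp l).re = Real.exp l.re * cos (l.im - ω) := by
  rw [← Complex.exp_add, Complex.exp_re]
  simp [sub_eq_add_neg, add_comm]

/-- Hopf's secant argument: comparison of the tangent angles at the two ends of a simple arc
lying in a half-plane at each of its ends. -/
lemma hopf_secant {Z Z' : ℝ → ℂ} (hZ : ∀ s, HasDerivAt Z (Z' s) s) (hc : Continuous Z')
    (h0 : ∀ s, Z' s ≠ 0) {a b : ℝ} (hab : a < b) (hinj : Set.InjOn Z (Set.Icc a b))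
    {ψ : ℝ → ℝ} (hψ : Continuous ψ)
    (hψZ : ∀ s, Z' s = ‖Z' s‖ * Complex.exp (ψ s * Complex.I)) {ω₁ ω₂ : ℝ}
    (h1 : ∀ t ∈ Set.Icc a b, 0 ≤ (Complex.exp (-(ω₁ * Complex.I)) * (Z t - Z a)).re)
    (h2 : ∀ t ∈ Set.Icc a b, 0 ≤ (Complex.exp (-(ω₂ * Complex.I)) * (Z b - Z t)).re) :
    ∃ (k₁ k₂ : ℤ) (v : ℝ), |ψ a - ω₁ - 2 * π * k₁| ≤ π / 2 ∧ |v - ω₁ - 2 * π * k₁| ≤ π / 2 ∧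
      |v - ω₂ - 2 * π * k₂| ≤ π / 2 ∧ |ψ b - ω₂ - 2 * π * k₂| ≤ π / 2 := by
  have hZc : Continuous Z := continuous_iff_continuousAt.2 fun s => (hZ s).continuousAt
  set Q : ℝ × ℝ → ℂ := fun p => ∫ u in (0:ℝ)..1, Z' (p.1 + u * (p.2 - p.1)) with hQ
  have hQc : Continuous Q := by
    apply intervalIntegral.continuous_parametric_intervalIntegral_of_continuous'
    exact hc.comp (by fun_prop)
  have hQm : ∀ p : ℝ × ℝ, ((p.2 - p.1 : ℝ) : ℂ) * Q p = Z p.2 - Z p.1 := by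
    intro p
    have := intervalIntegral.integral_eq_sub_of_hasDerivAt (a := (0:ℝ)) (b := 1)
      (f := fun u => Z (p.1 + u * (p.2 - p.1)))
      (f' := fun u => ((p.2 - p.1 : ℝ) : ℂ) * Z' (p.1 + u * (p.2 - p.1)))
      (fun u _ => by
        have h := (hZ (p.1 + u * (p.2 - p.1))).scomp u
          (((hasDerivAt_id u).mul_const (p.2 - p.1)).const_add p.1)
        simpa [Function.comp_def, mul_comm] using h)
      ((continuous_const.mul (hc.comp (by fun_prop))).intervalIntegrable _ _)
    rw [intervalIntegral.integral_const_mul] at this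
    simpa using this
  have hQd : ∀ s, Q (s, s) = Z' s := by intro s; simp [hQ]
  have hQ0 : ∀ p : ℝ × ℝ, p.1 ∈ Set.Icc a b → p.2 ∈ Set.Icc a b → Q p ≠ 0 := by
    rintro ⟨s, t⟩ hs ht hq
    by_cases hst : s = t
    · subst hst; rw [hQd] at hq; exact h0 _ hq
    · have := hQm (s, t)
      rw [hq, mul_zero, eq_comm, sub_eq_zero] at this
      exact hst (hinj ht hs this).symm
  set P : ℝ → ℝ := fun s => max a (min b s) with hP
  have hPc : Continuous P := by fun_prop
  have hPm : ∀ s, P s ∈ Set.Icc a b := fun s =>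
    ⟨le_max_left _ _, max_le hab.le (min_le_left _ _)⟩
  have hPid : ∀ s ∈ Set.Icc a b, P s = s := by
    intro s hs; simp only [hP]; rw [min_eq_right hs.2, max_eq_right hs.1]
  have haI : a ∈ Set.Icc a b := ⟨le_rfl, hab.le⟩
  have hbI : b ∈ Set.Icc a b := ⟨hab.le, le_rfl⟩
  obtain ⟨L, hLc, hLa, hL⟩ := exists_log_lift_plane (f := fun p => Q (P p.1, P p.2))
    (by fun_prop) (fun p => hQ0 _ (hPm _) (hPm _)) (a, a)
    (l := Real.log ‖Z' a‖ + ψ a * Complex.I) (by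
      simp only [hPid a haI, hQd]
      rw [Complex.exp_add, ← Complex.ofReal_exp, Real.exp_log (norm_pos_iff.2 (h0 a)), ← hψZ])
  have hdiag : ∀ s ∈ Set.Icc a b, (L (s, s)).im = ψ s := by
    obtain ⟨n, hn⟩ := angle_eq_add_int (f := fun s => (L (P s, P s)).im) (g := fun s => ψ (P s))
      (by fun_prop) (by fun_prop) (by
        intro s
        have e1 := hL (P s, P s)
        simp only [hPid _ (hPm s), hQd] at e1
        have e2 := hψZ (P s)
        have e3 : Complex.exp (L (P s, P s)) =
            ‖Z' (P s)‖ * Complex.exp ((L (P s, P s)).im * Complex.I) := by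
          rw [← e1, Complex.norm_exp, Complex.ofReal_exp, ← Complex.exp_add,
            Complex.re_add_im]
        rw [e1] at e3
        have hne : (‖Z' (P s)‖ : ℂ) ≠ 0 := by exact_mod_cast (norm_pos_iff.2 (h0 _)).ne'
        exact mul_left_cancel₀ hne (e3.symm.trans e2))
    intro s hs
    have ha := hn a
    have hs' := hn s
    simp only [hPid a haI, hPid s hs, hLa] at ha hs'
    simp at ha
    rw [hs', ha]; simp
  have aux : ∀ (ω s t : ℝ), s ∈ Set.Icc a b → t ∈ Set.Icc a b → s < t →
      0 ≤ (Complex.exp (-(ω * Complex.I)) * (Z t - Z s)).re → 0 ≤ cos ((L (s, t)).im - ω) := by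
    intro ω s t hs ht hst h
    have e := hQm (s, t)
    have e1 := hL (s, t)
    simp only [hPid s hs, hPid t ht] at e1
    rw [← e, ← e1, mul_left_comm, Complex.re_ofReal_mul, re_exp_mul] at h
    have hp : 0 < t - s := by linarith
    by_contra hcon
    push Not at hcon
    have := mul_neg_of_pos_of_neg hp (mul_neg_of_pos_of_neg (Real.exp_pos (L (s, t)).re) hcon)
    simp only at h
    linarith
  have close : ∀ (f : ℝ → ℝ) (S : Set ℝ), Continuous f → (∀ t ∈ S, 0 ≤ f t) →
      ∀ t ∈ closure S, 0 ≤ f t := by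
    intro f S hf h t ht
    exact closure_minimal (t := {t | 0 ≤ f t}) h (isClosed_le continuous_const hf) ht
  obtain ⟨k₁, hk₁⟩ := exists_band (g := fun t => (L (a, t)).im) (ω := ω₁) hab.le (by fun_prop) (by
    have := close (fun t => cos ((L (a, t)).im - ω₁)) (Set.Ioc a b) (by fun_prop)
      (fun t ht => aux ω₁ a t haI ⟨ht.1.le, ht.2⟩ ht.1 (h1 t ⟨ht.1.le, ht.2⟩))
    rwa [closure_Ioc hab.ne] at this)
  obtain ⟨k₂, hk₂⟩ := exists_band (g := fun t => (L (t, b)).im) (ω := ω₂) hab.le (by fun_prop) (by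
    have := close (fun t => cos ((L (t, b)).im - ω₂)) (Set.Ico a b) (by fun_prop)
      (fun t ht => aux ω₂ t b ⟨ht.1, ht.2.le⟩ hbI ht.2 (h2 t ⟨ht.1, ht.2.le⟩))
    rwa [closure_Ico hab.ne] at this)
  refine ⟨k₁, k₂, (L (a, b)).im, ?_, hk₁ b hbI, hk₂ a haI, ?_⟩
  · rw [← hdiag a haI]; exact hk₁ a haI
  · rw [← hdiag b hbI]; exact hk₂ b hbI

lemma integrable_indicator_norm_inv (R : ℝ) :
    Integrable (fun y : ℂ => (Set.Iio R).indicator (fun r : ℝ => r⁻¹) ‖y‖) := by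
  rw [integrable_fun_norm_addHaar (μ := (volume : Measure ℂ))
    (f := (Set.Iio R).indicator (fun r : ℝ => r⁻¹))]
  have : IntegrableOn (fun _ : ℝ => (1:ℝ)) (Set.Ioo 0 R) := by simp
  have h2 : IntegrableOn ((Set.Iio R).indicator (fun _ : ℝ => (1:ℝ))) (Set.Ioi 0) := by
    rw [IntegrableOn, integrable_indicator_iff measurableSet_Iio, IntegrableOn,
      Measure.restrict_restrict measurableSet_Iio, Set.inter_comm]
    exact this
  refine h2.congr_fun (fun r hr => ?_) measurableSet_Ioi
  have hr' : r ≠ 0 := ne_of_gt hr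
  by_cases h : r ∈ Set.Iio R <;> simp [h, Complex.finrank_real_complex, hr']

lemma norm_indicator_inv_sub_le (z x : ℂ) {R : ℝ} (hz : ‖z‖ < R) :
    (ball (0:ℂ) R).indicator (fun x => ‖(z - x)⁻¹‖) x ≤
      (Set.Iio (2 * R)).indicator (fun r : ℝ => r⁻¹) ‖z - x‖ := by
  by_cases h : x ∈ ball (0:ℂ) R
  · have h' : ‖x‖ < R := by simpa using h
    have : ‖z - x‖ < 2 * R := (norm_sub_le _ _).trans_lt (by linarith)
    rw [Set.indicator_of_mem h, Set.indicator_of_mem (by exact this)]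
    simp
  · rw [Set.indicator_of_notMem h]
    by_cases h3 : ‖z - x‖ ∈ Set.Iio (2 * R)
    · rw [Set.indicator_of_mem h3]; positivity
    · rw [Set.indicator_of_notMem h3]

lemma integrable_norm_inv_sub (z : ℂ) {R : ℝ} (hz : ‖z‖ < R) :
    IntegrableOn (fun x => (z - x)⁻¹) (ball (0:ℂ) R) := by
  have h := (integrable_indicator_norm_inv (2 * R)).comp_sub_left z
  rw [← integrable_indicator_iff measurableSet_ball]
  refine h.mono' ?_ (Eventually.of_forall fun x => ?_)
  · exact ((measurable_const.sub measurable_id).inv.indicator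
      measurableSet_ball).aestronglyMeasurable
  · rw [norm_indicator_eq_indicator_norm]
    exact norm_indicator_inv_sub_le z x hz

lemma setIntegral_norm_inv_sub_le (z : ℂ) {R : ℝ} (hz : ‖z‖ < R) :
    ∫ x in ball (0:ℂ) R, ‖(z - x)⁻¹‖ ≤
      ∫ y : ℂ, (Set.Iio (2 * R)).indicator (fun r : ℝ => r⁻¹) ‖y‖ := by
  rw [← integral_indicator measurableSet_ball,
    ← integral_sub_left_eq_self (fun y : ℂ => (Set.Iio (2 * R)).indicator (fun r : ℝ => r⁻¹) ‖y‖)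
      volume z]
  refine integral_mono ?_ ((integrable_indicator_norm_inv (2 * R)).comp_sub_left z)
    fun x => norm_indicator_inv_sub_le z x hz
  exact (integrable_indicator_iff measurableSet_ball).2 (Integrable.norm (integrable_norm_inv_sub z hz))

lemma integral_angle_inv_sub {z : ℂ} (hz : z ≠ 0) {r : ℝ} (hr : 0 < r) (hrz : r ≠ ‖z‖) :
    ∫ θ in (-π)..π, (z - r * Complex.exp (θ * Complex.I))⁻¹ =
      if r < ‖z‖ then 2 * π / z else 0 := by
  have hper : Function.Periodic (fun θ : ℝ => (z - r * Complex.exp (θ * Complex.I))⁻¹) (2 * π) := by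
    intro θ
    simp only
    congr 3
    push_cast
    rw [add_mul, Complex.exp_add, Complex.exp_two_pi_mul_I, mul_one]
  have e1 := hper.intervalIntegral_add_eq (-π) 0
  rw [show -π + 2 * π = π by ring, zero_add] at e1
  rw [e1]
  have hne : ∀ θ : ℝ, z - circleMap 0 r θ ≠ 0 := by
    intro θ h
    apply hrz
    rw [sub_eq_zero.1 h]; simp [abs_of_pos hr]
  have e2 : ∫ θ in (0:ℝ)..(2 * π), (z - r * Complex.exp (θ * Complex.I))⁻¹ =
      (Complex.I * z)⁻¹ * ((∮ w in C(0, r), (w - 0)⁻¹) - ∮ w in C(0, r), (w - z)⁻¹) := by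
    have hi1 : CircleIntegrable (fun w : ℂ => (w - 0)⁻¹) 0 r := by
      apply ContinuousOn.circleIntegrable hr.le
      apply ContinuousOn.inv₀ (by fun_prop)
      intro w hw
      rw [sub_zero]
      exact ne_of_mem_sphere hw hr.ne'
    have hi2 : CircleIntegrable (fun w : ℂ => (w - z)⁻¹) 0 r := by
      apply ContinuousOn.circleIntegrable hr.le
      apply ContinuousOn.inv₀ (by fun_prop)
      intro w hw h
      rw [sub_eq_zero] at h
      apply hrz
      rw [← h]; simpa using hw.symm
    rw [← circleIntegral.integral_sub hi1 hi2, circleIntegral,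
      ← intervalIntegral.integral_const_mul]
    congr 1
    ext θ
    have h1 := hne θ
    have h2 : circleMap 0 r θ ≠ 0 := circleMap_ne_center hr.ne'
    have h3 : circleMap 0 r θ - z ≠ 0 := by
      intro h; apply h1; rw [← neg_sub, h, neg_zero]
    have h4 : (r : ℂ) * Complex.exp (θ * Complex.I) = circleMap 0 r θ := by simp [circleMap]
    rw [h4, deriv_circleMap, sub_zero, smul_eq_mul]
    generalize circleMap 0 r θ = w at *
    have hI := Complex.I_ne_zero
    field_simp
    ring
  rw [e2, circleIntegral.integral_sub_inv_of_mem_ball (by simpa using hr)]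
  split_ifs with h
  · have : (∮ w in C(0, r), (w - z)⁻¹) = 0 := by
      apply DiffContOnCl.circleIntegral_eq_zero hr.le
      apply DifferentiableOn.diffContOnCl
      intro w hw
      apply DifferentiableAt.differentiableWithinAt
      have : w - z ≠ 0 := by
        rw [sub_ne_zero]
        rintro rfl
        rw [closure_ball _ hr.ne', mem_closedBall_zero_iff] at hw
        linarith
      fun_prop (disch := assumption)
    rw [this]
    have hI := Complex.I_ne_zero
    field_simp
    ring
  · have hz' : z ∈ ball (0:ℂ) r := by
      rw [mem_ball_zero_iff]; exact lt_of_le_of_ne (not_lt.1 h) (Ne.symm hrz)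
    rw [circleIntegral.integral_sub_inv_of_mem_ball hz']
    simp

/-- The Cauchy transform of a disc. -/
lemma setIntegral_ball_inv_sub (z : ℂ) {R : ℝ} (hz : ‖z‖ < R) :
    ∫ x in ball (0:ℂ) R, (z - x)⁻¹ = π * (starRingEnd ℂ) z := by
  have hR : 0 < R := (norm_nonneg z).trans_lt hz
  rcases eq_or_ne z 0 with rfl | hz0
  · have : ∫ x : ℂ, (ball (0:ℂ) R).indicator (fun x => (0 - x)⁻¹) x = 0 := by
      have e := integral_neg_eq_self ((ball (0:ℂ) R).indicator (fun x : ℂ => (0 - x)⁻¹)) volume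
      have e2 : ∀ x : ℂ, (ball (0:ℂ) R).indicator (fun x : ℂ => (0 - x)⁻¹) (-x) =
          -(ball (0:ℂ) R).indicator (fun x : ℂ => (0 - x)⁻¹) x := by
        intro x
        by_cases h : x ∈ ball (0:ℂ) R
        · have h' : -x ∈ ball (0:ℂ) R := by simpa using h
          simp only [Set.indicator_of_mem h, Set.indicator_of_mem h', zero_sub, inv_neg, neg_neg]
        · have h' : -x ∉ ball (0:ℂ) R := by simpa using h
          simp only [Set.indicator_of_notMem h, Set.indicator_of_notMem h', neg_zero]
      simp only [e2, integral_neg] at e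
      exact self_eq_neg.1 e.symm
    rw [← integral_indicator measurableSet_ball, this]; simp
  rw [← integral_indicator measurableSet_ball]
  set f : ℂ → ℂ := (ball (0:ℂ) R).indicator fun x => (z - x)⁻¹ with hf
  have hfm : Measurable f :=
    (measurable_const.sub measurable_id).inv.indicator measurableSet_ball
  have hfi : Integrable f :=
    (integrable_indicator_iff measurableSet_ball).2 (integrable_norm_inv_sub z hz)
  have hT : polarCoord.target = Set.Ioi (0 : ℝ) ×ˢ Set.Ioo (-π) π := rfl
  have hsym : ∀ p : ℝ × ℝ, Complex.polarCoord.symm p = p.1 * Complex.exp (p.2 * Complex.I) := by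
    intro p
    rw [Complex.polarCoord_symm_apply, Complex.exp_mul_I]
    push_cast; ring
  have hgi : IntegrableOn (fun p : ℝ × ℝ => p.1 • f (Complex.polarCoord.symm p))
      (Set.Ioi (0 : ℝ) ×ˢ Set.Ioo (-π) π) := by
    constructor
    · apply Measurable.aestronglyMeasurable
      apply measurable_fst.smul (hfm.comp _)
      have : (Complex.polarCoord.symm : ℝ × ℝ → ℂ) =
          fun p => p.1 * Complex.exp (p.2 * Complex.I) := funext hsym
      rw [this]
      fun_prop
    · have h := Complex.lintegral_comp_polarCoord_symm (fun x => ‖f x‖ₑ)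
      rw [HasFiniteIntegral]
      refine lt_of_le_of_lt (le_of_eq ?_) hfi.2
      rw [← h, hT]
      refine setLIntegral_congr_fun (measurableSet_Ioi.prod measurableSet_Ioo) fun p hp => ?_
      have : 0 < p.1 := hp.1
      simp only [enorm_smul, smul_eq_mul]
      rw [Real.enorm_of_nonneg this.le]
  rw [← Complex.integral_comp_polarCoord_symm, hT, Measure.volume_eq_prod,
    setIntegral_prod _ (by simpa [Measure.volume_eq_prod] using hgi)]
  have key : ∀ᵐ r : ℝ, r ∈ Set.Ioi (0:ℝ) → (∫ θ in Set.Ioo (-π) π,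
      (r, θ).1 • f (Complex.polarCoord.symm (r, θ))) =
      (Set.Iio ‖z‖).indicator (fun r : ℝ => (r : ℂ) * (2 * π / z)) r := by
    have hae : ∀ᵐ r : ℝ, r ≠ ‖z‖ := by
      simp [ae_iff]
    filter_upwards [hae] with r hr1 hr
    have hr' : (0:ℝ) < r := hr
    simp only [hsym]
    rw [integral_smul, ← integral_Ioc_eq_integral_Ioo,
      ← intervalIntegral.integral_of_le (by linarith [pi_pos])]
    by_cases hrR : r < R
    · have : ∀ θ : ℝ, f (r * Complex.exp (θ * Complex.I)) =
          (z - r * Complex.exp (θ * Complex.I))⁻¹ := by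
        intro θ
        rw [hf, Set.indicator_of_mem]
        simp [Complex.norm_exp_ofReal_mul_I, abs_of_pos hr', hrR]
      simp only [this]
      rw [integral_angle_inv_sub hz0 hr' hr1]
      by_cases h : r < ‖z‖
      · rw [if_pos h, Set.indicator_of_mem (by exact h)]; simp
      · rw [if_neg h, Set.indicator_of_notMem (by exact h)]; simp
    · have : ∀ θ : ℝ, f (r * Complex.exp (θ * Complex.I)) = 0 := by
        intro θ
        rw [hf, Set.indicator_of_notMem]
        simpa [Complex.norm_exp_ofReal_mul_I, abs_of_pos hr'] using hrR
      simp only [this]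
      rw [Set.indicator_of_notMem (by simp; linarith)]; simp
  rw [setIntegral_congr_ae measurableSet_Ioi key, setIntegral_indicator measurableSet_Iio,
    Set.Ioi_inter_Iio, ← integral_Ioc_eq_integral_Ioo,
    ← intervalIntegral.integral_of_le (norm_nonneg z), intervalIntegral.integral_mul_const,
    intervalIntegral.integral_ofReal, integral_id]
  have e : z * (starRingEnd ℂ) z = ((‖z‖ ^ 2 : ℝ) : ℂ) := by
    rw [Complex.mul_conj, Complex.normSq_eq_norm_sq]
  have e' : (starRingEnd ℂ) z = ((‖z‖ ^ 2 : ℝ) : ℂ) / z := by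
    rw [← e]; field_simp
  rw [e']; push_cast; field_simp; ring

/-- The integral of the winding number of a closed curve, up to normalisation. -/
lemma integral_winding {c c' : ℝ → ℂ} (hc : Continuous c) (hc' : Continuous c') {R : ℝ}
    (hR : ∀ s ∈ Set.Icc (0:ℝ) 1, ‖c s‖ < R) :
    IntegrableOn (fun x => ∫ s in (0:ℝ)..1, c' s / (c s - x)) (ball (0:ℂ) R) ∧
    ∫ x in ball (0:ℂ) R, ∫ s in (0:ℝ)..1, c' s / (c s - x) =
      π * ∫ s in (0:ℝ)..1, c' s * (starRingEnd ℂ) (c s) := by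
  set F : ℂ × ℝ → ℂ := fun p => c' p.2 / (c p.2 - p.1) with hF
  have hFm : Measurable F := by
    have := hc.measurable; have := hc'.measurable
    fun_prop
  have hint : Integrable F ((volume.restrict (ball (0:ℂ) R)).prod
      (volume.restrict (Set.Ioc (0:ℝ) 1))) := by
    rw [integrable_prod_iff' hFm.aestronglyMeasurable]
    have hb : ∀ s ∈ Set.Ioc (0:ℝ) 1, ‖c s‖ < R := fun s hs => hR s ⟨hs.1.le, hs.2⟩
    constructor
    · filter_upwards [ae_restrict_mem measurableSet_Ioc] with s hs
      exact (Integrable.const_mul (integrable_norm_inv_sub (c s) (hb s hs)) (c' s)).congr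
        (Eventually.of_forall fun x => by simp [hF, div_eq_mul_inv])
    · obtain ⟨M, hM⟩ := isCompact_Icc.exists_bound_of_continuousOn (s := Set.Icc (0:ℝ) 1)
        hc'.continuousOn
      refine Integrable.mono' (g := fun _ => M *
        ∫ y : ℂ, (Set.Iio (2 * R)).indicator (fun r : ℝ => r⁻¹) ‖y‖) (integrable_const _) ?_ ?_
      · have := StronglyMeasurable.integral_prod_left' (μ := volume.restrict (ball (0:ℂ) R))
          hFm.norm.stronglyMeasurable
        exact this.aestronglyMeasurable
      · filter_upwards [ae_restrict_mem measurableSet_Ioc] with s hs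
        have hM' := hM s ⟨hs.1.le, hs.2⟩
        rw [Real.norm_of_nonneg (integral_nonneg fun _ => norm_nonneg _)]
        simp only [hF, div_eq_mul_inv, norm_mul]
        rw [integral_const_mul]
        exact mul_le_mul hM' (setIntegral_norm_inv_sub_le _ (hb s hs))
          (integral_nonneg fun _ => norm_nonneg _) ((norm_nonneg _).trans hM')
  have h01 : (0:ℝ) ≤ 1 := zero_le_one
  constructor
  · simp only [intervalIntegral.integral_of_le h01]
    exact hint.integral_prod_left
  · simp only [intervalIntegral.integral_of_le h01]
    have := integral_integral_swap (f := fun x s => c' s / (c s - x)) hint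
    rw [this, ← integral_const_mul]
    refine setIntegral_congr_fun measurableSet_Ioc fun s hs => ?_
    simp only [div_eq_mul_inv]
    rw [integral_const_mul, setIntegral_ball_inv_sub _ (hR s ⟨hs.1.le, hs.2⟩)]
    ring

/-- A `C²` Jordan curve in the complex plane, with its first two derivatives. -/
structure PlaneLoop where
  /-- the curve -/
  c : ℝ → ℂ
  /-- its derivative -/
  c1 : ℝ → ℂ
  /-- its second derivative -/
  c2 : ℝ → ℂ
  hasDerivAt_c : ∀ s, HasDerivAt c (c1 s) s
  hasDerivAt_c1 : ∀ s, HasDerivAt c1 (c2 s) s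
  continuous_c2 : Continuous c2
  periodic : Function.Periodic c 1
  injOn : Set.InjOn c (Set.Ico 0 1)
  c1_ne_zero : ∀ s, c1 s ≠ 0

namespace PlaneLoop
variable (γ : PlaneLoop)

lemma continuous_c : Continuous γ.c :=
  continuous_iff_continuousAt.2 fun s => (γ.hasDerivAt_c s).continuousAt

lemma continuous_c1 : Continuous γ.c1 :=
  continuous_iff_continuousAt.2 fun s => (γ.hasDerivAt_c1 s).continuousAt

lemma periodic_c1 : Function.Periodic γ.c1 1 := by
  intro s
  have h := (γ.hasDerivAt_c (s + 1)).comp_add_const s 1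
  have e : (fun x => γ.c (x + 1)) = γ.c := funext γ.periodic
  rw [e] at h
  exact h.unique (γ.hasDerivAt_c s)

lemma periodic_c2 : Function.Periodic γ.c2 1 := by
  intro s
  have h := (γ.hasDerivAt_c1 (s + 1)).comp_add_const s 1
  have e : (fun x => γ.c1 (x + 1)) = γ.c1 := funext γ.periodic_c1
  rw [e] at h
  exact h.unique (γ.hasDerivAt_c1 s)

lemma eq_of_c_eq {s t : ℝ} (hst : |s - t| < 1) (h : γ.c s = γ.c t) : s = t := by
  have hf : ∀ s, γ.c (Int.fract s) = γ.c s := by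
    intro s
    have := γ.periodic.sub_int_mul_eq ⌊s⌋ (x := s)
    rwa [mul_one, Int.self_sub_floor] at this
  have h' := γ.injOn ⟨Int.fract_nonneg s, Int.fract_lt_one s⟩
    ⟨Int.fract_nonneg t, Int.fract_lt_one t⟩ (by rw [hf, hf, h])
  obtain ⟨n, hn⟩ := Int.fract_eq_fract.1 h'
  rw [hn] at hst
  have : n = 0 := by
    rw [← Int.abs_lt_one_iff]; exact_mod_cast hst
  rw [this] at hn
  simp at hn
  linarith

/-- A continuous logarithm of the derivative. -/
def logDer : ℝ → ℂ :=
  (exists_log_lift γ.hasDerivAt_c1 γ.continuous_c2 γ.c1_ne_zero 0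
    (Complex.exp_log (γ.c1_ne_zero 0))).choose

lemma hasDerivAt_logDer (s : ℝ) : HasDerivAt γ.logDer (γ.c2 s / γ.c1 s) s :=
  (exists_log_lift γ.hasDerivAt_c1 γ.continuous_c2 γ.c1_ne_zero 0
    (Complex.exp_log (γ.c1_ne_zero 0))).choose_spec.2.1 s

lemma exp_logDer (s : ℝ) : Complex.exp (γ.logDer s) = γ.c1 s :=
  (exists_log_lift γ.hasDerivAt_c1 γ.continuous_c2 γ.c1_ne_zero 0
    (Complex.exp_log (γ.c1_ne_zero 0))).choose_spec.2.2 s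

/-- The tangent angle. -/
def ang (s : ℝ) : ℝ := (γ.logDer s).im

/-- The derivative of the tangent angle. -/
def angd (s : ℝ) : ℝ := (γ.c2 s / γ.c1 s).im

lemma continuous_angd : Continuous γ.angd :=
  Complex.continuous_im.comp (γ.continuous_c2.div γ.continuous_c1 γ.c1_ne_zero)

lemma hasDerivAt_ang (s : ℝ) : HasDerivAt γ.ang (γ.angd s) s := by
  have := (Complex.imCLM.hasFDerivAt.comp_hasDerivAt s (γ.hasDerivAt_logDer s))
  exact this

lemma continuous_ang : Continuous γ.ang :=
  continuous_iff_continuousAt.2 fun s => (γ.hasDerivAt_ang s).continuousAt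

/-- The unit tangent. -/
def tan (s : ℝ) : ℂ := Complex.exp (γ.ang s * Complex.I)

/-- The unit normal. -/
def nor (s : ℝ) : ℂ := Complex.I * γ.tan s

lemma norm_tan (s : ℝ) : ‖γ.tan s‖ = 1 := Complex.norm_exp_ofReal_mul_I _

lemma norm_nor (s : ℝ) : ‖γ.nor s‖ = 1 := by simp [nor, norm_tan]

lemma c1_eq (s : ℝ) : γ.c1 s = ‖γ.c1 s‖ * γ.tan s := by
  rw [tan, ang, ← γ.exp_logDer s, Complex.norm_exp, Complex.ofReal_exp, ← Complex.exp_add,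
    Complex.re_add_im]

lemma tan_eq (s : ℝ) : γ.tan s = γ.c1 s / ‖γ.c1 s‖ := by
  have : (‖γ.c1 s‖ : ℂ) ≠ 0 := by exact_mod_cast (norm_pos_iff.2 (γ.c1_ne_zero s)).ne'
  rw [eq_div_iff this, mul_comm, ← γ.c1_eq]

lemma periodic_tan : Function.Periodic γ.tan 1 := by
  intro s; rw [tan_eq, tan_eq, γ.periodic_c1]

lemma periodic_nor : Function.Periodic γ.nor 1 := by
  intro s; rw [nor, nor, γ.periodic_tan]

lemma periodic_angd : Function.Periodic γ.angd 1 := by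
  intro s; rw [angd, angd, γ.periodic_c1, γ.periodic_c2]

lemma hasDerivAt_tan (s : ℝ) : HasDerivAt γ.tan (γ.angd s * γ.nor s) s := by
  have := ((γ.hasDerivAt_ang s).ofReal_comp.mul_const Complex.I).cexp
  refine this.congr_deriv ?_
  rw [nor, tan]; ring

lemma hasDerivAt_nor (s : ℝ) : HasDerivAt γ.nor (-(γ.angd s * γ.tan s)) s := by
  have := (γ.hasDerivAt_tan s).const_mul Complex.I
  refine this.congr_deriv ?_
  rw [nor, mul_left_comm, ← mul_assoc Complex.I, Complex.I_mul_I]; ring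

lemma continuous_tan : Continuous γ.tan :=
  continuous_iff_continuousAt.2 fun s => (γ.hasDerivAt_tan s).continuousAt

lemma continuous_nor : Continuous γ.nor := continuous_const.mul γ.continuous_tan

/-- The parallel curve at signed distance `t`. -/
def par (t s : ℝ) : ℂ := γ.c s + t * γ.nor s

/-- The derivative of the parallel curve. -/
def pard (t s : ℝ) : ℂ := (‖γ.c1 s‖ - t * γ.angd s : ℝ) * γ.tan s

lemma hasDerivAt_par (t s : ℝ) : HasDerivAt (γ.par t) (γ.pard t s) s := by
  have := (γ.hasDerivAt_c s).add ((γ.hasDerivAt_nor s).const_mul (t : ℂ))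
  refine this.congr_deriv ?_
  rw [pard]
  nth_rewrite 1 [γ.c1_eq]
  push_cast; ring

lemma continuous_par (t : ℝ) : Continuous (γ.par t) :=
  continuous_iff_continuousAt.2 fun s => (γ.hasDerivAt_par t s).continuousAt

lemma continuous_pard (t : ℝ) : Continuous (γ.pard t) := by
  have h1 := γ.continuous_angd; have h2 := γ.continuous_c1; have h3 := γ.continuous_tan
  unfold pard; fun_prop

lemma periodic_par (t : ℝ) : Function.Periodic (γ.par t) 1 := by
  intro s; rw [par, par, γ.periodic, γ.periodic_nor]

lemma periodic_pard (t : ℝ) : Function.Periodic (γ.pard t) 1 := by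
  intro s; rw [pard, pard, γ.periodic_c1, γ.periodic_angd, γ.periodic_tan]

/-- The length of the curve. -/
def len : ℝ := ∫ s in (0:ℝ)..1, ‖γ.c1 s‖

/-- The change of signed area when passing to a parallel curve. -/
lemma signedArea_par (t : ℝ) (hturn : γ.ang 1 = γ.ang 0 + 2 * π) :
    (∫ s in (0:ℝ)..1, γ.pard t s * (starRingEnd ℂ) (γ.par t s)).im =
      (∫ s in (0:ℝ)..1, γ.c1 s * (starRingEnd ℂ) (γ.c s)).im
        - 2 * t * γ.len + 2 * π * t ^ 2 := by
  have hc := γ.continuous_c; have hc1 := γ.continuous_c1; have hp := γ.continuous_par t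
  have hpd := γ.continuous_pard t; have ha := γ.continuous_angd
  have him : ∀ f : ℝ → ℂ, Continuous f →
      (∫ s in (0:ℝ)..1, f s).im = ∫ s in (0:ℝ)..1, (f s).im := fun f hf =>
    (Complex.imCLM.intervalIntegral_comp_comm (hf.intervalIntegrable _ _)).symm
  rw [him _ (by fun_prop), him _ (by fun_prop)]
  set f : ℝ → ℝ := fun s => (γ.tan s * (starRingEnd ℂ) (γ.c s)).re with hf
  have hfd : ∀ s, HasDerivAt f (‖γ.c1 s‖ - γ.angd s * (γ.tan s * (starRingEnd ℂ) (γ.c s)).im) s := by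
    intro s
    have h1 := (γ.hasDerivAt_tan s).mul
      ((Complex.conjCLE.toContinuousLinearMap.hasFDerivAt).comp_hasDerivAt s (γ.hasDerivAt_c s))
    have h2 := Complex.reCLM.hasFDerivAt.comp_hasDerivAt s h1
    refine HasDerivAt.congr_deriv h2 ?_
    have h3 := γ.norm_tan s
    have h4 : γ.tan s * (starRingEnd ℂ) (γ.c1 s) = ‖γ.c1 s‖ := by
      nth_rewrite 1 [γ.c1_eq]
      rw [map_mul, Complex.conj_ofReal, mul_left_comm, Complex.mul_conj,
        Complex.normSq_eq_norm_sq, h3]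
      simp
    simp only [Complex.reCLM_apply, nor, Function.comp, ContinuousLinearEquiv.coe_coe,
      Complex.conjCLE_apply, h4, Complex.add_re, Complex.ofReal_re]
    simp
    ring
  have hf1 : f 1 = f 0 := by
    have h1 := γ.periodic_tan 0; have h2 := γ.periodic 0
    rw [zero_add] at h1 h2
    simp only [hf, h1, h2]
  have hfc : Continuous fun s => γ.angd s * (γ.tan s * (starRingEnd ℂ) (γ.c s)).im := by
    have := γ.continuous_tan
    fun_prop
  have i1 := intervalIntegral.integral_eq_sub_of_hasDerivAt (a := (0:ℝ)) (b := 1)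
    (fun s _ => hfd s) ((hc1.norm.sub hfc).intervalIntegrable _ _)
  have i2 := intervalIntegral.integral_eq_sub_of_hasDerivAt (a := (0:ℝ)) (b := 1)
    (fun s _ => γ.hasDerivAt_ang s) (ha.intervalIntegrable _ _)
  rw [hf1, sub_self] at i1
  have e : ∀ s, (γ.pard t s * (starRingEnd ℂ) (γ.par t s)).im =
      ((γ.c1 s * (starRingEnd ℂ) (γ.c s)).im - 2 * t * ‖γ.c1 s‖ + t ^ 2 * γ.angd s) +
      t * (‖γ.c1 s‖ - γ.angd s * (γ.tan s * (starRingEnd ℂ) (γ.c s)).im) := by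
    intro s
    have h3 : (γ.tan s).re ^ 2 + (γ.tan s).im ^ 2 = 1 := by
      have := Complex.normSq_eq_norm_sq (γ.tan s)
      rw [γ.norm_tan, Complex.normSq_apply] at this
      linarith
    nth_rewrite 1 [γ.c1_eq]
    simp [pard, par, nor]
    linear_combination (t ^ 2 * γ.angd s - t * ‖γ.c1 s‖) * h3
  simp only [e]
  have ic := hc1.norm
  have ics : Continuous fun s => (γ.c1 s * (starRingEnd ℂ) (γ.c s)).im := by fun_prop
  have hB : Continuous fun s => t * (‖γ.c1 s‖ -
      γ.angd s * (γ.tan s * (starRingEnd ℂ) (γ.c s)).im) := continuous_const.mul (ic.sub hfc)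
  rw [intervalIntegral.integral_add (Continuous.intervalIntegrable (by fun_prop) _ _)
      (hB.intervalIntegrable _ _),
    intervalIntegral.integral_const_mul, i1,
    intervalIntegral.integral_add (Continuous.intervalIntegrable (by fun_prop) _ _)
      (Continuous.intervalIntegrable (by fun_prop) _ _),
    intervalIntegral.integral_sub (Continuous.intervalIntegrable (by fun_prop) _ _)
      (Continuous.intervalIntegrable (by fun_prop) _ _),
    intervalIntegral.integral_const_mul, intervalIntegral.integral_const_mul, i2, hturn, len]
  ring

end PlaneLoop

namespace PlaneLoop

lemma int_le_of_bounds {m n : ℤ} (h : 2 * π * m < 2 * π * (n + 1)) : m ≤ n := by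
  have hpi := pi_pos
  have : (m : ℝ) < n + 1 := lt_of_mul_lt_mul_left h (by positivity)
  exact Int.lt_add_one_iff.1 (by exact_mod_cast this)

lemma int_eq_of_bounds {m n : ℤ} (h1 : 2 * π * m < 2 * π * (n + 1))
    (h2 : 2 * π * n < 2 * π * (m + 1)) : m = n :=
  le_antisymm (int_le_of_bounds h1) (int_le_of_bounds h2)

section

variable (γ : PlaneLoop) {x : ℂ} {t : ℝ} {Z V : ℝ → ℂ}

lemma norm_eq_exp_re (hZe : ∀ s, Complex.exp (Z s) = γ.c s - x) (s : ℝ) :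
    ‖γ.c s - x‖ = Real.exp (Z s).re := by rw [← hZe, Complex.norm_exp]

lemma exp_V (hZe : ∀ s, Complex.exp (Z s) = γ.c s - x)
    (hVe : ∀ s, Complex.exp (V s) * (γ.c s - x) = γ.par t s - x) (s : ℝ) :
    Complex.exp (V s) = 1 + t * γ.nor s / (γ.c s - x) := by
  have h : γ.c s - x ≠ 0 := by rw [← hZe]; exact Complex.exp_ne_zero _
  field_simp
  rw [mul_comm, mul_comm, hVe, par]; ring

lemma cos_V_pos (ht : 0 < t) (hZe : ∀ s, Complex.exp (Z s) = γ.c s - x)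
    (hVe : ∀ s, Complex.exp (V s) * (γ.c s - x) = γ.par t s - x) {s : ℝ}
    (hs : t ≤ ‖γ.c s - x‖) : 0 < cos (V s).im := by
  have h := γ.exp_V hZe hVe s
  set ξ := t * γ.nor s / (γ.c s - x) with hξ
  have hξn : ‖ξ‖ ≤ 1 := by
    rw [hξ, norm_div, norm_mul, γ.norm_nor, mul_one, Complex.norm_real, Real.norm_of_nonneg ht.le]
    exact div_le_one_of_le₀ hs (norm_nonneg _)
  have hpos : 0 < (1 + ξ).re := by
    by_contra hcon
    push Not at hcon
    simp at hcon
    have h1 : ξ.re ^ 2 + ξ.im ^ 2 ≤ 1 := by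
      have := Complex.normSq_eq_norm_sq ξ
      rw [Complex.normSq_apply] at this
      nlinarith [norm_nonneg ξ]
    have h2 : ξ.re = -1 := by nlinarith [sq_nonneg ξ.im]
    have h3 : ξ.im = 0 := by nlinarith [sq_nonneg ξ.im]
    have : ξ = -1 := Complex.ext (by simp [h2]) (by simp [h3])
    rw [this] at h
    exact Complex.exp_ne_zero (V s) (by rw [h]; ring)
  rw [← h, Complex.exp_re] at hpos
  exact pos_of_mul_pos_right hpos (Real.exp_pos _).le

lemma exists_int_V (ht : 0 < t) (hZe : ∀ s, Complex.exp (Z s) = γ.c s - x)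
    (hVe : ∀ s, Complex.exp (V s) * (γ.c s - x) = γ.par t s - x) {s : ℝ}
    (hs : t ≤ ‖γ.c s - x‖) : ∃ m : ℤ, |(V s).im - 2 * π * m| < π / 2 := by
  have hcos := γ.cos_V_pos ht hZe hVe hs
  obtain ⟨k, hk⟩ := exists_band (g := fun _ => (V s).im) (ω := 0) (le_refl (0:ℝ))
    continuousOn_const (fun _ _ => by simpa using hcos.le)
  have h1 := hk 0 (by simp)
  rw [sub_zero] at h1
  refine ⟨k, lt_of_le_of_ne h1 fun h => ?_⟩
  have h2 : cos ((V s).im - 2 * π * k) = cos (V s).im := by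
    rw [← cos_sub_int_mul_two_pi (V s).im k]; ring_nf
  rw [← cos_abs, h, cos_pi_div_two] at h2
  linarith

/-- Behaviour of the winding angle of the parallel curve across an arc inside a disc. -/
lemma angle_gap (ht : 0 < t) (hZ : ∀ s, HasDerivAt Z (γ.c1 s / (γ.c s - x)) s)
    (hZe : ∀ s, Complex.exp (Z s) = γ.c s - x) (hV : Continuous V)
    (hVe : ∀ s, Complex.exp (V s) * (γ.c s - x) = γ.par t s - x) {a b : ℝ} (hab : a < b)
    (hab1 : b - a < 1) (ha : ‖γ.c a - x‖ = t) (hb : ‖γ.c b - x‖ = t)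
    (hgap : ∀ s ∈ Set.Icc a b, ‖γ.c s - x‖ ≤ t) {ma mb : ℤ}
    (hma : |(V a).im - 2 * π * ma| < π / 2) (hmb : |(V b).im - 2 * π * mb| < π / 2) :
    mb ≤ ma ∧ ∀ s₀ ∈ Set.Ioo a b, ∀ r : ℝ, 0 < r → γ.c s₀ + r * γ.nor s₀ = x →
      (∀ s, r ≤ ‖γ.c s - x‖) → mb = ma - 1 := by
  have hpi := pi_pos
  have hne : ∀ s, γ.c s - x ≠ 0 := fun s => by rw [← hZe]; exact Complex.exp_ne_zero _
  have hZc : Continuous Z := continuous_iff_continuousAt.2 fun s => (hZ s).continuousAt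
  set Z' : ℝ → ℂ := fun s => γ.c1 s / (γ.c s - x) with hZ'
  have hZ'c : Continuous Z' :=
    γ.continuous_c1.div (γ.continuous_c.sub continuous_const) hne
  have hZ'0 : ∀ s, Z' s ≠ 0 := fun s => div_ne_zero (γ.c1_ne_zero s) (hne s)
  set ψ : ℝ → ℝ := fun s => γ.ang s - (Z s).im with hψ
  have hψc : Continuous ψ := γ.continuous_ang.sub (Complex.continuous_im.comp hZc)
  have hψe : ∀ s, Complex.exp (ψ s * Complex.I) =
      γ.tan s * ‖γ.c s - x‖ / (γ.c s - x) := by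
    intro s
    have e1 : γ.c s - x = ‖γ.c s - x‖ * Complex.exp ((Z s).im * Complex.I) := by
      rw [γ.norm_eq_exp_re hZe, ← hZe, Complex.ofReal_exp, ← Complex.exp_add, Complex.re_add_im]
    have e2 := Complex.exp_ne_zero ((Z s).im * Complex.I)
    have e3 : (‖γ.c s - x‖ : ℂ) ≠ 0 := by exact_mod_cast (norm_pos_iff.2 (hne s)).ne'
    have e4 : Complex.exp (ψ s * Complex.I) = γ.tan s / Complex.exp ((Z s).im * Complex.I) := by
      rw [tan, ← Complex.exp_sub, hψ]; push_cast; ring_nf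
    rw [e4]
    nth_rewrite 2 [e1]
    field_simp
  have hψZ : ∀ s, Z' s = ‖Z' s‖ * Complex.exp (ψ s * Complex.I) := by
    intro s
    have e3 : (‖γ.c s - x‖ : ℂ) ≠ 0 := by exact_mod_cast (norm_pos_iff.2 (hne s)).ne'
    rw [hψe, hZ']
    simp only [norm_div]
    nth_rewrite 1 [γ.c1_eq]
    push_cast
    field_simp
  have hinj : Set.InjOn Z (Set.Icc a b) := by
    intro s hs s' hs' h
    have : γ.c s - x = γ.c s' - x := by rw [← hZe, ← hZe, h]
    exact γ.eq_of_c_eq (by rw [abs_lt]; constructor <;> linarith [hs.1, hs.2, hs'.1, hs'.2])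
      (sub_left_injective this)
  have hre : ∀ s s', (Z s).re ≤ (Z s').re ↔ ‖γ.c s - x‖ ≤ ‖γ.c s' - x‖ := by
    intro s s'; rw [γ.norm_eq_exp_re hZe, γ.norm_eq_exp_re hZe, Real.exp_le_exp]
  have hpiω : Complex.exp (-((π : ℝ) * Complex.I)) = -1 := by
    rw [Complex.exp_neg, Complex.exp_pi_mul_I]; norm_num
  have hopf := fun (p q : ℝ) (hp : a ≤ p) (hpq : p < q) (hq : q ≤ b) (ω₁ ω₂ : ℝ) =>
    hopf_secant hZ hZ'c hZ'0 hpq (hinj.mono (Set.Icc_subset_Icc hp hq)) hψc hψZ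
      (ω₁ := ω₁) (ω₂ := ω₂)
  -- comparison of the angles of `V` and of the tangent
  obtain ⟨k₀, hk₀⟩ := exists_band (g := fun s => (V s).im - (ψ s + π / 2)) (ω := 0) hab.le
    (by fun_prop) (by
      intro s hs
      have hn0 : γ.nor s ≠ 0 := by rw [← norm_pos_iff, γ.norm_nor]; exact one_pos
      have ht0 : (t : ℂ) ≠ 0 := by exact_mod_cast ht.ne'
      have e := γ.exp_V hZe hVe s
      set ξ := t * γ.nor s / (γ.c s - x) with hξ
      have hξ0 : ξ ≠ 0 := div_ne_zero (mul_ne_zero ht0 hn0) (hne s)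
      have hξn : 1 ≤ ‖ξ‖ := by
        rw [hξ, norm_div, norm_mul, γ.norm_nor, mul_one, Complex.norm_real,
          Real.norm_of_nonneg ht.le, one_le_div (norm_pos_iff.2 (hne s))]
        exact hgap s hs
      have e2 : ξ = ‖ξ‖ * Complex.exp (((ψ s + π / 2 : ℝ) : ℂ) * Complex.I) := by
        have e3 : (‖γ.c s - x‖ : ℂ) ≠ 0 := by exact_mod_cast (norm_pos_iff.2 (hne s)).ne'
        push_cast
        rw [add_mul, Complex.exp_add, hψe, Complex.exp_pi_div_two_mul_I, hξ, norm_div, norm_mul,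
          γ.norm_nor, mul_one, Complex.norm_real, Real.norm_of_nonneg ht.le, nor]
        push_cast
        field_simp
      have e4 : Complex.exp (V s - ((ψ s + π / 2 : ℝ) : ℂ) * Complex.I) = ‖ξ‖ * (1 + ξ⁻¹) := by
        have := Complex.exp_ne_zero (((ψ s + π / 2 : ℝ) : ℂ) * Complex.I)
        rw [Complex.exp_sub, e, div_eq_iff this, mul_right_comm, ← e2]
        field_simp
        ring
      have e5 := congrArg Complex.re e4
      rw [Complex.exp_re, Complex.re_ofReal_mul] at e5
      have e6 : 0 ≤ (1 + ξ⁻¹).re := by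
        have h1 := Complex.abs_re_le_norm ξ⁻¹
        rw [norm_inv] at h1
        have h2 := inv_le_one_of_one_le₀ hξn
        have h3 := (abs_le.1 (h1.trans h2)).1
        rw [Complex.add_re, Complex.one_re]
        linarith
      have e7 : 0 ≤ Real.exp (V s - ((ψ s + π / 2 : ℝ) : ℂ) * Complex.I).re *
          cos (V s - ((ψ s + π / 2 : ℝ) : ℂ) * Complex.I).im := by
        rw [e5]; exact mul_nonneg (norm_nonneg _) e6
      have e8 := nonneg_of_mul_nonneg_right e7 (Real.exp_pos _)
      simpa using e8)
  have ka := abs_le.1 (hk₀ a ⟨le_rfl, hab.le⟩)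
  have kb := abs_le.1 (hk₀ b ⟨hab.le, le_rfl⟩)
  have ma' := abs_lt.1 hma
  have mb' := abs_lt.1 hmb
  obtain ⟨k₁, k₂, v, h1, h2, h3, h4⟩ := hopf a b le_rfl hab le_rfl π 0 (by
    intro s hs
    rw [hpiω]
    have := (hre s a).2 ((hgap s hs).trans ha.ge)
    simp; linarith) (by
    intro s hs
    have := (hre s b).2 ((hgap s hs).trans hb.ge)
    simp; linarith)
  rw [abs_le] at h1 h2 h3 h4
  have E1 : ma = k₀ + k₁ + 1 := by
    apply int_eq_of_bounds <;> push_cast <;> linarith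
  have E2 : mb = k₀ + k₂ := by
    apply int_eq_of_bounds <;> push_cast <;> linarith
  refine ⟨?_, ?_⟩
  · have : k₂ ≤ k₁ + 1 := by apply int_le_of_bounds; push_cast; linarith
    omega
  · intro s₀ hs₀ r hr hrx hmin
    have hρ : ‖γ.c s₀ - x‖ = r := by
      rw [← hrx, sub_add_cancel_left, norm_neg, norm_mul, γ.norm_nor, Complex.norm_real,
        Real.norm_of_nonneg hr.le, mul_one]
    obtain ⟨l₁, l₂, v', p1, p2, p3, p4⟩ := hopf a s₀ le_rfl hs₀.1 hs₀.2.le π π (by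
      intro s hs
      rw [hpiω]
      have := (hre s a).2 ((hgap s ⟨hs.1, hs.2.trans hs₀.2.le⟩).trans ha.ge)
      simp; linarith) (by
      intro s hs
      rw [hpiω]
      have := (hre s₀ s).2 (hρ.trans_le (hmin s))
      simp; linarith)
    obtain ⟨j₁, j₂, w, q1, q2, q3, q4⟩ := hopf s₀ b hs₀.1.le hs₀.2 le_rfl 0 0 (by
      intro s hs
      have := (hre s₀ s).2 (hρ.trans_le (hmin s))
      simp; linarith) (by
      intro s hs
      have := (hre s b).2 ((hgap s ⟨hs₀.1.le.trans hs.1, hs.2⟩).trans hb.ge)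
      simp; linarith)
    rw [abs_le] at p1 p2 p3 p4 q1 q2 q3 q4
    have hψ0 : ∃ j : ℤ, ψ s₀ = π / 2 + 2 * π * j := by
      have e : Complex.exp (ψ s₀ * Complex.I) = Complex.exp (((π / 2 : ℝ) : ℂ) * Complex.I) := by
        have hr0 : (r : ℂ) ≠ 0 := by exact_mod_cast hr.ne'
        have ht0 : γ.tan s₀ ≠ 0 := by rw [← norm_pos_iff, γ.norm_tan]; exact one_pos
        rw [hψe, hρ]
        push_cast
        rw [Complex.exp_pi_div_two_mul_I, ← hrx, nor]
        have hI := Complex.I_ne_zero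
        rw [div_eq_iff (by simp [hr0, ht0])]
        linear_combination (r * γ.tan s₀) * Complex.I_mul_I
      obtain ⟨n, hn⟩ := Complex.exp_eq_exp_iff_exists_int.1 e
      refine ⟨n, ?_⟩
      have := congrArg Complex.im hn
      simp at this
      rw [this]; ring
    obtain ⟨j, hj⟩ := hψ0
    have F1 : ma = k₀ + l₁ + 1 := by
      apply int_eq_of_bounds <;> push_cast <;> linarith
    have F2 : mb = k₀ + j₂ := by
      apply int_eq_of_bounds <;> push_cast <;> linarith
    have F3 : l₁ = l₂ := by apply int_eq_of_bounds <;> linarith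
    have F4 : j₁ = j₂ := by apply int_eq_of_bounds <;> linarith
    have F5 : j = l₂ := by apply int_eq_of_bounds <;> linarith
    have F6 : j = j₁ := by apply int_eq_of_bounds <;> linarith
    omega
end
end PlaneLoop

/-- The component of a sublevel set around a point, inside an interval. -/
lemma exists_gap {f : ℝ → ℝ} (hf : Continuous f) {t p s₀ q : ℝ} (hps : p ≤ s₀) (hsq : s₀ ≤ q)
    (hp : t ≤ f p) (hq : t ≤ f q) (hs : f s₀ < t) :
    ∃ a b, p ≤ a ∧ a < s₀ ∧ s₀ < b ∧ b ≤ q ∧ f a = t ∧ f b = t ∧ ∀ s ∈ Set.Icc a b, f s ≤ t := by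
  set A := {s | t ≤ f s} ∩ Set.Icc p s₀ with hA
  set B := {s | t ≤ f s} ∩ Set.Icc s₀ q with hB
  have hAc : IsCompact A := isCompact_Icc.inter_left (isClosed_le continuous_const hf)
  have hBc : IsCompact B := isCompact_Icc.inter_left (isClosed_le continuous_const hf)
  obtain ⟨a, ha⟩ := hAc.exists_isGreatest ⟨p, hp, le_rfl, hps⟩
  obtain ⟨b, hb⟩ := hBc.exists_isLeast ⟨q, hq, hsq, le_rfl⟩
  have has : a < s₀ := lt_of_le_of_ne ha.1.2.2 fun h => by
    have := ha.1.1; rw [h] at this; exact absurd hs (not_lt.2 this)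
  have hbs : s₀ < b := lt_of_le_of_ne hb.1.2.1 fun h => by
    have := hb.1.1; rw [← h] at this; exact absurd hs (not_lt.2 this)
  have hlt : ∀ s ∈ Set.Ioo a b, f s < t := by
    intro s hs'
    by_contra hcon
    push Not at hcon
    rcases le_total s s₀ with h | h
    · exact absurd (ha.2 ⟨hcon, ha.1.2.1.trans hs'.1.le, h⟩) (not_le.2 hs'.1)
    · exact absurd (hb.2 ⟨hcon, h, hs'.2.le.trans hb.1.2.2⟩) (not_le.2 hs'.2)
  have hle : ∀ s ∈ Set.Icc a b, f s ≤ t := by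
    intro s hs'
    rw [← closure_Ioo (has.trans hbs).ne] at hs'
    exact closure_minimal (fun s hs => (hlt s hs).le) (isClosed_le hf continuous_const) hs'
  exact ⟨a, b, ha.1.2.1, has, hbs, hb.1.2.2, le_antisymm (hle a ⟨le_rfl, (has.trans hbs).le⟩) ha.1.1,
    le_antisymm (hle b ⟨(has.trans hbs).le, le_rfl⟩) hb.1.1, hle⟩

namespace PlaneLoop
variable (γ : PlaneLoop) {x : ℂ} {t : ℝ} {Z V : ℝ → ℂ}

lemma angle_antitone (ht : 0 < t) (hZ : ∀ s, HasDerivAt Z (γ.c1 s / (γ.c s - x)) s)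
    (hZe : ∀ s, Complex.exp (Z s) = γ.c s - x) (hV : Continuous V)
    (hVe : ∀ s, Complex.exp (V s) * (γ.c s - x) = γ.par t s - x) {σ : ℝ}
    (hσ : t < ‖γ.c σ - x‖) {p q : ℝ} (hσp : σ ≤ p) (hpq : p ≤ q) (hq1 : q ≤ σ + 1)
    (hp : t ≤ ‖γ.c p - x‖) (hq : t ≤ ‖γ.c q - x‖) {mp mq : ℤ}
    (hmp : |(V p).im - 2 * π * mp| < π / 2) (hmq : |(V q).im - 2 * π * mq| < π / 2) :
    mq ≤ mp := by
  have hρ : Continuous fun s => ‖γ.c s - x‖ := (γ.continuous_c.sub continuous_const).norm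
  have hVi : Continuous fun s => (V s).im := Complex.continuous_im.comp hV
  set T := {s | t ≤ ‖γ.c s - x‖} ∩ {s | (V s).im ≤ 2 * π * mp + π / 2} ∩ Set.Icc p q with hT
  have hTc : IsCompact T := isCompact_Icc.inter_left
    ((isClosed_le continuous_const hρ).inter (isClosed_le hVi continuous_const))
  have hpT : p ∈ T := ⟨⟨hp, by have := (abs_lt.1 hmp).2; simp only [Set.mem_ofPred_eq]; linarith⟩,
    le_rfl, hpq⟩
  obtain ⟨m, hm⟩ := hTc.exists_isGreatest ⟨p, hpT⟩
  have hmT : ∀ s ∈ T, ∀ k : ℤ, |(V s).im - 2 * π * k| < π / 2 → k ≤ mp := by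
    intro s hs k hk
    have h1 := (abs_lt.1 hk).1
    have h2 := hs.1.2
    simp only [Set.mem_ofPred_eq] at h2
    apply int_le_of_bounds
    have := pi_pos
    linarith
  have hmS : t ≤ ‖γ.c m - x‖ := hm.1.1.1
  obtain ⟨k, hk⟩ := γ.exists_int_V ht hZe hVe hmS
  have hkm := hmT m hm.1 k hk
  rcases eq_or_lt_of_le hm.1.2.2 with h | h
  · rw [h] at hm; exact hmT q hm.1 mq hmq
  exfalso
  have hkm' : (k : ℝ) ≤ mp := by exact_mod_cast hkm
  have hlt : (V m).im < 2 * π * mp + π / 2 := by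
    have := (abs_lt.1 hk).2
    have : 2 * π * k ≤ 2 * π * mp := by have := pi_pos; gcongr
    linarith
  obtain ⟨ε, hε, hεV⟩ := Metric.eventually_nhds_iff.1 (hVi.continuousAt.eventually_lt_const hlt)
  have hnS : ∀ s ∈ Set.Ioo m (min (m + ε) q), ‖γ.c s - x‖ < t := by
    intro s hs
    by_contra hcon
    push Not at hcon
    have hs2 := lt_min_iff.1 hs.2
    have : s ∈ T := ⟨⟨hcon, (hεV (by rw [Real.dist_eq, abs_lt]; constructor <;> linarith [hs.1])).le⟩,
      hm.1.2.1.trans hs.1.le, hs2.2.le⟩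
    exact absurd (hm.2 this) (not_le.2 hs.1)
  obtain ⟨s₀, hs₀⟩ : (Set.Ioo m (min (m + ε) q)).Nonempty :=
    Set.nonempty_Ioo.2 (lt_min (by linarith) h)
  have hs₀2 := lt_min_iff.1 hs₀.2
  obtain ⟨a, b, hma, has, hsb, hbq, hfa, hfb, hle⟩ :=
    exists_gap hρ hs₀.1.le hs₀2.2.le hmS hq (hnS s₀ hs₀)
  have ham : a = m := by
    by_contra hne
    have := hnS a ⟨lt_of_le_of_ne hma (Ne.symm hne), has.trans hs₀.2⟩
    linarith
  subst ham
  have hb1 : b - a < 1 := by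
    by_contra hcon
    push Not at hcon
    have : a = σ := by linarith [hm.1.2.1]
    rw [← this] at hσ; linarith
  obtain ⟨kb, hkb⟩ := γ.exists_int_V ht hZe hVe hfb.ge
  have h1 := (γ.angle_gap ht hZ hZe hV hVe (has.trans hsb) hb1 hfa hfb hle hk hkb).1
  have hkb' : (kb : ℝ) ≤ mp := by exact_mod_cast h1.trans hkm
  have : b ∈ T := by
    refine ⟨⟨hfb.ge, ?_⟩, hm.1.2.1.trans (has.trans hsb).le, hbq⟩
    simp only [Set.mem_ofPred_eq]
    have h2 := (abs_lt.1 hkb).2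
    have : 2 * π * kb ≤ 2 * π * mp := by have := pi_pos; gcongr
    linarith
  exact absurd (hm.2 this) (not_le.2 (has.trans hsb))

/-- Pointwise comparison of the winding numbers of a curve and of its parallel curve. -/
lemma winding_par_le (ht : 0 < t) (hx : ∀ s, γ.c s ≠ x) (hxt : ∀ s, γ.par t s ≠ x)
    (hfar : ∃ s, t < ‖γ.c s - x‖) :
    (∫ s in (0:ℝ)..1, γ.pard t s / (γ.par t s - x)).im ≤
      (∫ s in (0:ℝ)..1, γ.c1 s / (γ.c s - x)).im ∧
    ((∃ s₀ r : ℝ, 0 < r ∧ r < t ∧ γ.c s₀ + r * γ.nor s₀ = x ∧ ∀ s, r ≤ ‖γ.c s - x‖) →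
      (∫ s in (0:ℝ)..1, γ.pard t s / (γ.par t s - x)).im + 2 * π ≤
        (∫ s in (0:ℝ)..1, γ.c1 s / (γ.c s - x)).im) := by
  have hpi := pi_pos
  obtain ⟨σ, hσ⟩ := hfar
  have hx' : ∀ s, γ.c s - x ≠ 0 := fun s => sub_ne_zero.2 (hx s)
  have hxt' : ∀ s, γ.par t s - x ≠ 0 := fun s => sub_ne_zero.2 (hxt s)
  obtain ⟨Z, -, hZ, hZe⟩ := exists_log_lift (c := fun s => γ.c s - x) (c' := γ.c1)
    (fun s => (γ.hasDerivAt_c s).sub_const x) γ.continuous_c1 hx' 0 (Complex.exp_log (hx' 0))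
  obtain ⟨W, -, hW, hWe⟩ := exists_log_lift (c := fun s => γ.par t s - x) (c' := γ.pard t)
    (fun s => (γ.hasDerivAt_par t s).sub_const x) (γ.continuous_pard t) hxt' 0
    (Complex.exp_log (hxt' 0))
  have hZc : Continuous Z := continuous_iff_continuousAt.2 fun s => (hZ s).continuousAt
  have hWc : Continuous W := continuous_iff_continuousAt.2 fun s => (hW s).continuousAt
  have qZ : Continuous fun s => γ.c1 s / (γ.c s - x) :=
    γ.continuous_c1.div (γ.continuous_c.sub continuous_const) hx'
  have qW : Continuous fun s => γ.pard t s / (γ.par t s - x) :=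
    (γ.continuous_pard t).div ((γ.continuous_par t).sub continuous_const) hxt'
  have pZ : Function.Periodic (fun s => γ.c1 s / (γ.c s - x)) 1 := by
    intro s; simp only [γ.periodic s, γ.periodic_c1 s]
  have pW : Function.Periodic (fun s => γ.pard t s / (γ.par t s - x)) 1 := by
    intro s; simp only [γ.periodic_par t s, γ.periodic_pard t s]
  have iZ : ∫ s in (0:ℝ)..1, γ.c1 s / (γ.c s - x) = Z (σ + 1) - Z σ := by
    have := pZ.intervalIntegral_add_eq 0 σ
    rw [zero_add] at this
    rw [this]
    exact intervalIntegral.integral_eq_sub_of_hasDerivAt (fun s _ => hZ s)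
      (qZ.intervalIntegrable _ _)
  have iW : ∫ s in (0:ℝ)..1, γ.pard t s / (γ.par t s - x) = W (σ + 1) - W σ := by
    have := pW.intervalIntegral_add_eq 0 σ
    rw [zero_add] at this
    rw [this]
    exact intervalIntegral.integral_eq_sub_of_hasDerivAt (fun s _ => hW s)
      (qW.intervalIntegrable _ _)
  set V : ℝ → ℂ := fun s => W s - Z s with hV
  have hVc : Continuous V := hWc.sub hZc
  have hVe : ∀ s, Complex.exp (V s) * (γ.c s - x) = γ.par t s - x := by
    intro s
    rw [← hZe, ← hWe, hV, ← Complex.exp_add]; ring_nf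
  have hσ1 : t < ‖γ.c (σ + 1) - x‖ := by rw [γ.periodic]; exact hσ
  obtain ⟨m, hm⟩ := γ.exists_int_V ht hZe hVe hσ.le
  obtain ⟨m', hm'⟩ := γ.exists_int_V ht hZe hVe hσ1.le
  have hj : ∃ j : ℤ, (V (σ + 1)).im = (V σ).im + 2 * π * j := by
    have e : Complex.exp (V (σ + 1)) = Complex.exp (V σ) := by
      rw [γ.exp_V hZe hVe, γ.exp_V hZe hVe, γ.periodic, γ.periodic_nor]
    obtain ⟨j, hj⟩ := Complex.exp_eq_exp_iff_exists_int.1 e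
    refine ⟨j, ?_⟩
    have := congrArg Complex.im hj
    simp at this
    rw [this]; ring
  obtain ⟨j, hj⟩ := hj
  have hjm : j = m' - m := by
    have h1 := abs_lt.1 hm; have h2 := abs_lt.1 hm'
    apply int_eq_of_bounds <;> push_cast <;> linarith
  have hD : (∫ s in (0:ℝ)..1, γ.pard t s / (γ.par t s - x)).im =
      (∫ s in (0:ℝ)..1, γ.c1 s / (γ.c s - x)).im + 2 * π * j := by
    rw [iZ, iW]
    simp only [hV, Complex.sub_im] at hj ⊢
    linarith
  have anti := fun (p q : ℝ) (h1 : σ ≤ p) (h2 : p ≤ q) (h3 : q ≤ σ + 1) =>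
    γ.angle_antitone ht hZ hZe hVc hVe hσ h1 h2 h3
  refine ⟨?_, ?_⟩
  · have h1 := anti σ (σ + 1) le_rfl (by linarith) le_rfl hσ.le hσ1.le hm hm'
    have : (j : ℝ) ≤ 0 := by exact_mod_cast (by omega : j ≤ 0)
    rw [hD]
    nlinarith
  · rintro ⟨s₁, r, hr, hrt, hrx, hmin⟩
    -- move the foot point into the period starting at `σ`
    obtain ⟨s₀, hs₀, hs₀x⟩ : ∃ s₀ ∈ Set.Ico σ (σ + 1), γ.c s₀ + r * γ.nor s₀ = x := by
      obtain ⟨y, hy, hy2⟩ := (γ.periodic_par r).exists_mem_Ico one_pos s₁ σ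
      exact ⟨y, hy, by rw [← hrx]; exact hy2.symm⟩
    have hρ0 : ‖γ.c s₀ - x‖ = r := by
      rw [← hs₀x, sub_add_cancel_left, norm_neg, norm_mul, γ.norm_nor, Complex.norm_real,
        Real.norm_of_nonneg hr.le, mul_one]
    have hρ : Continuous fun s => ‖γ.c s - x‖ := (γ.continuous_c.sub continuous_const).norm
    obtain ⟨a, b, hpa, has, hsb, hbq, hfa, hfb, hle⟩ :=
      exists_gap hρ hs₀.1 hs₀.2.le hσ.le hσ1.le (hρ0.trans_lt hrt)
    have hb1 : b - a < 1 := by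
      by_contra hcon
      push Not at hcon
      have : a = σ := by linarith
      rw [← this] at hσ; linarith
    obtain ⟨ka, hka⟩ := γ.exists_int_V ht hZe hVe hfa.ge
    obtain ⟨kb, hkb⟩ := γ.exists_int_V ht hZe hVe hfb.ge
    have h1 := (γ.angle_gap ht hZ hZe hVc hVe (has.trans hsb) hb1 hfa hfb hle hka hkb).2
      s₀ ⟨has, hsb⟩ r hr hs₀x hmin
    have h2 := anti σ a le_rfl hpa (by linarith) hσ.le hfa.ge hm hka
    have h3 := anti b (σ + 1) (by linarith) hbq le_rfl hfb.ge hσ1.le hkb hm'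
    have : (j : ℝ) ≤ -1 := by exact_mod_cast (by omega : j ≤ -1)
    rw [hD]
    nlinarith

/-- A differentiable closed curve has zero area. -/
lemma volume_range_eq_zero {c c' : ℝ → ℂ} (hc : ∀ s, HasDerivAt c (c' s) s) :
    volume (Set.range c) = 0 := by
  set f : ℂ → ℂ := fun z => c z.re with hf
  have : Set.range c ⊆ f '' Set.univ := by
    rintro _ ⟨s, rfl⟩; exact ⟨s, trivial, by simp [hf]⟩
  refine measure_mono_null this ?_
  refine addHaar_image_eq_zero_of_det_fderivWithin_eq_zero volume
    (f' := fun z => ((ContinuousLinearMap.toSpanSingleton ℝ (c' z.re)).comp Complex.reCLM))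
    (fun z _ => ?_) fun z _ => ?_
  · exact ((hc z.re).hasFDerivAt.comp z Complex.reCLM.hasFDerivAt).hasFDerivWithinAt
  · rw [ContinuousLinearMap.det]
    rw [LinearMap.det_eq_zero_iff_ker_ne_bot, Submodule.ne_bot_iff]
    exact ⟨Complex.I, by simp, Complex.I_ne_zero⟩

/-- The area of a one-sided collar of a simple closed curve. -/
lemma volume_collar_le (ht : 0 < t) (hturn : γ.ang 1 = γ.ang 0 + 2 * π)
    (hfar : ∀ x, ∃ s, t < ‖γ.c s - x‖) {E : Set ℂ} (hE : MeasurableSet E)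
    (hEb : Bornology.IsBounded E)
    (hEx : ∀ x ∈ E, ∃ s₀ r : ℝ, 0 < r ∧ r < t ∧ γ.c s₀ + r * γ.nor s₀ = x ∧
      ∀ s, r ≤ ‖γ.c s - x‖) :
    (volume E).toReal ≤ γ.len * t - π * t ^ 2 := by
  have hpi := pi_pos
  obtain ⟨R₁, hR₁⟩ := isCompact_Icc.exists_bound_of_continuousOn (s := Set.Icc (0:ℝ) 1)
    γ.continuous_c.continuousOn
  obtain ⟨R₂, hR₂⟩ := isCompact_Icc.exists_bound_of_continuousOn (s := Set.Icc (0:ℝ) 1)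
    (γ.continuous_par t).continuousOn
  obtain ⟨R₃, hR₃⟩ := hEb.subset_ball (0:ℂ)
  set R := max (max R₁ R₂ + 1) R₃ with hR
  have hER : E ⊆ ball 0 R := hR₃.trans (ball_subset_ball (le_max_right _ _))
  have b1 : ∀ s ∈ Set.Icc (0:ℝ) 1, ‖γ.c s‖ < R := fun s hs => (hR₁ s hs).trans_lt
    (lt_of_lt_of_le (by linarith [le_max_left R₁ R₂]) (le_max_left _ _))
  have b2 : ∀ s ∈ Set.Icc (0:ℝ) 1, ‖γ.par t s‖ < R := fun s hs => (hR₂ s hs).trans_lt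
    (lt_of_lt_of_le (by linarith [le_max_right R₁ R₂]) (le_max_left _ _))
  obtain ⟨i1, e1⟩ := integral_winding γ.continuous_c γ.continuous_c1 b1
  obtain ⟨i2, e2⟩ := integral_winding (γ.continuous_par t) (γ.continuous_pard t) b2
  have him : ∀ f : ℂ → ℂ, IntegrableOn f (ball (0:ℂ) R) →
      (∫ x in ball (0:ℂ) R, f x).im = ∫ x in ball (0:ℂ) R, (f x).im := fun f hf =>
    (Complex.imCLM.integral_comp_comm hf).symm
  have f1 := congrArg Complex.im e1
  have f2 := congrArg Complex.im e2
  rw [him _ i1, Complex.im_ofReal_mul] at f1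
  rw [him _ i2, Complex.im_ofReal_mul, γ.signedArea_par t hturn] at f2
  have j1 : IntegrableOn (fun x => (∫ s in (0:ℝ)..1, γ.c1 s / (γ.c s - x)).im) (ball (0:ℂ) R) :=
    Complex.imCLM.integrable_comp i1
  have j2 : IntegrableOn (fun x => (∫ s in (0:ℝ)..1, γ.pard t s / (γ.par t s - x)).im)
      (ball (0:ℂ) R) := Complex.imCLM.integrable_comp i2
  have j3 : IntegrableOn (E.indicator fun _ => 2 * π) (ball (0:ℂ) R) :=
    (integrableOn_const (by exact measure_ball_lt_top.ne)).indicator hE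
  have hmono : ∫ x in ball (0:ℂ) R, ((∫ s in (0:ℝ)..1, γ.pard t s / (γ.par t s - x)).im +
      E.indicator (fun _ => 2 * π) x) ≤
      ∫ x in ball (0:ℂ) R, (∫ s in (0:ℝ)..1, γ.c1 s / (γ.c s - x)).im := by
    refine integral_mono_ae (j2.add j3) j1 (ae_restrict_of_ae ?_)
    have n1 := volume_range_eq_zero γ.hasDerivAt_c
    have n2 := volume_range_eq_zero (γ.hasDerivAt_par t)
    filter_upwards [compl_mem_ae_iff.2 n1, compl_mem_ae_iff.2 n2] with x h1 h2
    have h := γ.winding_par_le ht (x := x) (fun s hs => h1 ⟨s, hs⟩) (fun s hs => h2 ⟨s, hs⟩)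
      (hfar x)
    by_cases hx : x ∈ E
    · rw [Set.indicator_of_mem hx]; exact h.2 (hEx x hx)
    · rw [Set.indicator_of_notMem hx, add_zero]; exact h.1
  rw [integral_add j2 j3, f1, f2, integral_indicator hE, Measure.restrict_restrict hE,
    Set.inter_eq_self_of_subset_left hER, setIntegral_const, smul_eq_mul] at hmono
  have : 2 * π * (volume E).toReal ≤ 2 * π * (γ.len * t - π * t ^ 2) := by
    simp only [Measure.real] at hmono
    nlinarith
  exact le_of_mul_le_mul_left this (by positivity)

end PlaneLoop

section Plane
open Topology

namespace PlaneLoop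
variable (γ : PlaneLoop)

/-- Normal coordinates along the curve: `s + r i ↦ γ(s) + r n(s)`. -/
def tube (z : ℂ) : ℂ := γ.c z.re + z.im * γ.nor z.re

/-- The derivative of the normal coordinates. -/
def tubed (z : ℂ) : ℂ →L[ℝ] ℂ :=
  Complex.reCLM.smulRight (γ.pard z.im z.re) + Complex.imCLM.smulRight (γ.nor z.re)

lemma hasFDerivAt_tube (z : ℂ) : HasFDerivAt γ.tube (γ.tubed z) z := by
  have h1 := (γ.hasDerivAt_c z.re).hasFDerivAt.comp z Complex.reCLM.hasFDerivAt
  have h2 := (γ.hasDerivAt_nor z.re).hasFDerivAt.comp z Complex.reCLM.hasFDerivAt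
  have h3 := Complex.imCLM.hasFDerivAt (x := z)
  have h4 := h1.add (h3.smul h2)
  refine HasFDerivAt.congr_fderiv (f := γ.tube) (h4.congr_of_eventuallyEq
    (Eventually.of_forall fun w => by simp [tube])) ?_
  ext v
  · simp [tubed, pard]
    nth_rewrite 1 [γ.c1_eq]
    ring

lemma continuous_tube : Continuous γ.tube :=
  continuous_iff_continuousAt.2 fun z => (γ.hasFDerivAt_tube z).continuousAt

lemma continuous_tubed : Continuous γ.tubed := by
  have h1 := γ.continuous_nor
  have h2 : Continuous fun z : ℂ => γ.pard z.im z.re := by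
    have h1 := γ.continuous_angd; have h2 := γ.continuous_c1; have h3 := γ.continuous_tan
    unfold pard; fun_prop
  exact (ContinuousLinearMap.continuous (ContinuousLinearMap.smulRightL ℝ ℂ ℂ Complex.reCLM)
    |>.comp h2).add (ContinuousLinearMap.continuous
      (ContinuousLinearMap.smulRightL ℝ ℂ ℂ Complex.imCLM) |>.comp
        (h1.comp Complex.continuous_re))

lemma det_tubed (z : ℂ) : (γ.tubed z).det = ‖γ.c1 z.re‖ - z.im * γ.angd z.re := by
  have h3 : (γ.tan z.re).re ^ 2 + (γ.tan z.re).im ^ 2 = 1 := by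
    have := Complex.normSq_eq_norm_sq (γ.tan z.re)
    rw [γ.norm_tan, Complex.normSq_apply] at this
    linarith
  rw [ContinuousLinearMap.det, ← LinearMap.det_toMatrix Complex.basisOneI, Matrix.det_fin_two]
  simp [LinearMap.toMatrix_apply, tubed, pard, nor]
  linear_combination (‖γ.c1 z.re‖ - z.im * γ.angd z.re) * h3

/-- The coordinate box around `s`. -/
def box (s δ : ℝ) : Set ℂ := Set.Ioo (s - δ) (s + δ) ×ℂ Set.Ioo (-δ) δ

lemma mem_box {s δ : ℝ} {z : ℂ} : z ∈ box s δ ↔ |z.re - s| < δ ∧ |z.im| < δ := by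
  rw [box, Complex.mem_reProdIm, Set.mem_Ioo, Set.mem_Ioo, abs_lt, abs_lt]
  constructor <;> rintro ⟨⟨h1, h2⟩, h3⟩ <;> exact ⟨⟨by linarith, by linarith⟩, h3⟩

lemma isOpen_box (s δ : ℝ) : IsOpen (box s δ) := isOpen_Ioo.reProdIm isOpen_Ioo

lemma exists_box_subset {s : ℝ} {V : Set ℂ} (hV : V ∈ 𝓝 (s : ℂ)) : ∃ δ > 0, box s δ ⊆ V := by
  obtain ⟨ε, hε, h⟩ := Metric.mem_nhds_iff.1 hV
  refine ⟨ε / 2, by positivity, fun z hz => h ?_⟩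
  rw [mem_box] at hz
  rw [mem_ball, dist_eq_norm]
  have := Complex.norm_le_abs_re_add_abs_im (z - s)
  simp at this
  linarith

lemma tube_ofReal (s : ℝ) : γ.tube s = γ.c s := by simp [tube]

lemma exists_int_c_eq (s t : ℝ) : ∃ n : ℤ, t ≤ s + n ∧ s + n < t + 1 ∧ γ.c (s + n) = γ.c s := by
  refine ⟨⌈t - s⌉, by linarith [Int.le_ceil (t - s)], by linarith [Int.ceil_lt_add_one (t - s)], ?_⟩
  have := γ.periodic.int_mul ⌈t - s⌉ s
  rwa [mul_one] at this

/-- Existence of tubular coordinates near a point of the curve, avoiding a given closed set. -/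
lemma exists_tube {K : Set ℂ} (hK : IsClosed K) (hKd : Disjoint K (Set.range γ.c)) (s : ℝ) :
    ∃ δ > 0, Set.InjOn γ.tube (box s δ) ∧ IsOpen (γ.tube '' box s δ) ∧
      (∀ z ∈ box s δ, γ.tube z ∉ K) ∧
      (∀ z ∈ box s δ, γ.tube z ∈ Set.range γ.c → z.im = 0) ∧
      ∀ z ∈ box s δ, ‖γ.c1 s‖ / 2 ≤ (γ.tubed z).det := by
  have hpos := norm_pos_iff.2 (γ.c1_ne_zero s)
  have hdet : (γ.tubed s).det ≠ 0 := by rw [det_tubed]; simp [γ.c1_ne_zero s]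
  have hstrict : HasStrictFDerivAt γ.tube
      ((γ.tubed s).toContinuousLinearEquivOfDetNeZero hdet : ℂ →L[ℝ] ℂ) (s : ℂ) := by
    rw [ContinuousLinearMap.coe_toContinuousLinearEquivOfDetNeZero]
    exact hasStrictFDerivAt_of_hasFDerivAt_of_continuousAt
      (Eventually.of_forall γ.hasFDerivAt_tube) γ.continuous_tubed.continuousAt
  set Φ := hstrict.toOpenPartialHomeomorph γ.tube with hΦ
  have hs : Φ.source ∈ 𝓝 (s : ℂ) := hstrict.mem_toOpenPartialHomeomorph_source |>
    Φ.open_source.mem_nhds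
  obtain ⟨δ₁, hδ₁, hb₁⟩ := exists_box_subset hs
  set δ₂ := min δ₁ (1 / 2) with hδ₂
  have hδ₂p : 0 < δ₂ := lt_min hδ₁ (by norm_num)
  set C := γ.c '' Set.Icc (s + δ₂) (s + 1 - δ₂) with hC
  have hCc : IsClosed C := (isCompact_Icc.image γ.continuous_c).isClosed
  have hsC : γ.c s ∉ C := by
    rintro ⟨t, ht, hts⟩
    have := γ.eq_of_c_eq (s := t) (t := s) (by
      rw [abs_of_nonneg] <;> linarith [ht.1, ht.2]) hts
    linarith [ht.1]
  have hV : {z | γ.tube z ∈ Cᶜ ∩ Kᶜ ∧ ‖γ.c1 s‖ / 2 < (γ.tubed z).det} ∈ 𝓝 (s : ℂ) := by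
    have hdc : Continuous fun z => (γ.tubed z).det := by
      simp only [det_tubed]
      have h1 := γ.continuous_angd; have h2 := γ.continuous_c1
      fun_prop
    have ho : IsOpen {z | ‖γ.c1 s‖ / 2 < (γ.tubed z).det} := isOpen_lt continuous_const hdc
    refine IsOpen.mem_nhds (((hCc.isOpen_compl.inter hK.isOpen_compl).preimage
      γ.continuous_tube).inter ho) ?_
    · refine ⟨?_, ?_⟩
      · rw [tube_ofReal]
        exact ⟨hsC, fun h => Set.disjoint_left.1 hKd h ⟨s, rfl⟩⟩
      · rw [det_tubed, Complex.ofReal_re, Complex.ofReal_im, zero_mul, sub_zero]; linarith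
  obtain ⟨δ₃, hδ₃, hb₃⟩ := exists_box_subset hV
  have hsub1 : box s (min δ₂ δ₃) ⊆ Φ.source := fun z hz => hb₁ (by
    simp only [mem_box, lt_min_iff, hδ₂] at hz
    exact mem_box.2 ⟨hz.1.1.1, hz.2.1.1⟩)
  have hsub3 : box s (min δ₂ δ₃) ⊆ {z | γ.tube z ∈ Cᶜ ∩ Kᶜ ∧ ‖γ.c1 s‖ / 2 < (γ.tubed z).det} :=
    fun z hz => hb₃ (by
    simp only [mem_box, lt_min_iff] at hz
    exact mem_box.2 ⟨hz.1.2, hz.2.2⟩)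
  have hinj : Set.InjOn γ.tube Φ.source := Φ.injOn
  refine ⟨min δ₂ δ₃, lt_min hδ₂p hδ₃, hinj.mono hsub1,
    Φ.isOpen_image_of_subset_source (isOpen_box _ _) hsub1,
    fun z hz => (hsub3 hz).1.2, fun z hz h => ?_, fun z hz => (hsub3 hz).2.le⟩
  obtain ⟨t, ht⟩ := h
  obtain ⟨n, hn1, hn2, hn3⟩ := γ.exists_int_c_eq t (s - δ₂)
  have hlt : t + n < s + δ₂ := by
    by_contra hcon
    push Not at hcon
    exact (hsub3 hz).1.1 ⟨t + n, ⟨hcon, by linarith⟩, by rw [hn3, ht]⟩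
  rcases eq_or_lt_of_le hn1 with h | h
  · exfalso
    refine (hsub3 hz).1.1 ⟨t + n + 1, ⟨by linarith [min_le_right δ₁ (1/2)], by linarith⟩, ?_⟩
    rw [γ.periodic, hn3, ht]
  · have hmem : (((t + n : ℝ)) : ℂ) ∈ Φ.source := hb₁ (mem_box.2 ⟨by
      simp only [Complex.ofReal_re]
      rw [abs_lt]; constructor <;> linarith [min_le_left δ₁ (1/2)], by simpa using hδ₁⟩)
    have := hinj (hsub1 hz) hmem (by rw [tube_ofReal, hn3, ht])
    rw [this]; simp

end PlaneLoop

lemma IsPreconnected.subset_or_subset_of_disjoint_frontier {X : Type*} [TopologicalSpace X]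
    {Ω S : Set X} (hO : IsOpen Ω) (hS : IsPreconnected S) (hd : Disjoint S (frontier Ω)) :
    S ⊆ Ω ∨ S ⊆ (closure Ω)ᶜ := by
  rcases (S ∩ Ω).eq_empty_or_nonempty with h | h
  · right
    intro x hx hcl
    refine Set.disjoint_left.1 hd hx ⟨hcl, fun hi => ?_⟩
    rw [hO.interior_eq] at hi
    exact (Set.eq_empty_iff_forall_notMem.1 h) x ⟨hx, hi⟩
  · left
    refine hS.subset_left_of_subset_union hO isClosed_closure.isOpen_compl
      (Set.disjoint_left.2 fun x hx hc => hc (subset_closure hx)) (fun x hx => ?_) h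
    by_contra hcon
    rw [Set.mem_union, not_or, Set.notMem_compl_iff] at hcon
    refine Set.disjoint_left.1 hd hx ?_
    rw [hO.frontier_eq]
    exact ⟨hcon.2, hcon.1⟩

/-- The union of the unbounded components of the complement of the closure. -/
def outerPart {X : Type*} [MetricSpace X] (Ω : Set X) : Set X :=
  {x | x ∈ (closure Ω)ᶜ ∧ ¬ Bornology.IsBounded (connectedComponentIn (closure Ω)ᶜ x)}

section
variable {X : Type*} [MetricSpace X] {Ω S : Set X}

lemma subset_outerPart (hS : IsPreconnected S) (hSc : S ⊆ (closure Ω)ᶜ)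
    (h : (S ∩ outerPart Ω).Nonempty) : S ⊆ outerPart Ω := by
  obtain ⟨x, hx, hxU⟩ := h
  intro y hy
  refine ⟨hSc hy, ?_⟩
  have := hS.subset_connectedComponentIn hx hSc hy
  rw [← connectedComponentIn_eq this]
  exact hxU.2

lemma subset_outerPart_of_unbounded (hS : IsPreconnected S) (hSc : S ⊆ (closure Ω)ᶜ)
    (h : ¬ Bornology.IsBounded S) : S ⊆ outerPart Ω := fun _ hx =>
  ⟨hSc hx, fun hb => h (hb.subset (hS.subset_connectedComponentIn hx hSc))⟩

lemma isOpen_outerPart [LocallyConnectedSpace X] : IsOpen (outerPart Ω) := by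
  rw [isOpen_iff_mem_nhds]
  intro x hx
  have ho := (isClosed_closure (s := Ω)).isOpen_compl.connectedComponentIn (x := x)
  refine mem_of_superset (ho.mem_nhds (mem_connectedComponentIn hx.1)) ?_
  exact subset_outerPart isPreconnected_connectedComponentIn (connectedComponentIn_subset _ _)
    ⟨_, mem_connectedComponentIn hx.1, hx⟩

lemma frontier_outerPart_subset [LocallyConnectedSpace X] (hO : IsOpen Ω) :
    frontier (outerPart Ω) ⊆ frontier Ω := by
  intro x hx
  rw [hO.frontier_eq]
  refine ⟨?_, fun hxΩ => ?_⟩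
  · by_contra hcl
    have ho := (isClosed_closure (s := Ω)).isOpen_compl.connectedComponentIn (x := x)
    have hmem := mem_connectedComponentIn (F := (closure Ω)ᶜ) hcl
    obtain ⟨y, hy, hyU⟩ := mem_closure_iff.1 hx.1 _ ho hmem
    have := subset_outerPart isPreconnected_connectedComponentIn
      (connectedComponentIn_subset _ _) ⟨y, hy, hyU⟩ hmem
    rw [isOpen_outerPart.frontier_eq] at hx
    exact hx.2 this
  · obtain ⟨y, hy, hyU⟩ := mem_closure_iff.1 hx.1 _ hO hxΩ
    exact hyU.1 (subset_closure hy)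

end

namespace PlaneLoop
variable (γ : PlaneLoop)

/-- The curve is a component of the boundary of the set `Ω`. -/
def IsBdry (Ω : Set ℂ) : Prop :=
  ∃ K, IsClosed K ∧ Disjoint K (Set.range γ.c) ∧ frontier Ω = K ∪ Set.range γ.c

/-- The normal at `s` points into `Ω`, and the opposite normal into the exterior. -/
def Sided (Ω : Set ℂ) (s : ℝ) : Prop :=
  ∃ δ > 0, ∀ r ∈ Set.Ioo (0:ℝ) δ, γ.c s + r * γ.nor s ∈ Ω ∧ γ.c s - r * γ.nor s ∈ outerPart Ω

/-- The half of the coordinate box on the side `σ`. -/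
def halfBox (s δ σ : ℝ) : Set ℂ := {z ∈ box s δ | 0 < σ * z.im}

lemma isPreconnected_halfBox (s δ σ : ℝ) : IsPreconnected (halfBox s δ σ) := by
  have h1 : Convex ℝ (box s δ) :=
    ((convex_Ioo (s - δ) (s + δ)).is_linear_preimage (f := Complex.re)
      ⟨Complex.add_re, fun c x => by simp⟩).inter
    ((convex_Ioo (-δ) δ).is_linear_preimage (f := Complex.im)
      ⟨Complex.add_im, fun c x => by simp⟩)
  have h2 : Convex ℝ {z : ℂ | 0 < σ * z.im} :=
    (convex_Ioi (0:ℝ)).is_linear_preimage (f := fun z : ℂ => σ * z.im)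
      ⟨fun x y => by simp [mul_add], fun c x => by simp; ring⟩
  exact (h1.inter h2).isPreconnected

variable {γ} {Ω : Set ℂ}

lemma IsBdry.range_subset (h : γ.IsBdry Ω) : Set.range γ.c ⊆ frontier Ω := by
  obtain ⟨K, -, -, h⟩ := h
  rw [h]; exact Set.subset_union_right

/-- Tubular coordinates at a boundary curve. -/
lemma IsBdry.exists_tube (h : γ.IsBdry Ω) (hO : IsOpen Ω) (s : ℝ) :
    ∃ δ > 0, Set.InjOn γ.tube (box s δ) ∧ IsOpen (γ.tube '' box s δ) ∧
      (∀ z ∈ box s δ, γ.tube z ∈ frontier Ω → z.im = 0) ∧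
      (∀ z ∈ box s δ, ‖γ.c1 s‖ / 2 ≤ (γ.tubed z).det) ∧
      (∀ σ, γ.tube '' halfBox s δ σ ⊆ Ω ∨ γ.tube '' halfBox s δ σ ⊆ (closure Ω)ᶜ) := by
  obtain ⟨K, hK, hd, hf⟩ := h
  obtain ⟨δ, hδ, h1, h2, h3, h4, h5⟩ := γ.exists_tube hK hd s
  have key : ∀ z ∈ box s δ, γ.tube z ∈ frontier Ω → z.im = 0 := by
    intro z hz hzf
    rw [hf] at hzf
    exact hzf.elim (fun h => absurd h (h3 z hz)) (h4 z hz)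
  refine ⟨δ, hδ, h1, h2, key, h5, fun σ => ?_⟩
  refine ((isPreconnected_halfBox s δ σ).image _
    γ.continuous_tube.continuousOn).subset_or_subset_of_disjoint_frontier hO ?_
  rw [Set.disjoint_left]
  rintro _ ⟨z, hz, rfl⟩ hzf
  have := key z hz.1 hzf
  have h := hz.2
  rw [this] at h
  simp at h

lemma tube_mk (s r : ℝ) : γ.tube ⟨s, r⟩ = γ.c s + r * γ.nor s := rfl

lemma IsBdry.eventually_sided_iff (h : γ.IsBdry Ω) (hO : IsOpen Ω) (s : ℝ) :
    ∃ Q : Prop, ∀ᶠ t in 𝓝 s, (γ.Sided Ω t ↔ Q) := by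
  obtain ⟨δ, hδ, -, -, h3, -, h5⟩ := h.exists_tube hO s
  refine ⟨γ.tube '' halfBox s δ 1 ⊆ Ω ∧ γ.tube '' halfBox s δ (-1) ⊆ outerPart Ω, ?_⟩
  filter_upwards [Metric.ball_mem_nhds s hδ] with t ht
  rw [mem_ball, dist_eq_norm, Real.norm_eq_abs] at ht
  have mp : ∀ r ∈ Set.Ioo 0 δ, (⟨t, r⟩ : ℂ) ∈ halfBox s δ 1 := fun r hr =>
    ⟨mem_box.2 ⟨ht, by rw [abs_of_pos hr.1]; exact hr.2⟩, by simpa using hr.1⟩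
  have mm : ∀ r ∈ Set.Ioo 0 δ, (⟨t, -r⟩ : ℂ) ∈ halfBox s δ (-1) := fun r hr =>
    ⟨mem_box.2 ⟨ht, by simp only [abs_neg]; rw [abs_of_pos hr.1]; exact hr.2⟩, by simpa using hr.1⟩
  have em : ∀ r : ℝ, γ.tube ⟨t, -r⟩ = γ.c t - r * γ.nor t := fun r => by
    rw [tube_mk]; push_cast; ring
  constructor
  · rintro ⟨δ', hδ', hP⟩
    obtain ⟨r, hr0, hr⟩ := exists_between (lt_min hδ hδ')
    rw [lt_min_iff] at hr
    obtain ⟨p1, p2⟩ := hP r ⟨hr0, hr.2⟩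
    rw [← tube_mk] at p1
    rw [← em] at p2
    refine ⟨?_, ?_⟩
    · rcases h5 1 with h | h
      · exact h
      · exact absurd (subset_closure p1) (h ⟨_, mp r ⟨hr0, hr.1⟩, rfl⟩)
    · rcases h5 (-1) with h | h
      · exact absurd (subset_closure (h ⟨_, mm r ⟨hr0, hr.1⟩, rfl⟩)) p2.1
      · exact subset_outerPart ((isPreconnected_halfBox _ _ _).image _
          γ.continuous_tube.continuousOn) h ⟨_, ⟨_, mm r ⟨hr0, hr.1⟩, rfl⟩, p2⟩
  · rintro ⟨q1, q2⟩
    refine ⟨δ, hδ, fun r hr => ⟨?_, ?_⟩⟩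
    · rw [← tube_mk]; exact q1 ⟨_, mp r hr, rfl⟩
    · rw [← em]; exact q2 ⟨_, mm r hr, rfl⟩

lemma IsBdry.sided (h : γ.IsBdry Ω) (hO : IsOpen Ω) {s₀ : ℝ} (hs : γ.Sided Ω s₀) (s : ℝ) :
    γ.Sided Ω s := by
  have hl : IsLocallyConstant (γ.Sided Ω) := by
    rw [IsLocallyConstant.iff_eventually_eq]
    intro t
    obtain ⟨Q, hQ⟩ := h.eventually_sided_iff hO t
    have := hQ.self_of_nhds
    filter_upwards [hQ] with u hu
    exact propext (hu.trans this.symm)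
  rw [hl.apply_eq_of_preconnectedSpace s s₀]; exact hs

lemma Sided.mem_frontier {s : ℝ} (h : γ.Sided Ω s) (hf : γ.c s ∈ frontier Ω) :
    γ.c s ∈ frontier (outerPart Ω) := by
  obtain ⟨δ, hδ, hP⟩ := h
  rw [isOpen_outerPart.frontier_eq]
  refine ⟨?_, fun h => h.1 hf.1⟩
  have : Tendsto (fun r : ℝ => γ.c s - r * γ.nor s) (𝓝[>] 0) (𝓝 (γ.c s)) := by
    have hc : Continuous fun r : ℝ => γ.c s - r * γ.nor s := by fun_prop
    have := hc.tendsto 0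
    simp only [Complex.ofReal_zero, zero_mul, sub_zero] at this
    exact this.mono_left nhdsWithin_le_nhds
  refine mem_closure_of_tendsto this ?_
  filter_upwards [Ioo_mem_nhdsGT hδ] with r hr using (hP r hr).2

/-- A half-plane below the set lies in the exterior. -/
lemma _root_.setOf_im_lt_subset_outerPart {m : ℝ} (hm : ∀ z ∈ closure Ω, m ≤ z.im) :
    {z : ℂ | z.im < m} ⊆ outerPart Ω := by
  refine subset_outerPart_of_unbounded ?_ (fun z hz hc => (hm z hc).not_gt hz) ?_
  · exact ((convex_Iio m).is_linear_preimage (f := Complex.im)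
      ⟨Complex.add_im, fun c x => by simp⟩).isPreconnected
  · intro hb
    obtain ⟨R, hR⟩ := hb.exists_norm_le
    have := hR ⟨|R| + 1, m - 1⟩ (by simp)
    have h2 := Complex.abs_re_le_norm (⟨|R| + 1, m - 1⟩ : ℂ)
    simp only at h2
    have h3 := le_abs_self R
    rw [abs_of_nonneg (by positivity)] at h2
    linarith

lemma _root_.setOf_lt_im_subset_outerPart {m : ℝ} (hm : ∀ z ∈ closure Ω, z.im ≤ m) :
    {z : ℂ | m < z.im} ⊆ outerPart Ω := by
  refine subset_outerPart_of_unbounded ?_ (fun z hz hc => (hm z hc).not_gt hz) ?_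
  · exact ((convex_Ioi m).is_linear_preimage (f := Complex.im)
      ⟨Complex.add_im, fun c x => by simp⟩).isPreconnected
  · intro hb
    obtain ⟨R, hR⟩ := hb.exists_norm_le
    have := hR ⟨|R| + 1, m + 1⟩ (by simp)
    have h2 := Complex.abs_re_le_norm (⟨|R| + 1, m + 1⟩ : ℂ)
    simp only at h2
    have h3 := le_abs_self R
    rw [abs_of_nonneg (by positivity)] at h2
    linarith

/-- One of the two sides of a boundary curve is in the domain. -/
lemma IsBdry.exists_tube_side (h : γ.IsBdry Ω) (hO : IsOpen Ω) (s : ℝ) :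
    ∃ δ > 0, Set.InjOn γ.tube (box s δ) ∧ IsOpen (γ.tube '' box s δ) ∧
      (∀ z ∈ box s δ, γ.tube z ∈ frontier Ω → z.im = 0) ∧
      (∀ z ∈ box s δ, ‖γ.c1 s‖ / 2 ≤ (γ.tubed z).det) ∧
      (∀ σ, γ.tube '' halfBox s δ σ ⊆ Ω ∨ γ.tube '' halfBox s δ σ ⊆ (closure Ω)ᶜ) ∧
      (γ.tube '' halfBox s δ 1 ⊆ Ω ∨ γ.tube '' halfBox s δ (-1) ⊆ Ω) := by
  obtain ⟨δ, hδ, h1, h2, h3, h4, h5⟩ := h.exists_tube hO s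
  refine ⟨δ, hδ, h1, h2, h3, h4, h5, ?_⟩
  have hs : γ.c s ∈ closure Ω := (h.range_subset ⟨s, rfl⟩).1
  have hmem : γ.c s ∈ γ.tube '' box s δ :=
    ⟨s, mem_box.2 (by simpa using hδ), γ.tube_ofReal s⟩
  obtain ⟨_, ⟨z, hz, rfl⟩, hzΩ⟩ := mem_closure_iff.1 hs _ h2 hmem
  rcases lt_trichotomy z.im 0 with hi | hi | hi
  · right
    refine (h5 (-1)).resolve_right fun hc => ?_
    exact hc ⟨z, ⟨hz, by linarith⟩, rfl⟩ (subset_closure hzΩ)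
  · exfalso
    have : γ.tube z ∈ frontier Ω := h.range_subset ⟨z.re, by simp [tube, hi]⟩
    rw [hO.frontier_eq] at this
    exact this.2 hzΩ
  · left
    refine (h5 1).resolve_right fun hc => ?_
    exact hc ⟨z, ⟨hz, by linarith⟩, rfl⟩ (subset_closure hzΩ)

/-- At a lowest point of the domain with rightward tangent, the curve has the domain on its left
and the exterior on its right. -/
lemma IsBdry.sided_of_lowest (h : γ.IsBdry Ω) (hO : IsOpen Ω) {s : ℝ}
    (hm : ∀ z ∈ closure Ω, (γ.c s).im ≤ z.im) (ht : γ.tan s = 1) : γ.Sided Ω s := by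
  obtain ⟨δ, hδ, -, -, -, -, h5, h6⟩ := h.exists_tube_side hO s
  have hn : γ.nor s = Complex.I := by rw [nor, ht, mul_one]
  have hlow := setOf_im_lt_subset_outerPart hm
  have hU : ∀ r : ℝ, 0 < r → γ.c s - r * γ.nor s ∈ outerPart Ω := fun r hr =>
    hlow (by simp [hn, hr])
  refine ⟨δ, hδ, fun r hr => ⟨?_, hU r hr.1⟩⟩
  have h7 : ¬ γ.tube '' halfBox s δ (-1) ⊆ Ω := by
    intro hc
    have := hc ⟨⟨s, -r⟩, ⟨mem_box.2 ⟨by simpa using hδ, by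
      simp only [abs_neg]; rw [abs_of_pos hr.1]; exact hr.2⟩, by simpa using hr.1⟩, rfl⟩
    have e : γ.tube ⟨s, -r⟩ = γ.c s - r * γ.nor s := by rw [tube_mk]; push_cast; ring
    rw [e] at this
    exact (hU r hr.1).1 (subset_closure this)
  exact (h6.resolve_right h7) ⟨⟨s, r⟩, ⟨mem_box.2 ⟨by simpa using hδ, by
      rw [abs_of_pos hr.1]; exact hr.2⟩, by simpa using hr.1⟩, rfl⟩

end PlaneLoop

namespace PlaneLoop
variable (γ : PlaneLoop)

/-- The winding number of the curve around a point. -/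
def wind (x : ℂ) : ℝ := (∫ s in (0:ℝ)..1, γ.c1 s / (γ.c s - x)).im / (2 * π)

variable {γ}

lemma exists_lift_sub {x : ℂ} (hx : x ∉ Set.range γ.c) (a : ℝ) {l : ℂ}
    (hl : Complex.exp l = γ.c a - x) :
    ∃ L : ℝ → ℂ, L a = l ∧ (∀ s, HasDerivAt L (γ.c1 s / (γ.c s - x)) s) ∧
      (∀ s, Complex.exp (L s) = γ.c s - x) ∧ (L (a + 1)).im = (L a).im + 2 * π * γ.wind x := by
  have h0 : ∀ s, γ.c s - x ≠ 0 := fun s h => hx ⟨s, sub_eq_zero.1 h⟩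
  obtain ⟨L, h1, h2, h3⟩ := exists_log_lift (c := fun s => γ.c s - x)
    (fun s => (γ.hasDerivAt_c s).sub_const x) γ.continuous_c1 h0 a hl
  refine ⟨L, h1, h2, h3, ?_⟩
  have hcont : Continuous fun s => γ.c1 s / (γ.c s - x) :=
    γ.continuous_c1.div (γ.continuous_c.sub continuous_const) h0
  have i1 := intervalIntegral.integral_eq_sub_of_hasDerivAt (a := a) (b := a + 1)
    (fun s _ => h2 s) (hcont.intervalIntegrable _ _)
  have hper : Function.Periodic (fun s => γ.c1 s / (γ.c s - x)) 1 := fun s => by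
    simp only [γ.periodic s, γ.periodic_c1 s]
  have i2 := hper.intervalIntegral_add_eq a 0
  rw [zero_add, i1] at i2
  have := congrArg Complex.im i2
  rw [Complex.sub_im] at this
  rw [wind, ← this]; field_simp; ring

lemma exists_int_wind {x : ℂ} (hx : x ∉ Set.range γ.c) : ∃ n : ℤ, γ.wind x = n := by
  have h0 : γ.c 0 - x ≠ 0 := fun h => hx ⟨0, sub_eq_zero.1 h⟩
  obtain ⟨L, -, -, h3, h4⟩ := exists_lift_sub hx 0 (Complex.exp_log h0)
  have h5 : Complex.exp (L (0 + 1)) = Complex.exp (L 0) := by rw [h3, h3, γ.periodic]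
  obtain ⟨n, hn⟩ := Complex.exp_eq_exp_iff_exists_int.1 h5
  refine ⟨n, ?_⟩
  have := congrArg Complex.im hn
  rw [h4] at this
  simp at this
  have hpi := pi_pos
  have : 2 * π * (γ.wind x - n) = 0 := by linarith
  have := (mul_eq_zero.1 this).resolve_left (by positivity)
  linarith

lemma continuousOn_wind : ContinuousOn γ.wind (Set.range γ.c)ᶜ := by
  rw [continuousOn_iff_continuous_domRestrict]
  have h : Continuous fun x : ((Set.range γ.c)ᶜ : Set ℂ) =>
      ∫ s in (0:ℝ)..1, γ.c1 s / (γ.c s - x) := by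
    apply intervalIntegral.continuous_parametric_intervalIntegral_of_continuous'
    refine (γ.continuous_c1.comp continuous_snd).div
      ((γ.continuous_c.comp continuous_snd).sub (continuous_subtype_val.comp continuous_fst)) ?_
    rintro ⟨x, s⟩ h
    exact x.2 ⟨s, sub_eq_zero.1 h⟩
  exact (Complex.continuous_im.comp h).div_const _

lemma wind_eq_of_isPreconnected {S : Set ℂ} (hS : IsPreconnected S)
    (hd : Disjoint S (Set.range γ.c)) {x y : ℂ} (hx : x ∈ S) (hy : y ∈ S) :
    γ.wind x = γ.wind y := by
  have key : ∀ x ∈ S, ∀ y ∈ S, ¬ γ.wind x < γ.wind y := by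
    intro x hx y hy hlt
    have hsub : S ⊆ (Set.range γ.c)ᶜ := fun z hz => Set.disjoint_left.1 hd hz
    obtain ⟨m, hm⟩ := exists_int_wind (hsub hx)
    obtain ⟨n, hn⟩ := exists_int_wind (hsub hy)
    have hmn : (m : ℝ) + 1 ≤ n := by
      rw [hm, hn] at hlt
      exact_mod_cast hlt
    obtain ⟨z, hz, hzw⟩ := hS.intermediate_value hx hy (continuousOn_wind.mono hsub)
      (show (m : ℝ) + 1 / 2 ∈ Set.Icc (γ.wind x) (γ.wind y) by
        rw [hm, hn]; constructor <;> linarith)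
    obtain ⟨k, hk⟩ := exists_int_wind (hsub hz)
    rw [hk] at hzw
    have h1 : (k : ℝ) < m + 1 := by linarith
    have h2 : (m : ℝ) < k := by linarith
    have h1' : k < m + 1 := by exact_mod_cast h1
    have h2' : m < k := by exact_mod_cast h2
    omega
  exact le_antisymm (not_lt.1 (key y hy x hx)) (not_lt.1 (key x hx y hy))

lemma exists_bound_c : ∃ R, ∀ s, ‖γ.c s‖ ≤ R := by
  obtain ⟨R, hR⟩ := isCompact_Icc.exists_bound_of_continuousOn (s := Set.Icc (0:ℝ) 1)
    γ.continuous_c.continuousOn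
  refine ⟨R, fun s => ?_⟩
  obtain ⟨n, h1, h2, h3⟩ := γ.exists_int_c_eq s 0
  rw [← h3]
  exact hR _ ⟨h1, by linarith⟩

lemma range_c_eq : Set.range γ.c = γ.c '' Set.Icc 0 1 := by
  ext x
  constructor
  · rintro ⟨s, rfl⟩
    obtain ⟨n, h1, h2, h3⟩ := γ.exists_int_c_eq s 0
    exact ⟨_, ⟨h1, by linarith⟩, h3⟩
  · rintro ⟨s, -, rfl⟩; exact ⟨s, rfl⟩

lemma isCompact_range_c : IsCompact (Set.range γ.c) := by
  rw [range_c_eq]; exact isCompact_Icc.image γ.continuous_c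

lemma wind_eq_zero_of_unbounded {S : Set ℂ} (hS : IsPreconnected S)
    (hd : Disjoint S (Set.range γ.c)) (hb : ¬ Bornology.IsBounded S) {x : ℂ} (hx : x ∈ S) :
    γ.wind x = 0 := by
  obtain ⟨R, hR⟩ := γ.exists_bound_c
  obtain ⟨R₁, hR₁⟩ := isCompact_Icc.exists_bound_of_continuousOn (s := Set.Icc (0:ℝ) 1)
    γ.continuous_c1.continuousOn
  have hR1p : 0 ≤ R₁ := (norm_nonneg _).trans (hR₁ 0 (by simp))
  have : ∃ y ∈ S, R + R₁ + 1 < ‖y‖ := by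
    by_contra hcon
    push Not at hcon
    exact hb (isBounded_iff_forall_norm_le.2 ⟨_, hcon⟩)
  obtain ⟨y, hy, hyR⟩ := this
  rw [wind_eq_of_isPreconnected hS hd hx hy]
  obtain ⟨n, hn⟩ := exists_int_wind (γ := γ) (Set.disjoint_left.1 hd hy)
  have hI : ‖∫ s in (0:ℝ)..1, γ.c1 s / (γ.c s - y)‖ ≤ 1 * |1 - 0| := by
    apply intervalIntegral.norm_integral_le_of_norm_le_const
    intro s hs
    rw [Set.uIoc_of_le zero_le_one] at hs
    rw [norm_div]
    have h1 := hR₁ s ⟨hs.1.le, hs.2⟩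
    have h2 := norm_sub_norm_le y (γ.c s)
    rw [norm_sub_rev] at h2
    have h3 := hR s
    rw [div_le_one (by linarith)]
    linarith
  have him := (Complex.abs_im_le_norm _).trans hI
  have hpi := pi_gt_three
  have hw : |γ.wind y| < 1 := by
    rw [wind, abs_div, abs_of_pos (by positivity : 0 < 2 * π), div_lt_one (by positivity)]
    simp at him
    linarith
  rw [hn] at hw ⊢
  have : |n| < 1 := by exact_mod_cast hw
  rw [Int.abs_lt_one_iff.1 this]; simp

/-- The winding number just above the lowest point of a curve. -/
lemma wind_above_lowest {a ε : ℝ} (hε : 0 < ε) (ht : γ.tan a = 1)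
    (hlow : ∀ s, (γ.c a).im ≤ (γ.c s).im)
    (hseg : ∀ r ∈ Set.Ioc 0 ε, γ.c a + r * Complex.I ∉ Set.range γ.c) :
    γ.wind (γ.c a + ε * Complex.I) = 1 := by
  set x := γ.c a + ε * Complex.I with hx
  have hpi := pi_pos
  have hfa : γ.c a - x = -(ε * Complex.I) := by rw [hx]; ring
  have hl : Complex.exp ((Real.log ε : ℝ) + (-(π / 2) : ℝ) * Complex.I) = γ.c a - x := by
    rw [hfa, Complex.exp_add, ← Complex.ofReal_exp, Real.exp_log hε]
    have : Complex.exp ((-(π / 2) : ℝ) * Complex.I) = -Complex.I := by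
      rw [Complex.exp_mul_I, ← Complex.ofReal_cos, ← Complex.ofReal_sin]
      simp
    rw [this]; ring
  obtain ⟨L, hLa, hL, hLe, hL1⟩ := exists_lift_sub (hseg ε ⟨hε, le_rfl⟩) a hl
  obtain ⟨n, hn⟩ := exists_int_wind (hseg ε ⟨hε, le_rfl⟩)
  rw [← hx] at hn
  set l : ℝ → ℝ := fun s => (L s).im with hldef
  have hla : l a = -(π / 2) := by simp [hldef, hLa]
  have hld : ∀ s, HasDerivAt l (γ.c1 s / (γ.c s - x)).im s := fun s =>
    Complex.imCLM.hasFDerivAt.comp_hasDerivAt s (hL s)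
  have hlc : Continuous l := continuous_iff_continuousAt.2 fun s => (hld s).continuousAt
  have hd0 : 0 < (γ.c1 a / (γ.c a - x)).im := by
    have e : γ.c1 a / (γ.c a - x) = (‖γ.c1 a‖ / ε : ℝ) * Complex.I := by
      rw [hfa, γ.c1_eq, ht]
      have : (ε : ℂ) ≠ 0 := by exact_mod_cast hε.ne'
      push_cast
      field_simp
      simp
    have := norm_pos_iff.2 (γ.c1_ne_zero a)
    rw [e]; simp; positivity
  have hd1 : 0 < (γ.c1 (a + 1) / (γ.c (a + 1) - x)).im := by rwa [γ.periodic, γ.periodic_c1]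
  have hbad : ∀ s ∈ Set.Ioo a (a + 1), ∀ k : ℤ, l s ≠ -(π / 2) + 2 * π * k := by
    intro s hs k hk
    obtain ⟨E, hE, h1⟩ : ∃ E : ℝ, 0 < E ∧ Complex.exp (L s) = -(E * Complex.I) := by
      refine ⟨Real.exp (L s).re, Real.exp_pos _, ?_⟩
      generalize hE : Real.exp (L s).re = E
      apply Complex.ext
      · rw [Complex.exp_re]
        change _ * cos (l s) = _
        rw [hk, mul_comm (2 * π), cos_add_int_mul_two_pi]; simp
      · rw [Complex.exp_im]
        change _ * sin (l s) = _
        rw [hk, mul_comm (2 * π), sin_add_int_mul_two_pi, hE]; simp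
    rw [hLe] at h1
    have h2 : γ.c s = γ.c a + ((ε - E : ℝ) : ℂ) * Complex.I := by
      rw [sub_eq_iff_eq_add] at h1
      rw [h1]; push_cast; ring
    have h3 := hlow s
    rw [h2] at h3
    simp at h3
    rcases h3.eq_or_lt with h | h
    · have : γ.c s = γ.c a := by rw [h2, h]; simp
      have := γ.eq_of_c_eq (by rw [abs_of_pos] <;> linarith [hs.1, hs.2]) this
      linarith [hs.1]
    · exact hseg (ε - E) ⟨by linarith, by linarith⟩ ⟨s, h2⟩
  have hgt : ∀ s ∈ Set.Ioo a (a + 1), -(π / 2) < l s := by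
    intro s hs
    by_contra hcon
    push Not at hcon
    have h1 := (hasDerivAt_iff_tendsto_slope.1 (hld a)).eventually_const_lt hd0
    have h2 : ∀ᶠ y in 𝓝[>] a, 0 < slope l a y :=
      h1.filter_mono (nhdsWithin_mono _ fun y hy => ne_of_gt hy)
    obtain ⟨y, hy1, hy2⟩ := (h2.and (Ioo_mem_nhdsGT hs.1)).exists
    rw [slope_def_field, hla] at hy1
    have hy3 : -(π / 2) < l y := by
      have := (div_pos_iff_of_pos_right (by linarith [hy2.1])).1 hy1
      linarith
    obtain ⟨z, hz, hzl⟩ := intermediate_value_Icc' hy2.2.le hlc.continuousOn ⟨hcon, hy3.le⟩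
    exact hbad z ⟨by linarith [hz.1, hy2.1], by linarith [hz.2, hs.2]⟩ 0 (by rw [hzl]; simp)
  have hlt : ∀ s ∈ Set.Ioo a (a + 1), l s < 3 * π / 2 := by
    intro s hs
    by_contra hcon
    push Not at hcon
    obtain ⟨z, hz, hzl⟩ := intermediate_value_Icc hs.1.le hlc.continuousOn
      ⟨by rw [hla]; linarith, hcon⟩
    have hza : z ≠ a := by rintro rfl; linarith
    exact hbad z ⟨lt_of_le_of_ne hz.1 hza.symm, by linarith [hz.2, hs.2]⟩ 1
      (by rw [hzl]; push_cast; ring)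
  have hl1 : l (a + 1) = -(π / 2) + 2 * π * n := by
    rw [← hla, ← hn]; exact hL1
  have hle : l (a + 1) ≤ 3 * π / 2 := by
    refine le_of_tendsto (hlc.continuousAt.mono_left (nhdsWithin_le_nhds (s := Set.Iio (a + 1)))) ?_
    filter_upwards [Ioo_mem_nhdsLT (show a < a + 1 by linarith)] with s hs using (hlt s hs).le
  have hge : -(π / 2) < l (a + 1) := by
    have h1 := (hasDerivAt_iff_tendsto_slope.1 (hld (a + 1))).eventually_const_lt hd1
    have h2 : ∀ᶠ y in 𝓝[<] (a + 1), 0 < slope l (a + 1) y :=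
      h1.filter_mono (nhdsWithin_mono _ fun y hy => ne_of_lt hy)
    obtain ⟨y, hy1, hy2⟩ := (h2.and (Ioo_mem_nhdsLT (show a < a + 1 by linarith))).exists
    rw [slope_def_field] at hy1
    have := hgt y hy2
    rcases div_pos_iff.1 hy1 with h | h
    · linarith [hy2.2, h.2]
    · linarith [h.1]
  have n1 : (0:ℝ) < n := by
    rw [hl1] at hge
    have : 0 < 2 * π * n := by linarith
    exact (pos_iff_pos_of_mul_pos this).1 (by positivity)
  have n2 : (n : ℝ) < 2 := by
    rw [hl1] at hle
    by_contra hcon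
    push Not at hcon
    nlinarith
  have : n = 1 := by
    have h1 : 0 < n := by exact_mod_cast n1
    have h2 : n < 2 := by exact_mod_cast n2
    omega
  rw [hn, this]; simp

variable {Ω : Set ℂ}

/-- The boundary of the exterior is the boundary curve through the lowest point. -/
lemma IsBdry.frontier_outerPart_eq (h : γ.IsBdry Ω) (hO : IsOpen Ω) (hC : IsPreconnected Ω) {a : ℝ}
    (hm : ∀ z ∈ closure Ω, (γ.c a).im ≤ z.im) (ht : γ.tan a = 1) :
    frontier (outerPart Ω) = Set.range γ.c := by
  have hS := h.sided_of_lowest hO hm ht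
  have hn : γ.nor a = Complex.I := by rw [nor, ht, mul_one]
  refine Set.Subset.antisymm (fun q hq => ?_) ?_
  · by_contra hqr
    have hdΩ : Disjoint Ω (Set.range γ.c) := by
      rw [Set.disjoint_left]
      intro x hx hxr
      have := h.range_subset hxr
      rw [hO.frontier_eq] at this
      exact this.2 hx
    obtain ⟨δ, hδ, hP⟩ := hS
    have hw1 : γ.wind (γ.c a + (δ / 2 : ℝ) * Complex.I) = 1 := by
      refine wind_above_lowest (by positivity) ht
        (fun s => hm _ (h.range_subset ⟨s, rfl⟩).1) fun r hr => ?_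
      have := (hP r ⟨hr.1, by linarith [hr.2]⟩).1
      rw [hn] at this
      exact Set.disjoint_left.1 hdΩ this
    have hmem : γ.c a + (δ / 2 : ℝ) * Complex.I ∈ Ω := by
      have := (hP (δ / 2) ⟨by positivity, by linarith⟩).1
      rwa [hn] at this
    obtain ⟨ε, hε, hb⟩ := Metric.isOpen_iff.1 γ.isCompact_range_c.isClosed.isOpen_compl q hqr
    have hbd : Disjoint (ball q ε) (Set.range γ.c) :=
      Set.disjoint_left.2 fun x hx => hb hx
    have hqΩ : q ∈ closure Ω := (frontier_outerPart_subset hO hq).1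
    obtain ⟨y, hy, hyΩ⟩ := mem_closure_iff.1 hqΩ _ isOpen_ball (mem_ball_self hε)
    obtain ⟨z, hz, hzU⟩ := mem_closure_iff.1 hq.1 _ isOpen_ball (mem_ball_self hε)
    have e1 := wind_eq_of_isPreconnected hC hdΩ hyΩ hmem
    have e2 := wind_eq_of_isPreconnected (convex_ball q ε).isPreconnected hbd hy hz
    have e3 := wind_eq_zero_of_unbounded (γ := γ) (S := connectedComponentIn (closure Ω)ᶜ z)
      isPreconnected_connectedComponentIn (Set.disjoint_left.2 fun x hx hxr =>
        connectedComponentIn_subset _ _ hx (h.range_subset hxr).1) hzU.2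
        (mem_connectedComponentIn hzU.1)
    rw [hw1, e2, e3] at e1
    norm_num at e1
  · rintro _ ⟨s, rfl⟩
    exact (h.sided hO hS s).mem_frontier (h.range_subset ⟨s, rfl⟩)

end PlaneLoop

namespace PlaneLoop
variable {γ : PlaneLoop} {Ω : Set ℂ}

lemma tan_eq_one_or_of_isLocalExtr {s : ℝ} (h : IsLocalExtr (fun s => (γ.c s).im) s) :
    γ.tan s = 1 ∨ γ.tan s = -1 := by
  have h1 : HasDerivAt (fun s => (γ.c s).im) (γ.c1 s).im s :=
    Complex.imCLM.hasFDerivAt.comp_hasDerivAt s (γ.hasDerivAt_c s)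
  have h2 := h.hasDerivAt_eq_zero h1
  have h3 : (γ.tan s).im = 0 := by
    rw [tan_eq, Complex.div_ofReal_im, h2, zero_div]
  have h4 := γ.norm_tan s
  have h5 : γ.tan s = ((γ.tan s).re : ℂ) := Complex.ext rfl (by simpa using h3)
  rw [h5, Complex.norm_real, Real.norm_eq_abs, abs_eq zero_le_one] at h4
  rw [h5]
  rcases h4 with h | h <;> simp [h]

lemma exists_int_of_tan_eq_one {s : ℝ} (h : γ.tan s = 1) : ∃ m : ℤ, γ.ang s = 2 * π * m := by
  obtain ⟨m, hm⟩ := Complex.exp_eq_one_iff.1 h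
  refine ⟨m, ?_⟩
  have := congrArg Complex.im hm
  simp at this
  rw [this]; ring

lemma exists_int_of_tan_eq_neg_one {s : ℝ} (h : γ.tan s = -1) :
    ∃ m : ℤ, γ.ang s = π + 2 * π * m := by
  rw [← Complex.exp_pi_mul_I] at h
  obtain ⟨m, hm⟩ := Complex.exp_eq_exp_iff_exists_int.1 h
  refine ⟨m, ?_⟩
  have := congrArg Complex.im hm
  simp at this
  rw [this]; ring

/-- The total turning of a loop that is at its lowest point to the right and at its highest point
to the left. -/
lemma turning_of_extrema {a b : ℝ} (hab : a < b) (hba : b < a + 1) (ha : γ.tan a = 1)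
    (hb : γ.tan b = -1) (hlow : ∀ s, (γ.c a).im ≤ (γ.c s).im)
    (hhigh : ∀ s, (γ.c s).im ≤ (γ.c b).im) : γ.ang 1 = γ.ang 0 + 2 * π := by
  have hpi := pi_pos
  have hrot : ∀ z : ℂ, (Complex.exp (-((π / 2 : ℝ) * Complex.I)) * z).re = z.im := by
    intro z
    have : Complex.exp (-((π / 2 : ℝ) * Complex.I)) = -Complex.I := by
      rw [← neg_mul, ← Complex.ofReal_neg, Complex.exp_mul_I, ← Complex.ofReal_cos,
        ← Complex.ofReal_sin]
      simp
    rw [this]; simp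
  have hrot' : ∀ z : ℂ, (Complex.exp (-((-(π / 2) : ℝ) * Complex.I)) * z).re = -z.im := by
    intro z
    have : Complex.exp (-((-(π / 2) : ℝ) * Complex.I)) = Complex.I := by
      rw [← neg_mul, ← Complex.ofReal_neg, neg_neg, Complex.exp_mul_I, ← Complex.ofReal_cos,
        ← Complex.ofReal_sin]
      simp
    rw [this]; simp
  have hinj : ∀ {x y : ℝ}, y < x + 1 → Set.InjOn γ.c (Set.Icc x y) := by
    intro x y hxy s hs t ht hst
    exact γ.eq_of_c_eq (by rw [abs_lt]; constructor <;> linarith [hs.1, hs.2, ht.1, ht.2]) hst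
  obtain ⟨m, hm⟩ := exists_int_of_tan_eq_one ha
  obtain ⟨m', hm'⟩ := exists_int_of_tan_eq_neg_one hb
  obtain ⟨n, hn⟩ := angle_eq_add_int (f := fun s => γ.ang (s + 1)) (g := γ.ang)
    (γ.continuous_ang.comp (by fun_prop)) γ.continuous_ang γ.periodic_tan
  have ha1 := hn a
  have h01 := hn 0
  rw [zero_add] at h01
  have hca : γ.c (a + 1) = γ.c a := γ.periodic a
  obtain ⟨k₁, k₂, v, p1, p2, p3, p4⟩ := hopf_secant γ.hasDerivAt_c γ.continuous_c1 γ.c1_ne_zero hab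
    (hinj hba) γ.continuous_ang γ.c1_eq (ω₁ := π / 2) (ω₂ := π / 2)
    (fun t _ => by rw [hrot, Complex.sub_im]; linarith [hlow t])
    (fun t _ => by rw [hrot, Complex.sub_im]; linarith [hhigh t])
  obtain ⟨j₁, j₂, w, q1, q2, q3, q4⟩ := hopf_secant γ.hasDerivAt_c γ.continuous_c1 γ.c1_ne_zero hba
    (hinj (by linarith)) γ.continuous_ang γ.c1_eq (ω₁ := -(π / 2)) (ω₂ := -(π / 2))
    (fun t _ => by rw [hrot', Complex.sub_im]; linarith [hhigh t])
    (fun t _ => by rw [hrot', Complex.sub_im, hca]; linarith [hlow t])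
  rw [abs_le] at p1 p2 p3 p4 q1 q2 q3 q4
  rw [ha1] at q4
  have cast : ∀ (i j : ℤ) (c : ℝ), c < 1 → 2 * π * (i:ℝ) ≤ 2 * π * (j:ℝ) + 2 * π * c → i ≤ j := by
    intro i j c hc h
    have h1 : (i:ℝ) ≤ j + c := by
      have : 2 * π * (i:ℝ) ≤ 2 * π * (j + c) := by linarith
      exact le_of_mul_le_mul_left this (by positivity)
    have : (i:ℝ) < j + 1 := by linarith
    have : i < j + 1 := by exact_mod_cast this
    omega
  have ek : k₁ = k₂ := le_antisymm (cast _ _ (1 / 2) (by norm_num) (by linarith))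
    (cast _ _ (1 / 2) (by norm_num) (by linarith))
  have ej : j₁ = j₂ := le_antisymm (cast _ _ (1 / 2) (by norm_num) (by linarith))
    (cast _ _ (1 / 2) (by norm_num) (by linarith))
  rw [hm] at p1 q4
  rw [hm'] at p4 q1
  have e1 : m = k₁ := le_antisymm (cast _ _ (1 / 2) (by norm_num) (by linarith))
    (cast _ _ 0 (by norm_num) (by linarith))
  have e2 : m' = k₂ := le_antisymm (cast _ _ 0 (by norm_num) (by linarith))
    (cast _ _ (1 / 2) (by norm_num) (by linarith))
  have e3 : m' + 1 = j₁ := le_antisymm (cast _ _ (1 / 2) (by norm_num) (by push_cast; linarith))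
    (cast _ _ 0 (by norm_num) (by push_cast; linarith))
  have e4 : m + n = j₂ := le_antisymm (cast _ _ 0 (by norm_num) (by push_cast; linarith))
    (cast _ _ (1 / 2) (by norm_num) (by push_cast; linarith))
  have : n = 1 := by omega
  rw [h01, this]; simp

/-- The total turning of the outer boundary curve of a domain. -/
lemma IsBdry.turning (h : γ.IsBdry Ω) (hO : IsOpen Ω) (hC : IsPreconnected Ω)
    (hB : Bornology.IsBounded Ω) {a : ℝ} (hm : ∀ z ∈ closure Ω, (γ.c a).im ≤ z.im)
    (ht : γ.tan a = 1) : γ.ang 1 = γ.ang 0 + 2 * π := by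
  have hS := h.sided_of_lowest hO hm ht
  have hcl : ∀ s, γ.c s ∈ closure Ω := fun s => (h.range_subset ⟨s, rfl⟩).1
  obtain ⟨q, hq, hqmax⟩ := hB.isCompact_closure.exists_isMaxOn ⟨γ.c a, hcl a⟩
    Complex.continuous_im.continuousOn
  have hqm : ∀ z ∈ closure Ω, z.im ≤ q.im := fun z hz => hqmax hz
  have hup := setOf_lt_im_subset_outerPart hqm
  have hqf : q ∈ frontier (outerPart Ω) := by
    rw [isOpen_outerPart.frontier_eq]
    refine ⟨?_, fun h => h.1 hq⟩
    have : Tendsto (fun r : ℝ => q + r * Complex.I) (𝓝[>] 0) (𝓝 q) := by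
      have hc : Continuous fun r : ℝ => q + r * Complex.I := by fun_prop
      have := hc.tendsto 0
      simp only [Complex.ofReal_zero, zero_mul, add_zero] at this
      exact this.mono_left nhdsWithin_le_nhds
    refine mem_closure_of_tendsto this ?_
    filter_upwards [self_mem_nhdsWithin] with r hr
    exact hup (by simpa using hr)
  rw [h.frontier_outerPart_eq hO hC hm ht] at hqf
  obtain ⟨b₀, hb₀⟩ := hqf
  obtain ⟨n, hn1, hn2, hn3⟩ := γ.exists_int_c_eq b₀ a
  have hcb : γ.c (b₀ + n) = q := by rw [hn3, hb₀]
  have hhigh : ∀ s, (γ.c s).im ≤ (γ.c (b₀ + n)).im := fun s => by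
    rw [hcb]; exact hqm _ (hcl s)
  have hne : ∀ s, γ.tan s = 1 → (γ.c s).im ≠ q.im := by
    intro s hs hsq
    obtain ⟨δ, hδ, hP⟩ := h.sided hO hS s
    have hmem := (hP (δ / 2) ⟨by positivity, by linarith⟩).1
    have := hqm _ (subset_closure hmem)
    rw [nor, hs, ← hsq] at this
    simp at this
    linarith
  refine turning_of_extrema (lt_of_le_of_ne hn1 ?_) hn2 ht ?_
    (fun s => hm _ (hcl s)) hhigh
  · intro he
    exact hne a ht (by rw [he, hcb])
  · refine (tan_eq_one_or_of_isLocalExtr (Or.inr ?_)).resolve_left fun h => hne _ h (by rw [hcb])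
    exact Eventually.of_forall hhigh

end PlaneLoop

namespace PlaneLoop
variable {γ : PlaneLoop} {Ω : Set ℂ}

/-- The curve `γ` bounds the exterior of `Ω`, with `Ω` on its left. -/
structure IsOuter (γ : PlaneLoop) (Ω : Set ℂ) : Prop where
  isOpen : IsOpen Ω
  isConnected : IsConnected Ω
  isBounded : Bornology.IsBounded Ω
  range_subset : Set.range γ.c ⊆ frontier Ω
  frontier_outerPart : frontier (outerPart Ω) = Set.range γ.c
  sided : ∀ s, γ.Sided Ω s
  turning : γ.ang 1 = γ.ang 0 + 2 * π

lemma IsBdry.isOuter (h : γ.IsBdry Ω) (hO : IsOpen Ω) (hC : IsConnected Ω)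
    (hB : Bornology.IsBounded Ω) {a : ℝ} (hm : ∀ z ∈ closure Ω, (γ.c a).im ≤ z.im)
    (ht : γ.tan a = 1) : γ.IsOuter Ω :=
  ⟨hO, hC, hB, h.range_subset, h.frontier_outerPart_eq hO hC.isPreconnected hm ht,
    h.sided hO (h.sided_of_lowest hO hm ht), h.turning hO hC.isPreconnected hB hm ht⟩

lemma infDist_range_le (s : ℝ) (x : ℂ) : infDist x (Set.range γ.c) ≤ ‖γ.c s - x‖ := by
  rw [← dist_eq_norm, dist_comm]
  exact infDist_le_dist_of_mem ⟨s, rfl⟩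

lemma eq_add_mul_nor {s₀ : ℝ} {x : ℂ} {d : ℝ} (hd : ‖γ.c s₀ - x‖ = d)
    (hmin : ∀ s, d ≤ ‖γ.c s - x‖) :
    γ.c s₀ + d * γ.nor s₀ = x ∨ γ.c s₀ - d * γ.nor s₀ = x := by
  have hd0 : 0 ≤ d := hd ▸ norm_nonneg _
  set w : ℂ := (γ.c s₀ - x) * (starRingEnd ℂ) (γ.tan s₀) with hw
  have hderiv : HasDerivAt (fun s => ‖γ.c s - x‖ ^ 2) (2 * inner ℝ (γ.c s₀ - x) (γ.c1 s₀)) s₀ :=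
    ((γ.hasDerivAt_c s₀).sub_const x).norm_sq
  have hloc : IsLocalMin (fun s => ‖γ.c s - x‖ ^ 2) s₀ := Eventually.of_forall fun s => by
    simp only [hd]
    exact pow_le_pow_left₀ hd0 (hmin s) 2
  have h0 := hloc.hasDerivAt_eq_zero hderiv
  have hre : w.re = 0 := by
    rw [γ.c1_eq, Complex.inner] at h0
    have h1 := norm_pos_iff.2 (γ.c1_ne_zero s₀)
    rw [hw]
    simp at h0 ⊢
    have h2 : ‖γ.c1 s₀‖ * (((γ.c s₀).re - x.re) * (γ.tan s₀).re +
        ((γ.c s₀).im - x.im) * (γ.tan s₀).im) = 0 := by linarith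
    linarith [(mul_eq_zero.1 h2).resolve_left h1.ne']
  have htt : γ.tan s₀ * (starRingEnd ℂ) (γ.tan s₀) = 1 := by
    rw [Complex.mul_conj, Complex.normSq_eq_norm_sq, γ.norm_tan]; simp
  have hx : γ.c s₀ - x = w * γ.tan s₀ := by
    rw [hw, mul_assoc, mul_comm _ (γ.tan s₀), htt, mul_one]
  have hwI : w = w.im * Complex.I := by
    apply Complex.ext <;> simp [hre]
  have hnw : |w.im| = d := by
    rw [← hd, hx, norm_mul, γ.norm_tan, mul_one, hwI]; simp
  rw [hwI, mul_assoc] at hx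
  change γ.c s₀ - x = w.im * γ.nor s₀ at hx
  rcases abs_choice w.im with h | h
  · right; rw [← hnw, h, ← hx]; ring
  · left; rw [← hnw, h]; push_cast; rw [neg_mul, ← hx]; ring

namespace IsOuter
variable (h : γ.IsOuter Ω)

lemma notMem_outerPart (_ : γ.IsOuter Ω) {x : ℂ} (hx : x ∈ Ω) : x ∉ outerPart Ω :=
  fun hU => hU.1 (subset_closure hx)

include h

lemma notMem_range {x : ℂ} (hx : x ∈ Ω) : x ∉ Set.range γ.c := fun hr => by
  have := h.range_subset hr
  rw [h.isOpen.frontier_eq] at this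
  exact this.2 hx

lemma infDist_pos {x : ℂ} (hx : x ∈ Ω) : 0 < infDist x (Set.range γ.c) :=
  (γ.isCompact_range_c.isClosed.notMem_iff_infDist_pos ⟨_, ⟨0, rfl⟩⟩).1 (h.notMem_range hx)

lemma exists_foot {x : ℂ} (hx : x ∈ Ω) :
    ∃ s₀, γ.c s₀ + (infDist x (Set.range γ.c) : ℝ) * γ.nor s₀ = x := by
  obtain ⟨_, ⟨s₀, rfl⟩, hs₀⟩ := γ.isCompact_range_c.exists_infDist_eq_dist ⟨_, ⟨0, rfl⟩⟩ x
  set d := infDist x (Set.range γ.c) with hd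
  have hdp : 0 < d := h.infDist_pos hx
  rw [dist_comm, dist_eq_norm] at hs₀
  refine ⟨s₀, (eq_add_mul_nor hs₀.symm fun s => infDist_range_le s x).resolve_right fun hcon => ?_⟩
  set S : Set ℂ := (fun r : ℝ => γ.c s₀ - r * γ.nor s₀) '' Set.Ioc 0 d with hS
  have hSp : IsPreconnected S := isPreconnected_Ioc.image _ (by fun_prop)
  have hSd : Disjoint S (frontier (outerPart Ω)) := by
    rw [h.frontier_outerPart, Set.disjoint_left]
    rintro _ ⟨r, hr, rfl⟩ ⟨s, hs⟩
    have h1 := infDist_range_le (γ := γ) s x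
    simp only at hs
    have e : γ.c s - x = ((d - r : ℝ) : ℂ) * γ.nor s₀ := by
      rw [hs]; push_cast; linear_combination hcon
    rw [e, norm_mul, γ.norm_nor, mul_one, Complex.norm_real, Real.norm_eq_abs,
      abs_of_nonneg (by linarith [hr.2])] at h1
    linarith [hr.1]
  rcases hSp.subset_or_subset_of_disjoint_frontier isOpen_outerPart hSd with h1 | h1
  · exact h.notMem_outerPart hx (h1 ⟨d, ⟨hdp, le_rfl⟩, hcon⟩)
  · obtain ⟨δ, hδ, hP⟩ := h.sided s₀
    obtain ⟨r, hr0, hr⟩ := exists_between (lt_min hδ hdp)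
    rw [lt_min_iff] at hr
    exact h1 ⟨r, ⟨hr0, hr.2.le⟩, rfl⟩ (subset_closure (hP r ⟨hr0, hr.1⟩).2)

lemma exists_ray_hit {y v : ℂ} (hy : y ∈ Ω) (hv : ‖v‖ = 1) :
    ∃ r : ℝ, 0 ≤ r ∧ y + r * v ∈ Set.range γ.c := by
  by_contra hcon
  push Not at hcon
  have hline : ∀ s : Set ℝ, Convex ℝ s → IsPreconnected ((fun r : ℝ => y + r * v) '' s) :=
    fun s hs => hs.isPreconnected.image _ (by fun_prop)
  have hd : Disjoint ((fun r : ℝ => y + r * v) '' Set.Ici 0) (frontier (outerPart Ω)) := by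
    rw [h.frontier_outerPart, Set.disjoint_left]
    rintro _ ⟨r, hr, rfl⟩
    exact hcon r hr
  have h1 := ((hline _ (convex_Ici 0)).subset_or_subset_of_disjoint_frontier isOpen_outerPart
    hd).resolve_left fun h1 => h.notMem_outerPart hy (h1 ⟨0, by simp, by simp⟩)
  obtain ⟨R, hR⟩ := h.isBounded.closure.exists_norm_le
  have hnorm : ∀ r : ℝ, |r| - ‖y‖ ≤ ‖y + r * v‖ := fun r => by
    have := norm_sub_norm_le ((r:ℂ) * v) (-y)
    rw [norm_mul, hv, mul_one, Complex.norm_real, norm_neg, sub_neg_eq_add, add_comm _ y] at this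
    exact this
  have hR0 : 0 ≤ R := (norm_nonneg y).trans (hR y (subset_closure hy))
  set R₁ := R + ‖y‖ + 1 with hR₁
  have hR1p : 0 ≤ R₁ := by positivity
  have hU : (fun r : ℝ => y + r * v) '' Set.Ici R₁ ⊆ outerPart Ω := by
    refine subset_outerPart_of_unbounded (hline _ (convex_Ici _)) ?_ ?_
    · rintro _ ⟨r, hr, rfl⟩ hc
      have h2 := hnorm r
      have h3 := hR _ hc
      have h4 := le_abs_self r
      have : R₁ ≤ r := hr
      simp only at h3
      linarith
    · intro hb
      obtain ⟨M, hM⟩ := hb.exists_norm_le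
      have h2 := hM _ ⟨max R₁ (M + ‖y‖ + 1), Set.mem_Ici.2 (le_max_left _ _), rfl⟩
      have h3 := hnorm (max R₁ (M + ‖y‖ + 1))
      have h4 := le_abs_self (max R₁ (M + ‖y‖ + 1))
      have h5 := le_max_right R₁ (M + ‖y‖ + 1)
      simp only at h2
      linarith
  exact h1 ⟨R₁, hR1p, rfl⟩ (subset_closure (hU ⟨R₁, Set.mem_Ici.2 le_rfl, rfl⟩))

lemma infDist_le_of_range_subset {x y : ℂ} {t : ℝ} (hx : ∀ s, ‖γ.c s - x‖ ≤ t) (hy : y ∈ Ω) :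
    infDist y (Set.range γ.c) ≤ t := by
  have ht : 0 ≤ t := (norm_nonneg _).trans (hx 0)
  obtain ⟨v, hv, hperp⟩ : ∃ v : ℂ, ‖v‖ = 1 ∧ inner ℝ (y - x) v = 0 := by
    rcases eq_or_ne (y - x) 0 with h0 | h0
    · exact ⟨1, by simp, by rw [h0, inner_zero_left]⟩
    · refine ⟨Complex.I * ((y - x) / ‖y - x‖), ?_, ?_⟩
      · simp [norm_ne_zero_iff.2 h0]
      · rw [Complex.inner, show Complex.I * ((y - x) / ‖y - x‖) * (starRingEnd ℂ) (y - x) =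
          Complex.I * ((y - x) * (starRingEnd ℂ) (y - x)) / ‖y - x‖ by ring, Complex.mul_conj,
          Complex.div_ofReal_re]
        simp
  obtain ⟨r, hr, s, hs⟩ := h.exists_ray_hit hy hv
  have h1 := infDist_range_le (γ := γ) s y
  have h2 : ‖γ.c s - y‖ = r := by
    rw [hs, add_sub_cancel_left, norm_mul, hv, mul_one, Complex.norm_real, Real.norm_eq_abs,
      abs_of_nonneg hr]
  have h3 := hx s
  have h4 : ‖γ.c s - x‖ ^ 2 = ‖y - x‖ ^ 2 + r ^ 2 := by
    have e : γ.c s - x = (y - x) + r • v := by rw [hs, Complex.real_smul]; ring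
    rw [e, norm_add_sq_real, inner_smul_right, hperp, norm_smul, hv, Real.norm_eq_abs, mul_one,
      sq_abs]
    ring
  rw [h2] at h1
  refine h1.trans (abs_le_of_sq_le_sq' ?_ ht).2
  nlinarith [sq_nonneg ‖y - x‖, pow_le_pow_left₀ (norm_nonneg _) h3 2]

/-- The collar estimate for small distances. -/
lemma volume_collar_le_of_far {t : ℝ} (ht : 0 < t) (hfar : ∀ x, ∃ s, t < ‖γ.c s - x‖) :
    (volume {x ∈ Ω | infDist x (Set.range γ.c) < t}).toReal ≤ γ.len * t - π * t ^ 2 := by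
  refine γ.volume_collar_le ht h.turning hfar ?_ (h.isBounded.subset fun x hx => hx.1) ?_
  · exact (h.isOpen.inter (isOpen_lt (continuous_infDist_pt _) continuous_const)).measurableSet
  · rintro x ⟨hx, hxt⟩
    obtain ⟨s₀, hs₀⟩ := h.exists_foot hx
    exact ⟨s₀, _, h.infDist_pos hx, hxt, hs₀, fun s => infDist_range_le s x⟩

/-- The collar estimate and the isoperimetric inequality. -/
lemma collar_and_isoperimetric {ℓ : ℝ} (hℓ : γ.len ≤ ℓ) :
    (∀ t, 0 < t → t ≤ ℓ / (2 * π) →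
      (volume {x ∈ Ω | infDist x (Set.range γ.c) < t}).toReal ≤ ℓ * t - π * t ^ 2) ∧
    4 * π * (volume Ω).toReal ≤ ℓ ^ 2 := by
  have hpi := pi_pos
  set d : ℂ → ℝ := fun x => infDist x (Set.range γ.c) with hd
  have hdc : Continuous d := continuous_infDist_pt _
  have hfin : volume Ω ≠ ⊤ := h.isBounded.measure_lt_top.ne
  set G : Set ℝ := {t | 0 < t ∧ ∀ x, ∃ s, t < ‖γ.c s - x‖} with hG
  have hGne : G.Nonempty := by
    have hne : γ.c 0 ≠ γ.c (1 / 2) := fun he => by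
      have := γ.eq_of_c_eq (s := 0) (t := 1 / 2) (by norm_num [abs_of_pos]) he
      norm_num at this
    have hp : 0 < ‖γ.c 0 - γ.c (1 / 2)‖ := norm_pos_iff.2 (sub_ne_zero.2 hne)
    refine ⟨‖γ.c 0 - γ.c (1 / 2)‖ / 3, by positivity, fun x => ?_⟩
    by_contra hcon
    push Not at hcon
    have h1 := norm_sub_le (γ.c 0 - x) (γ.c (1 / 2) - x)
    rw [sub_sub_sub_cancel_right] at h1
    linarith [hcon 0, hcon (1 / 2)]
  have hGb : BddAbove G := by
    obtain ⟨R, hR⟩ := γ.exists_bound_c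
    refine ⟨R, fun t ht => ?_⟩
    obtain ⟨s, hs⟩ := ht.2 0
    rw [sub_zero] at hs
    linarith [hR s]
  set T := sSup G with hT
  have hTpos : 0 < T := by
    obtain ⟨t, ht⟩ := hGne
    exact ht.1.trans_le (le_csSup hGb ht)
  have hgood : ∀ t, 0 < t → t < T → t ∈ G := by
    intro t ht htT
    obtain ⟨t', ht', htt'⟩ := exists_lt_of_lt_csSup hGne htT
    refine ⟨ht, fun x => ?_⟩
    obtain ⟨s, hs⟩ := ht'.2 x
    exact ⟨s, htt'.trans hs⟩
  have hbad : ∀ t, T < t → ∀ y ∈ Ω, d y ≤ t := by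
    intro t ht y hy
    have : t ∉ G := notMem_of_csSup_lt ht hGb
    simp only [hG, Set.mem_ofPred_eq, not_and, not_forall, not_exists, not_lt] at this
    obtain ⟨x, hx⟩ := this (hTpos.trans ht)
    exact h.infDist_le_of_range_subset hx hy
  have hdT : ∀ y ∈ Ω, d y ≤ T := fun y hy => le_of_forall_gt_imp_ge_of_dense fun t ht => hbad t ht y hy
  have hA0 : volume Ω = volume {x ∈ Ω | d x < T} := by
    refine le_antisymm ?_ (measure_mono fun x hx => hx.1)
    have hsub : Ω ⊆ {x ∈ Ω | d x < T} ∪ Set.range (γ.par T) := by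
      intro x hx
      rcases (hdT x hx).lt_or_eq with hlt | heq
      · exact Or.inl ⟨hx, hlt⟩
      · right
        obtain ⟨s₀, hs₀⟩ := h.exists_foot hx
        change γ.c s₀ + (d x : ℝ) * γ.nor s₀ = x at hs₀
        rw [heq] at hs₀
        exact ⟨s₀, hs₀⟩
    refine (measure_mono hsub).trans ((measure_union_le _ _).trans ?_)
    rw [volume_range_eq_zero (γ.hasDerivAt_par T), add_zero]
  have hlim : (volume Ω).toReal ≤ γ.len * T - π * T ^ 2 := by
    obtain ⟨u, hu, huT, hul⟩ := exists_seq_strictMono_tendsto' hTpos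
    have hmono : Monotone fun n => {x ∈ Ω | d x < u n} := fun m n hmn x hx =>
      ⟨hx.1, hx.2.trans_le (hu.monotone hmn)⟩
    have hun : ⋃ n, {x ∈ Ω | d x < u n} = {x ∈ Ω | d x < T} := by
      ext x
      simp only [Set.mem_iUnion, Set.mem_ofPred_eq]
      constructor
      · rintro ⟨n, hx, hxn⟩; exact ⟨hx, hxn.trans (huT n).2⟩
      · rintro ⟨hx, hxT⟩
        obtain ⟨n, hn⟩ := (hul.eventually_const_lt hxT).exists
        exact ⟨n, hx, hn⟩
    have ht1 := tendsto_measure_iUnion_atTop (μ := volume) hmono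
    rw [hun, ← hA0] at ht1
    have ht2 := (ENNReal.tendsto_toReal hfin).comp ht1
    refine le_of_tendsto_of_tendsto' ht2
      (((tendsto_const_nhds (x := γ.len)).mul hul).sub
        ((tendsto_const_nhds (x := π)).mul (hul.pow 2))) fun n => ?_
    exact h.volume_collar_le_of_far (huT n).1 (hgood _ (huT n).1 (huT n).2).2
  have hlim' : (volume Ω).toReal ≤ ℓ * T - π * T ^ 2 := by
    refine hlim.trans ?_
    gcongr
  refine ⟨fun t ht htr => ?_, ?_⟩
  · rcases lt_or_ge t T with htT | htT
    · refine (h.volume_collar_le_of_far ht (hgood t ht htT).2).trans ?_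
      gcongr
    · refine (ENNReal.toReal_mono hfin (measure_mono fun x hx => hx.1)).trans (hlim'.trans ?_)
      rw [le_div_iff₀ (by positivity)] at htr
      nlinarith [mul_nonneg (sub_nonneg.2 htT) (show 0 ≤ ℓ - π * (t + T) by nlinarith)]
  · nlinarith [sq_nonneg (ℓ - 2 * π * T)]

end IsOuter
end PlaneLoop

lemma ofReal_norm_sub_le_hausdorffMeasure_image {c : ℝ → ℂ} (hc : Continuous c) {a b : ℝ}
    (hab : a ≤ b) : ENNReal.ofReal ‖c b - c a‖ ≤ μH[1] (c '' Set.Ico a b) := by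
  rcases eq_or_ne (c b - c a) 0 with h0 | h0
  · simp [h0]
  have hn : ‖c b - c a‖ ≠ 0 := norm_ne_zero_iff.2 h0
  set v : ℂ := (starRingEnd ℂ) (c b - c a) / ‖c b - c a‖ with hv
  have hv1 : ‖v‖ = 1 := by
    rw [hv, norm_div, RCLike.norm_conj, Complex.norm_real, norm_norm, div_self hn]
  set f : ℂ → ℝ := fun z => (v * z).re with hf
  have hfL : LipschitzWith 1 f := by
    refine LipschitzWith.of_dist_le_mul fun x y => ?_
    rw [hf, Real.dist_eq, ← Complex.sub_re, ← mul_sub, NNReal.coe_one, one_mul, dist_eq_norm]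
    refine (Complex.abs_re_le_norm _).trans ?_
    rw [norm_mul, hv1, one_mul]
  have hfd : f (c b) - f (c a) = ‖c b - c a‖ := by
    rw [hf, ← Complex.sub_re, ← mul_sub, hv, div_mul_eq_mul_div, mul_comm, Complex.mul_conj,
      Complex.normSq_eq_norm_sq, Complex.div_ofReal_re, Complex.ofReal_re]
    field_simp
  have hsub : Set.Icc (f (c a)) (f (c b)) ⊆ f '' (c '' Set.Icc a b) := by
    rw [← Set.image_comp]
    exact intermediate_value_Icc hab (hfL.continuous.comp hc).continuousOn
  have hvol : ENNReal.ofReal ‖c b - c a‖ ≤ μH[1] (c '' Set.Icc a b) := by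
    have h1 := hfL.hausdorffMeasure_image_le zero_le_one (c '' Set.Icc a b)
    rw [hausdorffMeasure_real] at h1
    simp only [ENNReal.coe_one, ENNReal.one_rpow, one_mul] at h1
    rw [← hfd, ← Real.volume_Icc]
    exact (measure_mono hsub).trans h1
  refine hvol.trans ?_
  have hI : c '' Set.Icc a b ⊆ c '' Set.Ico a b ∪ {c b} := by
    rintro _ ⟨s, hs, rfl⟩
    rcases hs.2.lt_or_eq with h | h
    · exact Or.inl ⟨s, ⟨hs.1, h⟩, rfl⟩
    · right; rw [h]; rfl
  refine (measure_mono hI).trans ((measure_union_le _ _).trans ?_)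
  have := Measure.nullSingletonClass_hausdorff ℂ (zero_lt_one (α := ℝ))
  rw [measure_singleton, add_zero]

namespace PlaneLoop
variable (γ : PlaneLoop)

lemma integral_norm_c1_le {M a b : ℝ} (hM : ∀ s, ‖γ.c2 s‖ ≤ M) (hab : a ≤ b) :
    ∫ s in a..b, ‖γ.c1 s‖ ≤ ‖γ.c b - γ.c a‖ + 2 * M * (b - a) ^ 2 := by
  have hM0 : 0 ≤ M := (norm_nonneg _).trans (hM 0)
  have h1 : ∀ s ∈ Set.Icc a b, ‖γ.c1 s - γ.c1 a‖ ≤ M * (b - a) := by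
    intro s hs
    have := (convex_Icc a b).norm_image_sub_le_of_norm_hasDerivWithin_le (f := γ.c1) (f' := γ.c2)
      (C := M) (fun x _ => (γ.hasDerivAt_c1 x).hasDerivWithinAt) (fun x _ => hM x)
      (Set.left_mem_Icc.2 hab) hs
    refine this.trans ?_
    rw [Real.norm_eq_abs, abs_of_nonneg (by linarith [hs.1])]
    gcongr
    exact hs.2
  have hFTC : ∫ s in a..b, γ.c1 s = γ.c b - γ.c a :=
    intervalIntegral.integral_eq_sub_of_hasDerivAt (fun s _ => γ.hasDerivAt_c s)
      (γ.continuous_c1.intervalIntegrable _ _)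
  have h2 : ‖(γ.c b - γ.c a) - ((b - a : ℝ) : ℂ) * γ.c1 a‖ ≤ M * (b - a) * (b - a) := by
    have e : (γ.c b - γ.c a) - ((b - a : ℝ) : ℂ) * γ.c1 a = ∫ s in a..b, (γ.c1 s - γ.c1 a) := by
      rw [intervalIntegral.integral_sub (γ.continuous_c1.intervalIntegrable _ _) (by simp), hFTC,
        intervalIntegral.integral_const, Complex.real_smul]
    rw [e]
    have := intervalIntegral.norm_integral_le_of_norm_le_const (a := a) (b := b)
      (f := fun s => γ.c1 s - γ.c1 a) (C := M * (b - a)) fun s hs => by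
        rw [Set.uIoc_of_le hab] at hs
        exact h1 s ⟨hs.1.le, hs.2⟩
    rwa [abs_of_nonneg (sub_nonneg.2 hab)] at this
  have h3 : (b - a) * ‖γ.c1 a‖ ≤ ‖γ.c b - γ.c a‖ + M * (b - a) * (b - a) := by
    have := norm_sub_norm_le (((b - a : ℝ) : ℂ) * γ.c1 a) (γ.c b - γ.c a)
    rw [norm_sub_rev (_ * _), norm_mul, Complex.norm_real, Real.norm_eq_abs,
      abs_of_nonneg (sub_nonneg.2 hab)] at this
    linarith
  have h4 : ∫ s in a..b, ‖γ.c1 s‖ ≤ ∫ s in a..b, (‖γ.c1 a‖ + M * (b - a)) := by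
    refine intervalIntegral.integral_mono_on hab (γ.continuous_c1.norm.intervalIntegrable _ _)
      (by simp) fun s hs => ?_
    have := norm_sub_norm_le (γ.c1 s) (γ.c1 a)
    linarith [h1 s hs]
  rw [intervalIntegral.integral_const, smul_eq_mul] at h4
  nlinarith

lemma exists_bound_c1 : ∃ M : NNReal, ∀ s, ‖γ.c1 s‖ ≤ M := by
  obtain ⟨R, hR⟩ := (γ.periodic_c1.compact_of_continuous one_ne_zero
    γ.continuous_c1).isBounded.exists_norm_le
  exact ⟨⟨R, (norm_nonneg _).trans (hR _ ⟨0, rfl⟩)⟩, fun s => hR _ ⟨s, rfl⟩⟩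

lemma exists_bound_c2 : ∃ M : ℝ, ∀ s, ‖γ.c2 s‖ ≤ M := by
  obtain ⟨R, hR⟩ := (γ.periodic_c2.compact_of_continuous one_ne_zero
    γ.continuous_c2).isBounded.exists_norm_le
  exact ⟨R, fun s => hR _ ⟨s, rfl⟩⟩

lemma exists_lipschitzWith_c : ∃ M : NNReal, LipschitzWith M γ.c := by
  obtain ⟨M, hM⟩ := γ.exists_bound_c1
  refine ⟨M, lipschitzWith_of_nnnorm_deriv_le (fun s => (γ.hasDerivAt_c s).differentiableAt)
    fun s => ?_⟩
  rw [(γ.hasDerivAt_c s).deriv]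
  exact hM s

lemma hausdorffMeasure_range_lt_top : μH[1] (Set.range γ.c) < ⊤ := by
  obtain ⟨M, hM⟩ := γ.exists_lipschitzWith_c
  rw [γ.range_c_eq]
  refine (hM.hausdorffMeasure_image_le zero_le_one _).trans_lt ?_
  rw [hausdorffMeasure_real]
  simp

/-- The length of a curve is at most the Hausdorff measure of its range. -/
lemma len_le : γ.len ≤ (μH[1] (Set.range γ.c)).toReal := by
  obtain ⟨M, hM⟩ := γ.exists_bound_c2
  have hM0 : 0 ≤ M := (norm_nonneg _).trans (hM 0)
  have key : ∀ n : ℕ, γ.len ≤ (μH[1] (Set.range γ.c)).toReal + 2 * M * (1 / ((n : ℝ) + 1)) := by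
    intro n
    have hn : (0 : ℝ) < n + 1 := by positivity
    set p : ℕ → ℝ := fun j => j / ((n : ℝ) + 1) with hp
    have hp1 : ∀ j, p (j + 1) - p j = 1 / ((n : ℝ) + 1) := fun j => by
      simp only [hp]; push_cast; ring
    have hpm : Monotone p := fun i j hij => by simp only [hp]; gcongr
    have hle : ∀ j, p j ≤ p (j + 1) := fun j => hpm (Nat.le_succ j)
    have hlast : p (n + 1) = 1 := by simp only [hp]; push_cast; exact div_self hn.ne'
    have h0 : p 0 = 0 := by simp [hp]
    have hsum : ∑ j ∈ Finset.range (n + 1), ∫ s in p j..p (j + 1), ‖γ.c1 s‖ = γ.len := by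
      rw [intervalIntegral.sum_integral_adjacent_intervals fun k _ =>
        γ.continuous_c1.norm.intervalIntegrable _ _, h0, hlast, len]
    have hsub : ∀ j ∈ Finset.range (n + 1), Set.Ico (p j) (p (j + 1)) ⊆ Set.Ico 0 1 := by
      intro j hj s hs
      rw [Finset.mem_range] at hj
      exact ⟨(h0 ▸ hpm (Nat.zero_le j)).trans hs.1, hs.2.trans_le (hlast ▸ hpm hj)⟩
    have hdisj : ((Finset.range (n + 1) : Finset ℕ) : Set ℕ).PairwiseDisjoint
        fun j => γ.c '' Set.Ico (p j) (p (j + 1)) := by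
      intro i hi j hj hij
      refine Set.disjoint_left.2 ?_
      rintro _ ⟨s, hs, rfl⟩ ⟨t, ht, hst⟩
      have hts := γ.injOn (hsub j hj ht) (hsub i hi hs) hst
      have hd := hpm.pairwise_disjoint_on_Ico_succ hij
      exact Set.disjoint_left.1 hd hs (hts ▸ ht)
    have hmeas : ∀ j ∈ Finset.range (n + 1), MeasurableSet (γ.c '' Set.Ico (p j) (p (j + 1))) :=
      fun j hj => measurableSet_Ico.image_of_continuousOn_injOn γ.continuous_c.continuousOn
        (γ.injOn.mono (hsub j hj))
    have hH : ∑ j ∈ Finset.range (n + 1), ENNReal.ofReal ‖γ.c (p (j + 1)) - γ.c (p j)‖ ≤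
        μH[1] (Set.range γ.c) := by
      refine (Finset.sum_le_sum fun j _ =>
        ofReal_norm_sub_le_hausdorffMeasure_image γ.continuous_c (hle j)).trans ?_
      rw [← measure_biUnion_finset hdisj hmeas]
      exact measure_mono (Set.iUnion₂_subset fun j _ => Set.image_subset_range _ _)
    rw [← ENNReal.ofReal_sum_of_nonneg fun _ _ => norm_nonneg _] at hH
    have hH' := (ENNReal.ofReal_le_iff_le_toReal γ.hausdorffMeasure_range_lt_top.ne).1 hH
    rw [← hsum]
    calc ∑ j ∈ Finset.range (n + 1), ∫ s in p j..p (j + 1), ‖γ.c1 s‖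
        ≤ ∑ j ∈ Finset.range (n + 1), (‖γ.c (p (j + 1)) - γ.c (p j)‖
            + 2 * M * (1 / ((n : ℝ) + 1)) ^ 2) := Finset.sum_le_sum fun j _ => by
          rw [← hp1 j]; exact γ.integral_norm_c1_le hM (hle j)
      _ = ∑ j ∈ Finset.range (n + 1), ‖γ.c (p (j + 1)) - γ.c (p j)‖
            + 2 * M * (1 / ((n : ℝ) + 1)) := by
          rw [Finset.sum_add_distrib, Finset.sum_const, Finset.card_range, nsmul_eq_mul]
          push_cast
          field_simp
      _ ≤ _ := by linarith
  have hlim : Tendsto (fun n : ℕ => (μH[1] (Set.range γ.c)).toReal +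
      2 * M * (1 / ((n : ℝ) + 1))) atTop (𝓝 ((μH[1] (Set.range γ.c)).toReal + 2 * M * 0)) :=
    (tendsto_one_div_add_atTop_nhds_zero_nat.const_mul _).const_add _
  rw [mul_zero, add_zero] at hlim
  exact ge_of_tendsto' hlim key

end PlaneLoop

lemma sq_le_integral_of_lipschitz {g : ℝ → ℝ} {K : NNReal} (hg : LipschitzWith K g) {η : ℝ}
    (hη : 0 < η) :
    IntervalIntegrable (fun r => 2 / η * g r ^ 2 + η * deriv g r ^ 2) volume 0 η ∧
    g 0 ^ 2 ≤ ∫ r in (0:ℝ)..η, (2 / η * g r ^ 2 + η * deriv g r ^ 2) := by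
  have hgc := hg.continuous
  have hAC : ∀ r, AbsolutelyContinuousOnInterval g 0 r := fun r =>
    (hg.lipschitzOnWith (s := Set.uIcc 0 r)).absolutelyContinuousOnInterval
  have hdb : ∀ r, ‖deriv g r‖ ≤ K := fun r => norm_deriv_le_of_lipschitz hg
  have hdi : ∀ r, IntervalIntegrable (deriv g) volume 0 r := fun r =>
    (hAC r).intervalIntegrable_deriv
  have hd2 : ∀ r, IntervalIntegrable (fun r => deriv g r ^ 2) volume 0 r := fun r => by
    simp_rw [sq]
    exact ⟨(hdi r).1.mul_bdd (c := K) (measurable_deriv g).aestronglyMeasurable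
      (Eventually.of_forall hdb), (hdi r).2.mul_bdd (c := K)
      (measurable_deriv g).aestronglyMeasurable (Eventually.of_forall hdb)⟩
  have hgd : ∀ r, IntervalIntegrable (fun r => deriv g r * g r) volume 0 r := fun r =>
    (hdi r).mul_continuousOn hgc.continuousOn
  have hg2 : ∀ a b, IntervalIntegrable (fun r => g r ^ 2) volume a b := fun a b =>
    (hgc.pow 2).intervalIntegrable _ _
  set φ : ℝ → ℝ := fun r => 1 / η * g r ^ 2 + η * deriv g r ^ 2 with hφ
  have hφi : ∀ r, IntervalIntegrable φ volume 0 r := fun r =>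
    ((hg2 0 r).const_mul _).add ((hd2 r).const_mul _)
  have h1 : ∀ r ∈ Set.Icc 0 η, g 0 ^ 2 ≤ g r ^ 2 + ∫ x in (0:ℝ)..η, φ x := by
    intro r hr
    have h2 := (hAC r).integral_deriv_mul_eq_sub (hAC r)
    have h3 : ∫ x in (0:ℝ)..r, -(deriv g x * g x + g x * deriv g x) ≤ ∫ x in (0:ℝ)..r, φ x := by
      refine intervalIntegral.integral_mono_on hr.1 ?_ (hφi r) fun x _ => ?_
      · refine ((hgd r).add ?_).neg
        simpa [mul_comm] using hgd r
      · have e : φ x - -(deriv g x * g x + g x * deriv g x) =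
            (1 / η) * (g x + η * deriv g x) ^ 2 := by
          simp only [hφ]; field_simp; ring
        have : 0 ≤ (1 / η) * (g x + η * deriv g x) ^ 2 := by positivity
        linarith
    have h4 : ∫ x in (0:ℝ)..r, φ x ≤ ∫ x in (0:ℝ)..η, φ x := by
      refine intervalIntegral.integral_mono_interval le_rfl hr.1 hr.2 ?_ (hφi η)
      refine Eventually.of_forall fun x => ?_
      simp only [hφ, Pi.zero_apply]
      positivity
    rw [intervalIntegral.integral_neg, h2] at h3
    nlinarith
  refine ⟨((hg2 0 η).const_mul _).add ((hd2 η).const_mul _), ?_⟩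
  have h5 : ∫ _ in (0:ℝ)..η, g 0 ^ 2 ≤ ∫ r in (0:ℝ)..η, (g r ^ 2 + ∫ x in (0:ℝ)..η, φ x) :=
    intervalIntegral.integral_mono_on hη.le (by simp) ((hg2 0 η).add (by simp)) h1
  rw [intervalIntegral.integral_add (hg2 0 η) (by simp), intervalIntegral.integral_const,
    intervalIntegral.integral_const, smul_eq_mul, smul_eq_mul, sub_zero, hφ,
    intervalIntegral.integral_add ((hg2 0 η).const_mul _) ((hd2 η).const_mul _),
    intervalIntegral.integral_const_mul, intervalIntegral.integral_const_mul] at h5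
  rw [intervalIntegral.integral_add ((hg2 0 η).const_mul _) ((hd2 η).const_mul _),
    intervalIntegral.integral_const_mul, intervalIntegral.integral_const_mul]
  refine le_of_mul_le_mul_left (h5.trans_eq ?_) hη
  field_simp
  ring

lemma ofReal_sq_le_lintegral_of_lipschitz {g : ℝ → ℝ} {K : NNReal} (hg : LipschitzWith K g)
    {η : ℝ} (hη : 0 < η) {f : ℝ → ENNReal}
    (hf : ∀ r ∈ Set.Ioo 0 η, DifferentiableAt ℝ g r → ENNReal.ofReal (deriv g r ^ 2) ≤ f r) :
    ENNReal.ofReal (g 0 ^ 2) ≤ ∫⁻ r in Set.Ioo 0 η,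
      (ENNReal.ofReal (2 / η) * ENNReal.ofReal (g r ^ 2) + ENNReal.ofReal η * f r) := by
  obtain ⟨hi, hle⟩ := sq_le_integral_of_lipschitz hg hη
  refine (ENNReal.ofReal_le_ofReal hle).trans ?_
  rw [intervalIntegral.integral_of_le hη.le, integral_Ioc_eq_integral_Ioo,
    ofReal_integral_eq_lintegral_ofReal]
  · refine setLIntegral_mono_ae' measurableSet_Ioo ?_
    filter_upwards [hg.ae_differentiableAt] with r hr hrm
    rw [ENNReal.ofReal_add (by positivity) (by positivity), ENNReal.ofReal_mul (by positivity),
      ENNReal.ofReal_mul hη.le]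
    gcongr
    exact hf r hrm hr
  · exact ((intervalIntegrable_iff_integrableOn_Ioc_of_le hη.le).1 hi).mono_set
      Set.Ioo_subset_Ioc_self
  · refine Eventually.of_forall fun r => ?_
    simp only [Pi.zero_apply]
    positivity

lemma ofReal_sq_le_lintegral_of_lipschitz_neg {g : ℝ → ℝ} {K : NNReal} (hg : LipschitzWith K g)
    {η : ℝ} (hη : 0 < η) {f : ℝ → ENNReal}
    (hf : ∀ r ∈ Set.Ioo (-η) 0, DifferentiableAt ℝ g r → ENNReal.ofReal (deriv g r ^ 2) ≤ f r) :
    ENNReal.ofReal (g 0 ^ 2) ≤ ∫⁻ r in Set.Ioo (-η) 0,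
      (ENNReal.ofReal (2 / η) * ENNReal.ofReal (g r ^ 2) + ENNReal.ofReal η * f r) := by
  have hg' : LipschitzWith (K * 1) (fun r => g (-r)) := hg.comp (LipschitzWith.id.neg)
  have h := ofReal_sq_le_lintegral_of_lipschitz hg' hη (f := fun r => f (-r)) ?_
  · simp only [neg_zero] at h
    refine h.trans_eq ?_
    rw [← (Measure.measurePreserving_neg (volume : Measure ℝ)).setLIntegral_comp_preimage_emb
      (MeasurableEquiv.neg ℝ).measurableEmbedding]
    simp
  · intro r hr hd
    have h_der : DifferentiableAt ℝ g (-r) := by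
      have := DifferentiableAt.comp (g := fun r => g (-r)) (f := fun r : ℝ => -r) (-r)
        (by simpa using hd) differentiable_neg.differentiableAt
      simpa [Function.comp_def] using this
    rw [deriv_comp_neg, neg_sq]
    exact hf (-r) ⟨by linarith [hr.2], by linarith [hr.1]⟩ h_der

/-- The boundary piece `E` satisfies a trace inequality for Lipschitz functions on `Ω`, with an
arbitrarily small constant in front of the Dirichlet integral. -/
def TraceLe (Ω E : Set ℂ) : Prop :=
  ∀ ε : ℝ, 0 < ε → ∃ C : ℝ, 0 ≤ C ∧ ∀ (u : ℂ → ℝ) (K : NNReal), LipschitzWith K u →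
    ∫⁻ x in E, ENNReal.ofReal (u x ^ 2) ∂μH[1] ≤
      ENNReal.ofReal ε * (∫⁻ x in Ω, ENNReal.ofReal (‖fderiv ℝ u x‖ ^ 2)) +
      ENNReal.ofReal C * ∫⁻ x in Ω, ENNReal.ofReal (u x ^ 2)

lemma traceLe_empty (Ω : Set ℂ) : TraceLe Ω ∅ := fun _ _ => ⟨0, le_rfl, fun u K _ => by simp⟩

lemma TraceLe.mono {Ω E F : Set ℂ} (h : TraceLe Ω F) (hEF : E ⊆ F) : TraceLe Ω E := fun ε hε => by
  obtain ⟨C, hC, h⟩ := h ε hε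
  exact ⟨C, hC, fun u K hu => (lintegral_mono_set hEF).trans (h u K hu)⟩

lemma TraceLe.union {Ω E F : Set ℂ} (hE : TraceLe Ω E) (hF : TraceLe Ω F) :
    TraceLe Ω (E ∪ F) := fun ε hε => by
  obtain ⟨C, hC, h⟩ := hE (ε / 2) (by positivity)
  obtain ⟨C', hC', h'⟩ := hF (ε / 2) (by positivity)
  refine ⟨C + C', by positivity, fun u K hu => (lintegral_union_le _ _ _).trans
    ((add_le_add (h u K hu) (h' u K hu)).trans_eq ?_)⟩
  rw [ENNReal.ofReal_add hC hC']
  have e : ENNReal.ofReal ε = ENNReal.ofReal (ε / 2) + ENNReal.ofReal (ε / 2) := by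
    rw [← ENNReal.ofReal_add (by positivity) (by positivity), add_halves]
  rw [e]
  ring

namespace PlaneLoop
variable {γ : PlaneLoop} {Ω : Set ℂ}

lemma lintegral_lintegral_tube_le {J S : Set ℝ} (hJ : MeasurableSet J) (hS : MeasurableSet S)
    {κ : ℝ} (hκ : 0 < κ) (hinj : Set.InjOn γ.tube (J ×ℂ S))
    (hdet : ∀ z ∈ J ×ℂ S, κ ≤ (γ.tubed z).det) (hsub : γ.tube '' (J ×ℂ S) ⊆ Ω)
    {f : ℂ → ENNReal} (hf : Measurable f) :
    ∫⁻ t in J, ∫⁻ r in S, f (γ.c t + r * γ.nor t) ≤ ENNReal.ofReal (1 / κ) * ∫⁻ x in Ω, f x := by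
  have hQ : MeasurableSet (J ×ℂ S) :=
    (Complex.measurable_re hJ).inter (Complex.measurable_im hS)
  have h1 := lintegral_image_eq_lintegral_abs_det_fderiv_mul volume hQ
    (fun z _ => (γ.hasFDerivAt_tube z).hasFDerivWithinAt) hinj f
  have h2 : ENNReal.ofReal κ * ∫⁻ z in J ×ℂ S, f (γ.tube z) ≤ ∫⁻ x in Ω, f x := by
    refine le_trans ?_ (lintegral_mono_set hsub)
    rw [h1, ← lintegral_const_mul _ (show Measurable fun z => f (γ.tube z) from
      hf.comp γ.continuous_tube.measurable)]
    refine setLIntegral_mono' hQ fun z hz => ?_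
    gcongr
    exact (hdet z hz).trans (le_abs_self _)
  have h3 : ∫⁻ t in J, ∫⁻ r in S, f (γ.c t + r * γ.nor t) = ∫⁻ z in J ×ℂ S, f (γ.tube z) := by
    have e : (J ×ℂ S) = Complex.measurableEquivRealProd ⁻¹' (J ×ˢ S) := rfl
    have := Complex.volume_preserving_equiv_real_prod.setLIntegral_comp_preimage_emb
      Complex.measurableEquivRealProd.measurableEmbedding
      (fun p : ℝ × ℝ => f (γ.c p.1 + p.2 * γ.nor p.1)) (J ×ˢ S)
    rw [← e] at this
    change ∫⁻ z in J ×ℂ S, f (γ.tube z) = _ at this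
    rw [this, Measure.volume_eq_prod, setLIntegral_prod]
    refine Measurable.aemeasurable (hf.comp ?_)
    have h1 := γ.continuous_c; have h2 := γ.continuous_nor
    exact Continuous.measurable (by fun_prop)
  rw [h3]
  calc ∫⁻ z in J ×ℂ S, f (γ.tube z)
      = ENNReal.ofReal (1 / κ) * (ENNReal.ofReal κ * ∫⁻ z in J ×ℂ S, f (γ.tube z)) := by
        rw [← mul_assoc, ← ENNReal.ofReal_mul (by positivity), one_div_mul_cancel hκ.ne']
        simp
    _ ≤ _ := by gcongr

lemma lintegral_image_c_le {M : NNReal} (hM : LipschitzWith M γ.c) (J : Set ℝ)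
    {f : ℂ → ENNReal} (hf : Measurable f) :
    ∫⁻ x in γ.c '' J, f x ∂μH[1] ≤ M * ∫⁻ t in J, f (γ.c t) := by
  have hc := γ.continuous_c.measurable
  have h1 : (μH[1]).restrict (γ.c '' J) ≤ (M : ENNReal) • (volume.restrict J).map γ.c := by
    refine Measure.le_iff.2 fun A hA => ?_
    rw [Measure.restrict_apply hA, Measure.smul_apply, Measure.map_apply hc hA,
      Measure.restrict_apply (hc hA), smul_eq_mul, Set.inter_comm, ← Set.image_inter_preimage,
      Set.inter_comm]
    have := hM.hausdorffMeasure_image_le zero_le_one (γ.c ⁻¹' A ∩ J)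
    rwa [hausdorffMeasure_real, ENNReal.rpow_one] at this
  refine (lintegral_mono' h1 le_rfl).trans_eq ?_
  rw [lintegral_smul_measure, lintegral_map hf hc, smul_eq_mul]

lemma ofReal_sq_le_lintegral_normal {η : ℝ} (hη : 0 < η) {S : Set ℝ}
    (hS : S = Set.Ioo 0 η ∨ S = Set.Ioo (-η) 0) {u : ℂ → ℝ} {K : NNReal} (hu : LipschitzWith K u)
    {f : ℂ → ENNReal}
    (hf : ∀ x, DifferentiableAt ℝ u x → ENNReal.ofReal (‖fderiv ℝ u x‖ ^ 2) ≤ f x)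
    (hf' : ∀ x, ¬ DifferentiableAt ℝ u x → f x = ⊤) (t : ℝ) :
    ENNReal.ofReal (u (γ.c t) ^ 2) ≤ ∫⁻ r in S,
      (ENNReal.ofReal (2 / η) * ENNReal.ofReal (u (γ.c t + r * γ.nor t) ^ 2) +
        ENNReal.ofReal η * f (γ.c t + r * γ.nor t)) := by
  set g : ℝ → ℝ := fun r => u (γ.c t + r * γ.nor t) with hg
  have hgL : LipschitzWith (K * 1) g := by
    refine hu.comp (LipschitzWith.of_dist_le_mul fun a b => ?_)
    rw [dist_eq_norm, add_sub_add_left_eq_sub, ← sub_mul, norm_mul, γ.norm_nor,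
      ← Complex.ofReal_sub, Complex.norm_real, Real.dist_eq]
    simp
  have hd : ∀ r, ENNReal.ofReal (deriv g r ^ 2) ≤ f (γ.c t + r * γ.nor t) := by
    intro r
    by_cases hx : DifferentiableAt ℝ u (γ.c t + r * γ.nor t)
    · refine le_trans (ENNReal.ofReal_le_ofReal ?_) (hf _ hx)
      have h1 : HasDerivAt (fun r : ℝ => γ.c t + r * γ.nor t) (γ.nor t) r := by
        simpa using ((hasDerivAt_id r).ofReal_comp.mul_const (γ.nor t)).const_add (γ.c t)
      have h2 := hx.hasFDerivAt.comp_hasDerivAt r h1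
      have h3 : deriv g r = fderiv ℝ u (γ.c t + r * γ.nor t) (γ.nor t) := h2.deriv
      rw [h3, ← sq_abs]
      gcongr
      have := (fderiv ℝ u (γ.c t + r * γ.nor t)).le_opNorm (γ.nor t)
      rwa [γ.norm_nor, mul_one] at this
    · rw [hf' _ hx]; exact le_top
  have h0 : g 0 = u (γ.c t) := by simp [hg]
  rw [← h0]
  rcases hS with rfl | rfl
  · exact ofReal_sq_le_lintegral_of_lipschitz hgL hη
      (f := fun r => f (γ.c t + r * γ.nor t)) fun r _ _ => hd r
  · exact ofReal_sq_le_lintegral_of_lipschitz_neg hgL hη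
      (f := fun r => f (γ.c t + r * γ.nor t)) fun r _ _ => hd r

lemma traceLe_of_side {s δ : ℝ} (hδ : 0 < δ) (hinj : Set.InjOn γ.tube (box s δ))
    (hdet : ∀ z ∈ box s δ, ‖γ.c1 s‖ / 2 ≤ (γ.tubed z).det) {σ : ℝ} (hσ : σ = 1 ∨ σ = -1)
    (hsub : γ.tube '' halfBox s δ σ ⊆ Ω) : TraceLe Ω (γ.c '' Set.Ioo (s - δ) (s + δ)) := by
  intro ε hε
  obtain ⟨M, hM⟩ := γ.exists_lipschitzWith_c
  have hκ : 0 < ‖γ.c1 s‖ / 2 := by have := norm_pos_iff.2 (γ.c1_ne_zero s); positivity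
  set κ := ‖γ.c1 s‖ / 2 with hκd
  set B : ℝ := M * (1 / κ) with hB
  have hB0 : 0 ≤ B := by positivity
  obtain ⟨η, hη0, hη⟩ := exists_between (show (0:ℝ) < min δ (ε / (B + 1)) by positivity)
  rw [lt_min_iff, lt_div_iff₀ (by positivity)] at hη
  obtain ⟨S, hS, hSδ, hSσ⟩ : ∃ S : Set ℝ, (S = Set.Ioo 0 η ∨ S = Set.Ioo (-η) 0) ∧
      S ⊆ Set.Ioo (-δ) δ ∧ ∀ r ∈ S, 0 < σ * r := by
    rcases hσ with rfl | rfl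
    · exact ⟨_, Or.inl rfl, Set.Ioo_subset_Ioo (by linarith) hη.1.le, fun r hr => by
        linarith [hr.1]⟩
    · exact ⟨_, Or.inr rfl, Set.Ioo_subset_Ioo (by linarith) (by linarith), fun r hr => by
        linarith [hr.2]⟩
  have hSm : MeasurableSet S := by rcases hS with rfl | rfl <;> exact measurableSet_Ioo
  set J := Set.Ioo (s - δ) (s + δ) with hJ
  have hQ : J ×ℂ S ⊆ halfBox s δ σ := fun z hz => ⟨⟨hz.1, hSδ hz.2⟩, hSσ _ hz.2⟩
  refine ⟨B * (2 / η), by positivity, fun u K hu => ?_⟩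
  have hum := hu.continuous.measurable
  have hDm : MeasurableSet {x | DifferentiableAt ℝ u x} := measurableSet_of_differentiableAt ℝ u
  classical
  set f : ℂ → ENNReal := fun x => if DifferentiableAt ℝ u x then
    ENNReal.ofReal (‖fderiv ℝ u x‖ ^ 2) else ⊤ with hf
  have hfm : Measurable f := Measurable.ite hDm
    ((measurable_fderiv ℝ u).norm.pow_const 2).ennreal_ofReal measurable_const
  have hfae : ∫⁻ x in Ω, f x = ∫⁻ x in Ω, ENNReal.ofReal (‖fderiv ℝ u x‖ ^ 2) := by
    refine lintegral_congr_ae (ae_restrict_of_ae ?_)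
    filter_upwards [hu.ae_differentiableAt] with x hx
    simp only [hf, if_pos hx]
  have h2m : Measurable fun x => ENNReal.ofReal (u x ^ 2) := (hum.pow_const 2).ennreal_ofReal
  set F : ℂ → ENNReal := fun x => ENNReal.ofReal (2 / η) * ENNReal.ofReal (u x ^ 2) +
    ENNReal.ofReal η * f x with hF
  have hFm : Measurable F := (h2m.const_mul _).add (hfm.const_mul _)
  calc ∫⁻ x in γ.c '' J, ENNReal.ofReal (u x ^ 2) ∂μH[1]
      ≤ M * ∫⁻ t in J, ENNReal.ofReal (u (γ.c t) ^ 2) :=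
        lintegral_image_c_le hM J h2m
    _ ≤ M * ∫⁻ t in J, ∫⁻ r in S, F (γ.c t + r * γ.nor t) := by
        gcongr with t
        exact ofReal_sq_le_lintegral_normal hη0 hS hu (fun x hx => by simp only [hf, if_pos hx, le_rfl])
          (fun x hx => by simp only [hf, if_neg hx]) t
    _ ≤ M * (ENNReal.ofReal (1 / κ) * ∫⁻ x in Ω, F x) := by
        gcongr
        exact lintegral_lintegral_tube_le measurableSet_Ioo hSm hκ
          (hinj.mono fun z hz => (hQ hz).1) (fun z hz => hdet z (hQ hz).1)
          ((Set.image_mono hQ).trans hsub) hFm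
    _ = ENNReal.ofReal B * ∫⁻ x in Ω, F x := by
        rw [← mul_assoc, hB, ENNReal.ofReal_mul M.coe_nonneg, ENNReal.ofReal_coe_nnreal]
    _ = ENNReal.ofReal (B * η) * (∫⁻ x in Ω, ENNReal.ofReal (‖fderiv ℝ u x‖ ^ 2)) +
          ENNReal.ofReal (B * (2 / η)) * ∫⁻ x in Ω, ENNReal.ofReal (u x ^ 2) := by
        rw [hF, lintegral_add_left (h2m.const_mul _), lintegral_const_mul _ h2m,
          lintegral_const_mul _ hfm, hfae, ENNReal.ofReal_mul hB0, ENNReal.ofReal_mul hB0]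
        ring
    _ ≤ _ := by
        gcongr
        nlinarith

lemma IsBdry.traceLe_range (h : γ.IsBdry Ω) (hO : IsOpen Ω) : TraceLe Ω (Set.range γ.c) := by
  rw [γ.range_c_eq]
  refine isCompact_Icc.induction_on (p := fun S => TraceLe Ω (γ.c '' S)) ?_ ?_ ?_ ?_
  · rw [Set.image_empty]; exact traceLe_empty Ω
  · exact fun S T hST hT => hT.mono (Set.image_mono hST)
  · intro S T hS hT
    rw [Set.image_union]; exact hS.union hT
  · intro s _
    obtain ⟨δ, hδ, h1, -, -, h4, -, h6⟩ := h.exists_tube_side hO s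
    refine ⟨_, mem_nhdsWithin_of_mem_nhds (Ioo_mem_nhds (by linarith : s - δ < s)
      (by linarith : s < s + δ)), ?_⟩
    rcases h6 with h6 | h6
    · exact traceLe_of_side hδ h1 h4 (Or.inl rfl) h6
    · exact traceLe_of_side hδ h1 h4 (Or.inr rfl) h6

end PlaneLoop

lemma fderiv_eq_of_eqOn {u v : ℂ → ℝ} {Ω : Set ℂ} (hO : IsOpen Ω) (h : Set.EqOn u v (closure Ω))
    {x : ℂ} (hx : x ∈ Ω) : fderiv ℝ u x = fderiv ℝ v x :=
  Filter.EventuallyEq.fderiv_eq (by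
    filter_upwards [hO.mem_nhds hx] with y hy using h (subset_closure hy))

lemma integrableOn_sq_norm_fderiv {v : ℂ → ℝ} {K : NNReal} (hv : LipschitzWith K v) {Ω : Set ℂ}
    (hB : Bornology.IsBounded Ω) : IntegrableOn (fun x => ‖fderiv ℝ v x‖ ^ 2) Ω := by
  refine Measure.integrableOn_of_bounded hB.measure_lt_top.ne (M := (K : ℝ) ^ 2)
    ((measurable_fderiv ℝ v).norm.pow_const 2).aestronglyMeasurable (ae_of_all _ fun x => ?_)
  rw [norm_pow, norm_norm]
  exact pow_le_pow_left₀ (norm_nonneg _) (norm_fderiv_le_of_lipschitz ℝ hv) 2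

lemma integrableOn_sq_of_lipschitzWith {v : ℂ → ℝ} {K : NNReal} (hv : LipschitzWith K v)
    {Ω : Set ℂ} (hB : Bornology.IsBounded Ω) : IntegrableOn (fun x => v x ^ 2) Ω :=
  ((hv.continuous.pow 2).continuousOn.integrableOn_compact hB.isCompact_closure).mono_set
    subset_closure

lemma TraceLe.exists_const {Ω : Set ℂ} (h : TraceLe Ω (frontier Ω)) (hO : IsOpen Ω)
    (hB : Bornology.IsBounded Ω) {β : ℝ} (hβ : 0 ≤ β) :
    ∃ C : ℝ, ∀ (u : ℂ → ℝ) (K : NNReal), LipschitzOnWith K u (closure Ω) →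
      β * ∫ x in frontier Ω, u x ^ 2 ∂μH[1] ≤
        (∫ x in Ω, ‖fderiv ℝ u x‖ ^ 2) + C * ∫ x in Ω, u x ^ 2 := by
  obtain ⟨C, hC, hT⟩ := h (1 / (β + 1)) (by positivity)
  refine ⟨β * C, fun u K hu => ?_⟩
  obtain ⟨v, hv, huv⟩ := hu.extend_real
  have e1 : ∫ x in frontier Ω, u x ^ 2 ∂μH[1] = ∫ x in frontier Ω, v x ^ 2 ∂μH[1] :=
    setIntegral_congr_fun isClosed_frontier.measurableSet
      fun x hx => by simp only [huv (frontier_subset_closure hx)]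
  have e2 : ∫ x in Ω, u x ^ 2 = ∫ x in Ω, v x ^ 2 :=
    setIntegral_congr_fun hO.measurableSet fun x hx => by simp only [huv (subset_closure hx)]
  have e3 : ∫ x in Ω, ‖fderiv ℝ u x‖ ^ 2 = ∫ x in Ω, ‖fderiv ℝ v x‖ ^ 2 :=
    setIntegral_congr_fun hO.measurableSet fun x hx => by simp only [fderiv_eq_of_eqOn hO huv hx]
  rw [e1, e2, e3]
  have hD0 : 0 ≤ ∫ x in Ω, ‖fderiv ℝ v x‖ ^ 2 := integral_nonneg fun x => sq_nonneg _
  have hM0 : 0 ≤ ∫ x in Ω, v x ^ 2 := integral_nonneg fun x => sq_nonneg _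
  have key : ∫ x in frontier Ω, v x ^ 2 ∂μH[1] ≤
      1 / (β + 1) * (∫ x in Ω, ‖fderiv ℝ v x‖ ^ 2) + C * ∫ x in Ω, v x ^ 2 := by
    have hTv := hT v K hv
    rw [← ofReal_integral_eq_lintegral_ofReal (integrableOn_sq_norm_fderiv hv hB)
        (ae_of_all _ fun x => sq_nonneg _),
      ← ofReal_integral_eq_lintegral_ofReal (integrableOn_sq_of_lipschitzWith hv hB)
        (ae_of_all _ fun x => sq_nonneg _),
      ← ENNReal.ofReal_mul (by positivity), ← ENNReal.ofReal_mul hC,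
      ← ENNReal.ofReal_add (by positivity) (by positivity)] at hTv
    rw [integral_eq_lintegral_of_nonneg_ae (ae_of_all _ fun x => sq_nonneg _)
      (hv.continuous.pow 2).aestronglyMeasurable]
    exact ENNReal.toReal_le_of_le_ofReal (by positivity) hTv
  have h1 : β * (1 / (β + 1)) ≤ 1 := by
    rw [mul_one_div, div_le_one (by positivity)]; linarith
  calc _ ≤ β * (1 / (β + 1) * (∫ x in Ω, ‖fderiv ℝ v x‖ ^ 2) + C * ∫ x in Ω, v x ^ 2) := by gcongr
    _ = (β * (1 / (β + 1))) * (∫ x in Ω, ‖fderiv ℝ v x‖ ^ 2) + β * C * ∫ x in Ω, v x ^ 2 := by ring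
    _ ≤ _ := by
      have := mul_le_mul_of_nonneg_right h1 hD0
      linarith

lemma lintegral_two_pi_mul {ρ b : ℝ} (hρ : 0 ≤ ρ) (hρb : ρ ≤ b) :
    ∫⁻ r in Set.Ioc ρ b, ENNReal.ofReal (2 * π * r) = ENNReal.ofReal (π * (b ^ 2 - ρ ^ 2)) := by
  rw [← ofReal_integral_eq_lintegral_ofReal, ← intervalIntegral.integral_of_le hρb]
  · congr 1
    rw [intervalIntegral.integral_const_mul, integral_id]; ring
  · exact (Continuous.integrableOn_Icc (by fun_prop)).mono_set Set.Ioc_subset_Icc_self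
  · filter_upwards [ae_restrict_mem measurableSet_Ioc] with r hr
    have : 0 ≤ r := hρ.trans hr.1.le
    show 0 ≤ 2 * π * r
    positivity

/-- If the superlevel sets of `p` on `Ω` are no larger than those of the radius on the annulus with
radii `a < b`, then the same comparison holds for integrals of monotone functions. -/
lemma lintegral_comp_le {Ω : Set ℂ} {p : ℂ → ℝ} (hp : Measurable p)
    {a b : ℝ} (ha : 0 ≤ a) (hab : a < b) (hpb : ∀ x, p x ≤ b)
    (hv : volume Ω ≤ ENNReal.ofReal (π * (b ^ 2 - a ^ 2)))
    (hv' : ∀ ρ ∈ Set.Ico a b,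
      volume {x ∈ Ω | ρ < p x} ≤ ENNReal.ofReal (π * (b ^ 2 - ρ ^ 2)))
    {Q : ℝ → ℝ} (hQ : Continuous Q) (hm : Monotone Q) (h0 : ∀ r, 0 ≤ Q r) :
    ∫⁻ x in Ω, ENNReal.ofReal (Q (p x)) ≤
      ∫⁻ r in Set.Ioc a b, ENNReal.ofReal (2 * π * r) * ENNReal.ofReal (Q r) := by
  set μ₂ : Measure ℝ := (volume.restrict (Set.Ioc a b)).withDensity
    fun r => ENNReal.ofReal (2 * π * r) with hμ₂
  have hdm : Measurable fun r : ℝ => ENNReal.ofReal (2 * π * r) := by fun_prop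
  have e : ∫⁻ r in Set.Ioc a b, ENNReal.ofReal (2 * π * r) * ENNReal.ofReal (Q r) =
      ∫⁻ r, ENNReal.ofReal (Q r) ∂μ₂ := by
    rw [hμ₂, lintegral_withDensity_eq_lintegral_mul _ hdm hQ.measurable.ennreal_ofReal]
    rfl
  have hμS : ∀ ρ, a ≤ ρ → ρ ≤ b → ∀ S, MeasurableSet S → Set.Ioc ρ b ⊆ S →
      ENNReal.ofReal (π * (b ^ 2 - ρ ^ 2)) ≤ μ₂ S := by
    intro ρ haρ hρb S hS hsub
    rw [hμ₂, withDensity_apply _ hS, Measure.restrict_restrict hS,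
      ← lintegral_two_pi_mul (ha.trans haρ) hρb]
    exact lintegral_mono_set fun r hr => ⟨hsub hr, haρ.trans_lt hr.1, hr.2⟩
  rw [e, lintegral_eq_lintegral_meas_lt _ (ae_of_all _ fun x => h0 _)
      (hQ.measurable.comp hp).aemeasurable,
    lintegral_eq_lintegral_meas_lt _ (ae_of_all _ h0) hQ.measurable.aemeasurable]
  refine lintegral_mono fun t => ?_
  have hSo : IsOpen {r | t < Q r} := isOpen_lt continuous_const hQ
  have hTm : MeasurableSet {x | t < Q (p x)} := measurableSet_lt measurable_const
    (hQ.measurable.comp hp)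
  rw [Measure.restrict_apply hTm]
  by_cases hat : t < Q a
  · refine (measure_mono Set.inter_subset_right).trans (hv.trans ?_)
    exact hμS a le_rfl hab.le _ hSo.measurableSet fun r hr => hat.trans_le (hm hr.1.le)
  by_cases hbt : t < Q b
  · have hlow : ∀ r, t < Q r → a < r := fun r hr => by
      by_contra h
      exact hat (hr.trans_le (hm (not_lt.1 h)))
    have hbb : BddBelow {r | t < Q r} := ⟨a, fun r hr => (hlow r hr).le⟩
    set ρ := sInf {r | t < Q r} with hρ
    have haρ : a ≤ ρ := le_csInf ⟨b, hbt⟩ fun r hr => (hlow r hr).le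
    have hρS : ¬ t < Q ρ := fun h => by
      obtain ⟨ε, hε, hball⟩ := Metric.isOpen_iff.1 hSo ρ h
      have : ρ - ε / 2 ∈ {r | t < Q r} := hball (by
        rw [mem_ball, Real.dist_eq, abs_lt]; constructor <;> linarith)
      linarith [csInf_le hbb this]
    have hSeq : ∀ r, t < Q r ↔ ρ < r := fun r =>
      ⟨fun h => by
        by_contra h'
        exact hρS (h.trans_le (hm (not_lt.1 h'))),
       fun h => by
        obtain ⟨s, hs, hsr⟩ := exists_lt_of_csInf_lt ⟨b, hbt⟩ h
        exact lt_of_lt_of_le hs (hm hsr.le)⟩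
    have hρb : ρ < b := (hSeq b).1 hbt
    refine le_trans ?_ (hμS ρ haρ hρb.le _ hSo.measurableSet fun r hr => (hSeq r).2 hr.1)
    refine le_trans (measure_mono ?_) (hv' ρ ⟨haρ, hρb⟩)
    exact fun x hx => ⟨hx.2, (hSeq _).1 hx.1⟩
  · have : {x | t < Q (p x)} = ∅ := by
      ext x
      simpa using (hm (hpb x)).trans (not_lt.1 hbt)
    rw [this]; simp

lemma integral_comp_le {Ω : Set ℂ} {p : ℂ → ℝ} (hp : Measurable p)
    {a b : ℝ} (ha : 0 ≤ a) (hab : a < b) (hpI : ∀ x, p x ∈ Set.Icc a b)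
    (hv : volume Ω ≤ ENNReal.ofReal (π * (b ^ 2 - a ^ 2)))
    (hv' : ∀ ρ ∈ Set.Ico a b,
      volume {x ∈ Ω | ρ < p x} ≤ ENNReal.ofReal (π * (b ^ 2 - ρ ^ 2)))
    {Q : ℝ → ℝ} (hQ : ContinuousOn Q (Set.Icc a b)) (hm : MonotoneOn Q (Set.Icc a b))
    (h0 : ∀ r ∈ Set.Icc a b, 0 ≤ Q r) :
    ∫ x in Ω, Q (p x) ≤ 2 * π * ∫ r in a..b, Q r * r := by
  set R : ℝ → ℝ := Set.IccExtend hab.le (Set.domRestrict (Set.Icc a b) Q) with hR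
  have hRc : Continuous R := (continuousOn_iff_continuous_domRestrict.1 hQ).Icc_extend'
  have hRm : Monotone R := fun x y hxy =>
    hm (Set.projIcc a b hab.le x).2 (Set.projIcc a b hab.le y).2 (Set.monotone_projIcc _ hxy)
  have hR0 : ∀ r, 0 ≤ R r := fun r => h0 _ (Set.projIcc a b hab.le r).2
  have hRQ : ∀ r ∈ Set.Icc a b, R r = Q r := fun r hr => by
    rw [hR, Set.IccExtend_of_mem _ _ hr]; rfl
  have e1 : ∫ x in Ω, Q (p x) = ∫ x in Ω, R (p x) := by
    congr 1; ext x; exact (hRQ _ (hpI x)).symm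
  have e2 : ∫ r in a..b, Q r * r = ∫ r in a..b, R r * r := by
    refine intervalIntegral.integral_congr fun r hr => ?_
    rw [Set.uIcc_of_le hab.le] at hr
    simp only [hRQ r hr]
  have hnn : ∀ r ∈ Set.Ioc a b, 0 ≤ 2 * π * r := fun r hr => by
    have : 0 ≤ r := ha.trans hr.1.le
    positivity
  rw [e1, e2, integral_eq_lintegral_of_nonneg_ae (ae_of_all _ fun x => hR0 _)
    (hRc.measurable.comp hp).aestronglyMeasurable, intervalIntegral.integral_of_le hab.le,
    ← integral_const_mul]
  have hn : ∀ r ∈ Set.Ioc a b, 0 ≤ 2 * π * (R r * r) := fun r hr => by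
    have := mul_nonneg (hnn r hr) (hR0 r)
    linarith
  refine ENNReal.toReal_le_of_le_ofReal (setIntegral_nonneg measurableSet_Ioc hn)
    ((lintegral_comp_le hp ha hab (fun x => (hpI x).2) hv hv' hRc hRm hR0).trans_eq ?_)
  rw [ofReal_integral_eq_lintegral_ofReal]
  · refine setLIntegral_congr_fun measurableSet_Ioc fun r hr => ?_
    rw [← ENNReal.ofReal_mul (hnn r hr)]
    congr 1; ring
  · exact (Continuous.integrableOn_Icc (by fun_prop)).mono_set Set.Ioc_subset_Icc_self
  · filter_upwards [ae_restrict_mem measurableSet_Ioc] with r hr using hn r hr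

lemma sub_le_mul_of_monotone_deriv {a b : ℝ} {F H : ℝ → ℝ}
    (hFc : ContinuousOn F (Set.Icc a b)) (hF : ∀ r ∈ Set.Ioo a b, HasDerivAt F (H r) r)
    (hHm : MonotoneOn H (Set.Icc a b)) {x y : ℝ} (hx : x ∈ Set.Icc a b) (hy : y ∈ Set.Icc a b)
    (hxy : x ≤ y) : F y - F x ≤ H y * (y - x) := by
  rcases hxy.eq_or_lt with rfl | h
  · simp
  obtain ⟨c, hc, hcs⟩ := exists_hasDerivAt_eq_slope F H h
    (hFc.mono (Set.Icc_subset_Icc hx.1 hy.2))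
    fun r hr => hF r ⟨hx.1.trans_lt hr.1, hr.2.trans_le hy.2⟩
  have h1 : F y - F x = H c * (y - x) := by
    rw [hcs, div_mul_cancel₀]; linarith
  rw [h1]
  exact mul_le_mul_of_nonneg_right
    (hHm ⟨hx.1.trans hc.1.le, hc.2.le.trans hy.2⟩ hy hc.2.le) (by linarith)

lemma abs_sub_le_mul_of_monotone_deriv {a b : ℝ} {F H : ℝ → ℝ}
    (hFc : ContinuousOn F (Set.Icc a b)) (hF : ∀ r ∈ Set.Ioo a b, HasDerivAt F (H r) r)
    (hFm : MonotoneOn F (Set.Icc a b)) (hHm : MonotoneOn H (Set.Icc a b)) {x y C : ℝ}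
    (hx : x ∈ Set.Icc a b) (hy : y ∈ Set.Icc a b) (hxC : H x ≤ C) (hyC : H y ≤ C) :
    |F y - F x| ≤ C * |y - x| := by
  rcases le_total x y with h | h
  · rw [abs_of_nonneg (sub_nonneg.2 (hFm hx hy h)), abs_of_nonneg (sub_nonneg.2 h)]
    exact (sub_le_mul_of_monotone_deriv hFc hF hHm hx hy h).trans
      (mul_le_mul_of_nonneg_right hyC (sub_nonneg.2 h))
  · rw [abs_sub_comm, abs_sub_comm y, abs_of_nonneg (sub_nonneg.2 (hFm hy hx h)),
      abs_of_nonneg (sub_nonneg.2 h)]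
    exact (sub_le_mul_of_monotone_deriv hFc hF hHm hy hx h).trans
      (mul_le_mul_of_nonneg_right hxC (sub_nonneg.2 h))

/-- Transplanting the radial ground state of the annulus along the distance to the outer boundary
gives a test function on `Ω` whose Rayleigh quotient does not exceed the radial eigenvalue. -/
theorem exists_test_function {Ω Γ : Set ℂ} (hO : IsOpen Ω) (hB : Bornology.IsBounded Ω)
    (hne : Ω.Nonempty) (hΓ : IsClosed Γ) (hΓf : Γ ⊆ frontier Ω)
    (hfin : μH[1] (frontier Ω) < ⊤) {L β : ℝ} (hβ : 0 < β) (hL : L = (μH[1] Γ).toReal)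
    (hcollar : ∀ t, 0 < t → t ≤ L / (2 * π) →
      (volume {x ∈ Ω | infDist x Γ < t}).toReal ≤ L * t - π * t ^ 2)
    (hiso : 4 * π * (volume Ω).toReal ≤ L ^ 2) :
    ∃ (u : ℂ → ℝ) (K : NNReal), LipschitzWith K u ∧ 0 < ∫ x in Ω, u x ^ 2 ∧
      ((∫ x in Ω, ‖fderiv ℝ u x‖ ^ 2) - β * ∫ x in frontier Ω, u x ^ 2 ∂μH[1]) /
        (∫ x in Ω, u x ^ 2) ≤
      nrEig (-β) (√(L ^ 2 - 4 * π * (volume Ω).toReal) / (2 * π)) (L / (2 * π)) := by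
  have hπ := Real.pi_pos
  have hfinΩ : volume Ω < ⊤ := hB.measure_lt_top
  set A := (volume Ω).toReal with hA
  have hA0 : 0 < A := ENNReal.toReal_pos (hO.measure_pos _ hne).ne' hfinΩ.ne
  have hL0 : 0 ≤ L := hL ▸ ENNReal.toReal_nonneg
  set a := √(L ^ 2 - 4 * π * A) / (2 * π) with ha'
  set b := L / (2 * π) with hb'
  have hLb : L = 2 * π * b := by rw [hb']; field_simp
  have ha : 0 ≤ a := by positivity
  have hAab : A = π * (b ^ 2 - a ^ 2) := by
    rw [ha', hb', div_pow, div_pow, Real.sq_sqrt (by linarith)]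
    field_simp; ring
  have hb0 : 0 ≤ b := by positivity
  have hab : a < b := by
    have : 0 < b ^ 2 - a ^ 2 := by
      by_contra h
      nlinarith
    exact lt_of_pow_lt_pow_left₀ 2 hb0 (by linarith)
  obtain ⟨k, F, H, hk, hFc, hHc, hF, hH, hF1, hFm, hHm, hHa, hHb⟩ :=
    exists_radial_groundState ha hab hβ
  have hbI : b ∈ Set.Icc a b := ⟨hab.le, le_rfl⟩
  have haI : a ∈ Set.Icc a b := ⟨le_rfl, hab.le⟩
  have hH0 : ∀ r ∈ Set.Icc a b, 0 ≤ H r := fun r hr => hHa ▸ hHm haI hr hr.1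
  have hen := radial_energy_eq hab hFc hHc hF hH hHa hHb
  have hle := neg_le_nrEig ha hab hFc hHc hF hH hF1 hHa hHb
  set p : ℂ → ℝ := fun x => max a (b - infDist x Γ) with hp
  have hpc : Continuous p := continuous_const.max (continuous_const.sub (continuous_infDist_pt Γ))
  have hpI : ∀ x, p x ∈ Set.Icc a b := fun x =>
    ⟨le_max_left _ _, max_le hab.le (by linarith [infDist_nonneg (x := x) (s := Γ)])⟩
  have hp1 : ∀ x y, |p x - p y| ≤ ‖x - y‖ := fun x y => by
    have h1 : |p x - p y| ≤ |(b - infDist x Γ) - (b - infDist y Γ)| := by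
      simpa [hp] using abs_max_sub_max_le_max a (b - infDist x Γ) a (b - infDist y Γ)
    refine h1.trans ?_
    have h2 := (lipschitz_infDist_pt Γ).dist_le_mul x y
    rw [NNReal.coe_one, one_mul, Real.dist_eq, dist_eq_norm] at h2
    rwa [sub_sub_sub_cancel_left, abs_sub_comm]
  have hpΓ : ∀ x ∈ Γ, p x = b := fun x hx => by
    simp [hp, infDist_zero_of_mem hx, hab.le]
  set u : ℂ → ℝ := fun x => F (p x) with hu
  have hlip : LipschitzWith ⟨H b, hH0 b hbI⟩ u := LipschitzWith.of_dist_le_mul fun x y => by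
    rw [Real.dist_eq, dist_eq_norm]
    refine (abs_sub_le_mul_of_monotone_deriv hFc hF hFm hHm (hpI y) (hpI x)
      (hHm (hpI y) hbI (hpI y).2) (hHm (hpI x) hbI (hpI x).2)).trans ?_
    exact mul_le_mul_of_nonneg_left (hp1 x y) (hH0 b hbI)
  have hHp : Continuous fun x => H (p x) := hHc.comp_continuous hpc hpI
  have hgrad : ∀ x, ‖fderiv ℝ u x‖ ≤ H (p x) := fun x => by
    refine le_of_forall_gt_imp_ge_of_dense fun C hC => ?_
    refine norm_fderiv_le_of_lip' ℝ ((hH0 _ (hpI x)).trans hC.le) ?_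
    filter_upwards [hHp.continuousAt.eventually_lt continuousAt_const hC] with y hy
    exact (abs_sub_le_mul_of_monotone_deriv hFc hF hFm hHm (hpI x) (hpI y) hC.le hy.le).trans
      (mul_le_mul_of_nonneg_left (hp1 y x) ((hH0 _ (hpI x)).trans hC.le))
  have hv : volume Ω ≤ ENNReal.ofReal (π * (b ^ 2 - a ^ 2)) := by
    rw [← hAab, hA, ENNReal.ofReal_toReal hfinΩ.ne]
  have hv' : ∀ ρ ∈ Set.Ico a b,
      volume {x ∈ Ω | ρ < p x} ≤ ENNReal.ofReal (π * (b ^ 2 - ρ ^ 2)) := fun ρ hρ => by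
    have hs : {x ∈ Ω | ρ < p x} = {x ∈ Ω | infDist x Γ < b - ρ} := by
      ext x
      simp only [Set.mem_ofPred_eq, hp, lt_max_iff, not_lt.2 hρ.1, false_or]
      exact and_congr_right fun _ => ⟨fun h => by linarith, fun h => by linarith⟩
    have hft : volume {x ∈ Ω | infDist x Γ < b - ρ} ≠ ⊤ :=
      ((measure_mono fun x hx => hx.1).trans_lt hfinΩ).ne
    have hc := hcollar (b - ρ) (by linarith [hρ.2]) (by linarith [hρ.1])
    rw [hs, ← ENNReal.ofReal_toReal hft]
    refine ENNReal.ofReal_le_ofReal (hc.trans_eq ?_)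
    rw [hLb]; ring
  have hD : ∫ x in Ω, ‖fderiv ℝ u x‖ ^ 2 ≤ 2 * π * ∫ r in a..b, H r ^ 2 * r := by
    refine le_trans ?_ (integral_comp_le hpc.measurable ha hab hpI hv hv' (Q := fun r => H r ^ 2)
      (hHc.pow 2) (fun x hx y hy hxy => pow_le_pow_left₀ (hH0 x hx) (hHm hx hy hxy) 2)
      fun r _ => sq_nonneg _)
    refine integral_mono (integrableOn_sq_norm_fderiv hlip hB)
      (((hHp.pow 2).continuousOn.integrableOn_compact hB.isCompact_closure).mono_set
        subset_closure) fun x => pow_le_pow_left₀ (norm_nonneg _) (hgrad x) 2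
  have hM : ∫ x in Ω, u x ^ 2 ≤ 2 * π * ∫ r in a..b, F r ^ 2 * r :=
    integral_comp_le hpc.measurable ha hab hpI hv hv' (Q := fun r => F r ^ 2)
      (hFc.pow 2) (fun x hx y hy hxy => pow_le_pow_left₀ (by linarith [hF1 x hx]) (hFm hx hy hxy) 2)
      fun r _ => sq_nonneg _
  have hM0 : 0 < ∫ x in Ω, u x ^ 2 := by
    refine hA0.trans_le ?_
    have h1 : ∫ _ in Ω, (1 : ℝ) = A := by simp [hA, Measure.real]
    rw [← h1]
    refine integral_mono (integrableOn_const hfinΩ.ne) (integrableOn_sq_of_lipschitzWith hlip hB)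
      fun x => ?_
    exact one_le_pow₀ (hF1 _ (hpI x))
  have hbd : L * F b ^ 2 ≤ ∫ x in frontier Ω, u x ^ 2 ∂μH[1] := by
    have h1 : ∫ x in Γ, u x ^ 2 ∂μH[1] = L * F b ^ 2 := by
      rw [setIntegral_congr_fun (g := fun _ => F b ^ 2) hΓ.measurableSet
        fun x hx => by simp only [hu, hpΓ x hx], setIntegral_const, hL]
      rfl
    rw [← h1]
    refine setIntegral_mono_set ?_ (ae_of_all _ fun x => sq_nonneg _) (ae_of_all _ hΓf)
    refine Measure.integrableOn_of_bounded hfin.ne (M := F b ^ 2)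
      (hlip.continuous.pow 2).aestronglyMeasurable (ae_of_all _ fun x => ?_)
    rw [Real.norm_of_nonneg (sq_nonneg _)]
    exact pow_le_pow_left₀ (by linarith [hF1 _ (hpI x)]) (hFm (hpI x) hbI (hpI x).2) 2
  refine ⟨u, _, hlip, hM0, le_trans ?_ hle⟩
  rw [div_le_iff₀ hM0]
  have h1 := mul_le_mul_of_nonneg_left hbd hβ.le
  have h2 := mul_le_mul_of_nonneg_left hM hk.le
  have h3 : 2 * π * ((∫ r in a..b, H r ^ 2 * r) - β * b * F b ^ 2) =
    2 * π * -(k * ∫ r in a..b, F r ^ 2 * r) := by rw [hen]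
  rw [hLb] at h1
  linarith

namespace PlaneLoop

/-- The curve traversed backwards. -/
def reverse (γ : PlaneLoop) : PlaneLoop where
  c s := γ.c (-s)
  c1 s := -γ.c1 (-s)
  c2 s := γ.c2 (-s)
  hasDerivAt_c s := ((γ.hasDerivAt_c (-s)).scomp s (hasDerivAt_neg s)).congr_deriv (by simp)
  hasDerivAt_c1 s := ((γ.hasDerivAt_c1 (-s)).scomp s (hasDerivAt_neg s)).neg.congr_deriv (by simp)
  continuous_c2 := γ.continuous_c2.comp continuous_neg
  periodic s := by
    have := γ.periodic (-(s + 1))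
    show γ.c (-(s + 1)) = γ.c (-s)
    rw [← this]; congr 1; ring
  injOn s hs t ht h := by
    have := γ.eq_of_c_eq (s := -s) (t := -t)
      (by rw [abs_lt]; constructor <;> linarith [hs.1, hs.2, ht.1, ht.2]) h
    linarith
  c1_ne_zero s := neg_ne_zero.2 (γ.c1_ne_zero _)

lemma range_reverse (γ : PlaneLoop) : Set.range γ.reverse.c = Set.range γ.c :=
  neg_surjective.range_comp γ.c

lemma tan_reverse (γ : PlaneLoop) (s : ℝ) : γ.reverse.tan s = -γ.tan (-s) := by
  rw [tan_eq, tan_eq]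
  simp [reverse, neg_div]

end PlaneLoop

section
variable {Ω : Set ℂ} {N : ℕ} {γ : Fin N → PlaneLoop}

lemma isBdry_of_frontier_eq_iUnion
    (hd : ∀ i j, i ≠ j → Disjoint (Set.range (γ i).c) (Set.range (γ j).c))
    (hf : frontier Ω = ⋃ i, Set.range (γ i).c) (i : Fin N) : (γ i).IsBdry Ω := by
  refine ⟨⋃ j : {j // j ≠ i}, Set.range (γ j).c,
    isClosed_iUnion_of_finite fun j => (γ j).isCompact_range_c.isClosed,
    Set.disjoint_iUnion_left.2 fun j => hd _ _ j.2, ?_⟩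
  rw [hf]
  ext x
  simp only [Set.mem_iUnion, Set.mem_union, Subtype.exists, exists_prop]
  constructor
  · rintro ⟨j, hj⟩
    by_cases h : j = i
    · exact Or.inr (h ▸ hj)
    · exact Or.inl ⟨j, h, hj⟩
  · rintro (⟨j, -, hj⟩ | h)
    exacts [⟨j, hj⟩, ⟨i, h⟩]

lemma traceLe_iUnion {ι : Type*} [Finite ι] {E : ι → Set ℂ} (h : ∀ i, TraceLe Ω (E i)) :
    TraceLe Ω (⋃ i, E i) := by
  cases nonempty_fintype ι
  classical
  have : ∀ s : Finset ι, TraceLe Ω (⋃ i ∈ s, E i) := fun s => by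
    induction s using Finset.induction_on with
    | empty => simpa using traceLe_empty Ω
    | insert i s _ ih =>
      rw [Finset.set_biUnion_insert]
      exact (h i).union ih
  simpa using this Finset.univ

lemma exists_isOuter (hO : IsOpen Ω) (hC : IsConnected Ω) (hB : Bornology.IsBounded Ω)
    (hd : ∀ i j, i ≠ j → Disjoint (Set.range (γ i).c) (Set.range (γ j).c))
    (hf : frontier Ω = ⋃ i, Set.range (γ i).c) : ∃ γ₀ : PlaneLoop, γ₀.IsOuter Ω := by
  obtain ⟨z₀, hz₀, hmin⟩ := hB.isCompact_closure.exists_isMinOn hC.nonempty.closure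
    Complex.continuous_im.continuousOn
  have hm : ∀ z ∈ closure Ω, z₀.im ≤ z.im := fun z hz => hmin hz
  have hfr : z₀ ∈ frontier Ω := by
    rw [hO.frontier_eq]
    refine ⟨hz₀, fun hz => ?_⟩
    obtain ⟨ε, hε, hb⟩ := Metric.isOpen_iff.1 hO z₀ hz
    have h1 : z₀ - (ε / 2 : ℝ) * Complex.I ∈ Ω := hb (by
      rw [mem_ball, dist_eq_norm]
      simp [abs_of_pos hε]
      linarith)
    have := hm _ (subset_closure h1)
    simp at this
    linarith
  rw [hf] at hfr
  obtain ⟨i, a, ha⟩ := Set.mem_iUnion.1 hfr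
  have hbd := isBdry_of_frontier_eq_iUnion hd hf i
  have hcl : ∀ s, (γ i).c s ∈ closure Ω := fun s =>
    frontier_subset_closure (hbd.range_subset ⟨s, rfl⟩)
  rw [← ha] at hm
  have hext : IsLocalExtr (fun s => ((γ i).c s).im) a :=
    Or.inl (Eventually.of_forall fun s => hm _ (hcl s))
  rcases (γ i).tan_eq_one_or_of_isLocalExtr hext with h | h
  · exact ⟨γ i, hbd.isOuter hO hC hB hm h⟩
  · have hbd' : (γ i).reverse.IsBdry Ω := by
      unfold PlaneLoop.IsBdry
      rw [PlaneLoop.range_reverse]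
      exact hbd
    refine ⟨(γ i).reverse, hbd'.isOuter hO hC hB (a := -a) ?_ ?_⟩
    · simpa [PlaneLoop.reverse] using hm
    · rw [PlaneLoop.tan_reverse, neg_neg, h, neg_neg]

end

/-- The Rayleigh quotients of Lipschitz test functions on a domain of the complex plane. -/
def complexRayleighSet (α : ℝ) (Ω : Set ℂ) : Set ℝ :=
  { lam : ℝ | ∃ (u : ℂ → ℝ) (K : NNReal),
      LipschitzOnWith K u (closure Ω) ∧
      (∫ x in Ω, (u x) ^ 2) ≠ 0 ∧
      lam = ((∫ x in Ω, ‖fderiv ℝ u x‖ ^ 2)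
              + α * ∫ x in frontier Ω, (u x) ^ 2 ∂μH[1])
            / (∫ x in Ω, (u x) ^ 2) }

theorem sInf_complexRayleighSet_le {α : ℝ} (hα : α ≤ 0) {Ω : Set ℂ} {N : ℕ}
    {γ : Fin N → PlaneLoop} (hO : IsOpen Ω) (hC : IsConnected Ω) (hB : Bornology.IsBounded Ω)
    (hd : ∀ i j, i ≠ j → Disjoint (Set.range (γ i).c) (Set.range (γ j).c))
    (hf : frontier Ω = ⋃ i, Set.range (γ i).c) :
    sInf (complexRayleighSet α Ω) ≤
      nrEig α (√((μH[1] (frontier (outerPart Ω))).toReal ^ 2 - 4 * π * (volume Ω).toReal) / (2 * π))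
        ((μH[1] (frontier (outerPart Ω))).toReal / (2 * π)) := by
  have hT : TraceLe Ω (frontier Ω) := by
    rw [hf]
    exact traceLe_iUnion fun i => (isBdry_of_frontier_eq_iUnion hd hf i).traceLe_range hO
  have hfin : μH[1] (frontier Ω) < ⊤ := by
    rw [hf]
    refine (measure_iUnion_le _).trans_lt ?_
    rw [tsum_fintype]
    exact ENNReal.sum_lt_top.2 fun i _ => (γ i).hausdorffMeasure_range_lt_top
  obtain ⟨C, hCb⟩ := hT.exists_const hO hB (neg_nonneg.2 hα)
  have hbdd : BddBelow (complexRayleighSet α Ω) := by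
    refine ⟨-C, ?_⟩
    rintro _ ⟨u, K, hu, hne, rfl⟩
    have hpos : 0 < ∫ x in Ω, u x ^ 2 :=
      lt_of_le_of_ne (integral_nonneg fun x => sq_nonneg _) hne.symm
    rw [le_div_iff₀ hpos]
    linarith [hCb u K hu]
  obtain ⟨γ₀, h₀⟩ := exists_isOuter hO hC hB hd hf
  rw [h₀.frontier_outerPart]
  obtain ⟨hcollar, hiso⟩ := h₀.collar_and_isoperimetric γ₀.len_le
  have hvol : volume Ω < ⊤ := hB.measure_lt_top
  rcases hα.eq_or_lt with rfl | hα'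
  · have h1 : 0 ≤ nrEig 0 (√((μH[1] (Set.range γ₀.c)).toReal ^ 2 - 4 * π * (volume Ω).toReal) /
        (2 * π)) ((μH[1] (Set.range γ₀.c)).toReal / (2 * π)) := by
      refine Real.sInf_nonneg ?_
      rintro _ ⟨ψ, -, -, rfl⟩
      have hab : √((μH[1] (Set.range γ₀.c)).toReal ^ 2 - 4 * π * (volume Ω).toReal) /
          (2 * π) ≤ (μH[1] (Set.range γ₀.c)).toReal / (2 * π) := by
        gcongr
        refine Real.sqrt_le_iff.2 ⟨ENNReal.toReal_nonneg, ?_⟩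
        have : 0 ≤ 4 * π * (volume Ω).toReal := by positivity
        linarith
      have hnn : ∀ g : ℝ → ℝ, 0 ≤ ∫ r in (√((μH[1] (Set.range γ₀.c)).toReal ^ 2 -
          4 * π * (volume Ω).toReal) / (2 * π))..((μH[1] (Set.range γ₀.c)).toReal / (2 * π)),
          g r ^ 2 * r := fun g =>
        intervalIntegral.integral_nonneg hab fun r hr =>
          mul_nonneg (sq_nonneg _) (le_trans (by positivity) hr.1)
      simp only [zero_mul, add_zero]
      exact div_nonneg (hnn _) (hnn _)
    refine le_trans (csInf_le hbdd ⟨fun _ => 1, 0, (LipschitzWith.const 1).lipschitzOnWith, ?_, ?_⟩) h1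
    · simpa [Measure.real] using (ENNReal.toReal_pos (hO.measure_pos _ hC.nonempty).ne' hvol.ne).ne'
    · simp
  · obtain ⟨u, K, hu, hM, hle⟩ := exists_test_function hO hB hC.nonempty
      γ₀.isCompact_range_c.isClosed h₀.range_subset hfin (neg_pos.2 hα') rfl hcollar hiso
    rw [neg_neg] at hle
    refine le_trans (csInf_le hbdd ⟨u, K, hu.lipschitzOnWith, hM.ne', ?_⟩) hle
    rw [neg_mul, sub_neg_eq_add]

/-- The standard isometry from the complex plane to the Euclidean plane. -/
def complexIso : ℂ ≃ₗᵢ[ℝ] Eu 2 := Complex.orthonormalBasisOneI.repr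

lemma complexIso_preimage_outerPart (Ω : Set (Eu 2)) :
    outerPart (complexIso ⁻¹' Ω) = complexIso ⁻¹' outerPart Ω := by
  have hcl : closure (complexIso ⁻¹' Ω) = complexIso ⁻¹' closure Ω :=
    (complexIso.toHomeomorph.preimage_closure Ω).symm
  ext x
  simp only [outerPart, Set.mem_ofPred_eq, Set.mem_preimage, hcl]
  refine and_congr Iff.rfl ?_
  by_cases hx : complexIso x ∈ (closure Ω)ᶜ
  swap
  · rw [connectedComponentIn_eq_empty hx, connectedComponentIn_eq_empty (by exact hx)]
    simp
  have himg : complexIso '' connectedComponentIn (complexIso ⁻¹' closure Ω)ᶜ x =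
      connectedComponentIn (closure Ω)ᶜ (complexIso x) := by
    have := complexIso.toHomeomorph.image_connectedComponentIn
      (s := (complexIso ⁻¹' closure Ω)ᶜ) (x := x) hx
    refine this.trans ?_
    congr 1
    exact Set.image_preimage_eq (closure Ω)ᶜ complexIso.surjective
  rw [← himg, not_iff_not]
  refine ⟨fun h => complexIso.lipschitz.isBounded_image h, fun h => ?_⟩
  have := complexIso.antilipschitz.isBounded_preimage h
  rwa [Set.preimage_image_eq _ complexIso.injective] at this

lemma setIntegral_complexIso (Ω : Set (Eu 2)) (g : Eu 2 → ℝ) :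
    ∫ x in complexIso ⁻¹' Ω, g (complexIso x) = ∫ x in Ω, g x :=
  complexIso.measurePreserving.setIntegral_preimage_emb
    complexIso.toHomeomorph.measurableEmbedding g Ω

lemma setIntegral_hausdorff_complexIso (Ω : Set (Eu 2)) (g : Eu 2 → ℝ) :
    ∫ x in complexIso ⁻¹' Ω, g (complexIso x) ∂μH[1] = ∫ x in Ω, g x ∂μH[1] :=
  (complexIso.toIsometryEquiv.measurePreserving_hausdorffMeasure 1).setIntegral_preimage_emb
    complexIso.toHomeomorph.measurableEmbedding g Ω

lemma norm_fderiv_comp_complexIso (u : Eu 2 → ℝ) (x : ℂ) :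
    ‖fderiv ℝ (fun z => u (complexIso z)) x‖ = ‖fderiv ℝ u (complexIso x)‖ := by
  have := complexIso.toContinuousLinearEquiv.comp_right_fderiv (f := u) (x := x)
  have e : (fun z => u (complexIso z)) = u ∘ complexIso.toContinuousLinearEquiv := rfl
  rw [e, this]
  exact ContinuousLinearMap.opNorm_comp_linearIsometryEquiv _ complexIso

lemma robinRayleighSet_eq (α : ℝ) (Ω : Set (Eu 2)) :
    robinRayleighSet 2 α Ω = complexRayleighSet α (complexIso ⁻¹' Ω) := by
  have hcl : closure (complexIso ⁻¹' Ω) = complexIso ⁻¹' closure Ω :=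
    (complexIso.toHomeomorph.preimage_closure Ω).symm
  have hfr : frontier (complexIso ⁻¹' Ω) = complexIso ⁻¹' frontier Ω :=
    (complexIso.toHomeomorph.preimage_frontier Ω).symm
  have h1 : ((2 : ℕ) : ℝ) - 1 = 1 := by norm_num
  have e1 : ∀ u : Eu 2 → ℝ, ∫ x in complexIso ⁻¹' Ω, u (complexIso x) ^ 2 = ∫ x in Ω, u x ^ 2 :=
    fun u => setIntegral_complexIso Ω fun x => u x ^ 2
  have e2 : ∀ u : Eu 2 → ℝ, ∫ x in complexIso ⁻¹' frontier Ω, u (complexIso x) ^ 2 ∂μH[1] =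
      ∫ x in frontier Ω, u x ^ 2 ∂μH[1] :=
    fun u => setIntegral_hausdorff_complexIso _ fun x => u x ^ 2
  have e3 : ∀ u : Eu 2 → ℝ,
      ∫ x in complexIso ⁻¹' Ω, ‖fderiv ℝ (fun z => u (complexIso z)) x‖ ^ 2 =
        ∫ x in Ω, ‖fderiv ℝ u x‖ ^ 2 := fun u => by
    simp only [norm_fderiv_comp_complexIso]
    exact setIntegral_complexIso Ω fun x => ‖fderiv ℝ u x‖ ^ 2
  ext lam
  simp only [robinRayleighSet, complexRayleighSet, h1, hcl, hfr, Set.mem_ofPred_eq]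
  constructor
  · rintro ⟨u, K, hu, hne, rfl⟩
    refine ⟨fun z => u (complexIso z), K, ?_, ?_, ?_⟩
    · have := hu.comp (complexIso.lipschitz.lipschitzOnWith (s := complexIso ⁻¹' closure Ω))
        (fun x hx => hx)
      rwa [mul_one] at this
    · rwa [e1]
    · rw [e1, e2, e3]
  · rintro ⟨v, K, hv, hne, rfl⟩
    obtain ⟨u, rfl⟩ : ∃ u : Eu 2 → ℝ, v = fun z => u (complexIso z) :=
      ⟨fun x => v (complexIso.symm x), by simp⟩
    rw [e1] at hne
    refine ⟨u, K, ?_, hne, ?_⟩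
    · have := hv.comp (complexIso.symm.lipschitz.lipschitzOnWith (s := closure Ω))
        (fun x hx => by simpa using hx)
      rw [mul_one] at this
      simpa [Function.comp_def] using this
    · rw [e1, e2, e3]

lemma IsC2JordanCurve.exists_planeLoop {c : ℝ → Eu 2} (h : IsC2JordanCurve c) :
    ∃ γ : PlaneLoop, ∀ s, γ.c s = complexIso.symm (c s) := by
  obtain ⟨hc, hp, hi, hd⟩ := h
  have hc' : ContDiff ℝ 1 (deriv c) := ((contDiff_succ_iff_deriv (n := 1)).1 (by
    simpa [one_add_one_eq_two] using hc)).2.2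
  have hL : ∀ {f : ℝ → Eu 2} {f' : Eu 2} {s : ℝ}, HasDerivAt f f' s →
      HasDerivAt (fun t => complexIso.symm (f t)) (complexIso.symm f') s := fun {f f' s} hf =>
    complexIso.symm.toContinuousLinearEquiv.hasFDerivAt.comp_hasDerivAt s hf
  refine ⟨{ c := fun s => complexIso.symm (c s)
            c1 := fun s => complexIso.symm (deriv c s)
            c2 := fun s => complexIso.symm (deriv (deriv c) s)
            hasDerivAt_c := fun s => hL ((hc.differentiable (by norm_num)) s).hasDerivAt
            hasDerivAt_c1 := fun s => hL ((hc'.differentiable (by norm_num)) s).hasDerivAt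
            continuous_c2 := complexIso.symm.continuous.comp (hc'.continuous_deriv le_rfl)
            periodic := fun s => by simp only [hp s]
            injOn := fun s hs t ht hst => hi s hs t ht (complexIso.symm.injective hst)
            c1_ne_zero := fun s => by simpa using hd s }, fun s => rfl⟩

end Plane

theorem robin_eigenvalue_le_neumann_robin_annulus
    (α : ℝ) (hα : α ≤ 0) (Ω : Set (Eu 2)) (hΩ : IsC2Domain Ω) :
    robinEig 2 α Ω ≤
      nrEig α (Real.sqrt ((outerPerim Ω) ^ 2 - 4 * π * (volume Ω).toReal) / (2 * π))
              (outerPerim Ω / (2 * π)) := by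
  obtain ⟨hO, hC, hB, N, c, hc, hd, hf⟩ := hΩ
  choose γ hγ using fun i => (hc i).exists_planeLoop
  have hr : ∀ i, Set.range (γ i).c = complexIso ⁻¹' Set.range (c i) := fun i => by
    ext z
    simp only [Set.mem_range, Set.mem_preimage, hγ, LinearIsometryEquiv.symm_apply_eq]
  have hfr : frontier (complexIso ⁻¹' Ω) = complexIso ⁻¹' frontier Ω :=
    (complexIso.toHomeomorph.preimage_frontier Ω).symm
  have hper : (μH[1] (frontier (outerPart (complexIso ⁻¹' Ω)))).toReal = outerPerim Ω := by
    have e : frontier (outerPart (complexIso ⁻¹' Ω)) = complexIso ⁻¹' outerBoundary Ω := by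
      rw [complexIso_preimage_outerPart]
      exact (complexIso.toHomeomorph.preimage_frontier _).symm
    rw [e, outerPerim]
    congr 1
    exact complexIso.toIsometryEquiv.hausdorffMeasure_preimage 1 _
  have hvol : volume (complexIso ⁻¹' Ω) = volume Ω :=
    complexIso.measurePreserving.measure_preimage hO.measurableSet.nullMeasurableSet
  rw [robinEig, robinRayleighSet_eq, ← hper, ← hvol]
  refine sInf_complexRayleighSet_le hα (γ := γ) (hO.preimage complexIso.continuous)
    ?_ ?_ (fun i j hij => ?_) ?_
  · exact complexIso.toHomeomorph.isConnected_preimage.2 hC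
  · exact complexIso.antilipschitz.isBounded_preimage hB
  · rw [hr, hr]
    exact (hd i j hij).preimage _
  · simp only [hr, hfr, hf, Set.preimage_iUnion]

end
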